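/- arXiv:1508.02734 — 2 statements merged into one kernel-verified Lean document; each statement's English description precedes it below -/
import Mathlib

section
/- Let Ω ⊂ ℝ² be a bounded open convex domain and let H ≠ 0 be a constant. Then any solution u of the spacelike constant mean curvature Dirichlet problem on Ω with mean curvature H has exactly one critical point in Ω. -/
open Real Set

/-- First partial derivative (in the x-direction) of `f : ℝ × ℝ → ℝ`. -/
noncomputable def pd1 (f : ℝ × ℝ → ℝ) (x : ℝ × ℝ) : ℝ := fderiv ℝ f x (1, 0)

/-- Second partial derivative (in the y-direction) of `f : ℝ × ℝ → ℝ`. -/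
noncomputable def pd2 (f : ℝ × ℝ → ℝ) (x : ℝ × ℝ) : ℝ := fderiv ℝ f x (0, 1)

/-- Squared norm of the Euclidean gradient `|∇f|²`. -/
noncomputable def gradSq (f : ℝ × ℝ → ℝ) (x : ℝ × ℝ) : ℝ := (pd1 f x)^2 + (pd2 f x)^2

/-- The spacelike mean curvature operator `div (∇u / √(1 - |∇u|²))`. -/
noncomputable def cmcDiv (f : ℝ × ℝ → ℝ) (x : ℝ × ℝ) : ℝ :=
  pd1 (fun y => pd1 f y / Real.sqrt (1 - gradSq f y)) x +
  pd2 (fun y => pd2 f y / Real.sqrt (1 - gradSq f y)) x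

/-- `u` is a solution of the spacelike CMC Dirichlet problem on `Ω` with mean curvature `H`:
`u` is smooth on the closure of `Ω`, spacelike (`|∇u| < 1`), satisfies
`div(∇u/√(1-|∇u|²)) = 2H` on `Ω`, and vanishes on `∂Ω`. -/
def IsCMCSol (Ω : Set (ℝ × ℝ)) (H : ℝ) (u : ℝ × ℝ → ℝ) : Prop :=
  ContDiffOn ℝ (⊤ : ℕ∞) u (closure Ω) ∧ (∀ x ∈ Ω, gradSq u x < 1) ∧
  (∀ x ∈ Ω, cmcDiv u x = 2 * H) ∧ (∀ x ∈ frontier Ω, u x = 0)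

/-- Directional derivative of `f` at `x` along `v`. -/
noncomputable def dd (v : ℝ × ℝ) (f : ℝ × ℝ → ℝ) (x : ℝ × ℝ) : ℝ := fderiv ℝ f x v

section Basics

variable {Ω : Set (ℝ × ℝ)} {f g : ℝ × ℝ → ℝ} {x p v w : ℝ × ℝ}

lemma pd1_eq_dd : pd1 = dd (1, 0) := rfl

lemma pd2_eq_dd : pd2 = dd (0, 1) := rfl

lemma dd_eq (v : ℝ × ℝ) (f : ℝ × ℝ → ℝ) (x : ℝ × ℝ) :
    dd v f x = v.1 * dd (1, 0) f x + v.2 * dd (0, 1) f x := by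
  have : v = v.1 • ((1 : ℝ), (0 : ℝ)) + v.2 • ((0 : ℝ), (1 : ℝ)) := by
    ext <;> simp
  conv_lhs => rw [dd, this, map_add, map_smul, map_smul]
  rfl

lemma diffAt_of_smooth (hΩ : IsOpen Ω) (hf : ContDiffOn ℝ (⊤ : ℕ∞) f Ω) (hx : x ∈ Ω) :
    DifferentiableAt ℝ f x :=
  ((hf.contDiffAt (hΩ.mem_nhds hx)).differentiableAt (by simp))

lemma smooth_dd (hΩ : IsOpen Ω) (hf : ContDiffOn ℝ (⊤ : ℕ∞) f Ω) (v : ℝ × ℝ) :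
    ContDiffOn ℝ (⊤ : ℕ∞) (dd v f) Ω := by
  have h : ContDiffOn ℝ (⊤ : ℕ∞) (fderiv ℝ f) Ω := by
    refine hf.fderiv_of_isOpen hΩ ?_
    exact le_rfl
  exact h.clm_apply contDiffOn_const

lemma dd_add (hf : DifferentiableAt ℝ f x) (hg : DifferentiableAt ℝ g x) :
    dd v (fun y => f y + g y) x = dd v f x + dd v g x := by
  rw [dd, fderiv_fun_add hf hg]; rfl

lemma dd_sub (hf : DifferentiableAt ℝ f x) (hg : DifferentiableAt ℝ g x) :
    dd v (fun y => f y - g y) x = dd v f x - dd v g x := by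
  rw [dd, fderiv_fun_sub hf hg]; rfl

lemma dd_neg : dd v (fun y => - f y) x = - dd v f x := by
  rw [dd, fderiv_fun_neg]; rfl

lemma dd_const (c : ℝ) : dd v (fun _ => c) x = 0 := by
  simp [dd]

lemma dd_mul (hf : DifferentiableAt ℝ f x) (hg : DifferentiableAt ℝ g x) :
    dd v (fun y => f y * g y) x = dd v f x * g x + f x * dd v g x := by
  rw [dd, fderiv_fun_mul hf hg]; simp [dd]; ring

lemma dd_comp {h : ℝ → ℝ} {h' : ℝ} (hh : HasDerivAt h h' (f x)) (hf : DifferentiableAt ℝ f x) :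
    dd v (fun y => h (f y)) x = h' * dd v f x := by
  have := (hh.comp_hasFDerivAt x hf.hasFDerivAt).fderiv
  rw [dd]
  change fderiv ℝ (h ∘ f) x v = _
  rw [this]; simp [dd]

lemma dd_congr (hΩ : IsOpen Ω) (h : EqOn f g Ω) (hx : x ∈ Ω) : dd v f x = dd v g x := by
  have : f =ᶠ[nhds x] g := h.eventuallyEq_of_mem (hΩ.mem_nhds hx)
  rw [dd, this.fderiv_eq]; rfl

lemma dd_comm (hΩ : IsOpen Ω) (hf : ContDiffOn ℝ (⊤ : ℕ∞) f Ω) (hx : x ∈ Ω) :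
    dd v (dd w f) x = dd w (dd v f) x := by
  have hc : ContDiffAt ℝ (⊤ : ℕ∞) f x := hf.contDiffAt (hΩ.mem_nhds hx)
  have hd : DifferentiableAt ℝ (fderiv ℝ f) x :=
    (hc.fderiv_right (m := 1) (WithTop.coe_le_coe.2 (le_top : (1 + 1 : ℕ∞) ≤ ⊤))).differentiableAt (by simp)
  have hs : IsSymmSndFDerivAt ℝ f x := hc.isSymmSndFDerivAt (by
    simp only [minSmoothness_of_isRCLikeNormedField]
    exact WithTop.coe_le_coe.2 (le_top : (2 : ℕ∞) ≤ ⊤))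
  have key : ∀ a b : ℝ × ℝ, dd a (dd b f) x = fderiv ℝ (fderiv ℝ f) x a b := by
    intro a b
    have : dd b f = fun y => fderiv ℝ f y b := rfl
    rw [dd, this, fderiv_clm_apply hd (differentiableAt_const _)]
    simp
  rw [key, key]; exact hs.eq v w

lemma dd_eq_zero_of (h1 : dd (1, 0) f x = 0) (h2 : dd (0, 1) f x = 0) : dd v f x = 0 := by
  rw [dd_eq, h1, h2]; simp

lemma fderiv_norm_le {M : ℝ} (h1 : |dd (1, 0) f x| ≤ M) (h2 : |dd (0, 1) f x| ≤ M) :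
    ‖fderiv ℝ f x‖ ≤ 2 * M := by
  have hM : 0 ≤ M := (abs_nonneg _).trans h1
  refine ContinuousLinearMap.opNorm_le_bound _ (by positivity) fun v => ?_
  have := dd_eq v f x
  rw [dd] at this
  rw [this, Real.norm_eq_abs]
  have a1 : |v.1| ≤ ‖v‖ := norm_fst_le v
  have a2 : |v.2| ≤ ‖v‖ := norm_snd_le v
  calc |v.1 * dd (1, 0) f x + v.2 * dd (0, 1) f x|
      ≤ |v.1| * |dd (1, 0) f x| + |v.2| * |dd (0, 1) f x| := by
        rw [← abs_mul, ← abs_mul]; exact abs_add_le _ _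
    _ ≤ ‖v‖ * M + ‖v‖ * M := by gcongr
    _ = 2 * M * ‖v‖ := by ring

/-- Derivative of `f` along a line. -/
lemma hasDerivAt_line {s : ℝ} (hf : DifferentiableAt ℝ f (p + s • v)) :
    HasDerivAt (fun s : ℝ => f (p + s • v)) (dd v f (p + s • v)) s := by
  have h1 : HasDerivAt (fun s : ℝ => p + s • v) v s := by
    simpa using ((hasDerivAt_id s).smul_const v).const_add p
  exact hf.hasFDerivAt.comp_hasDerivAt s h1

end Basics

section Van

variable {Ω : Set (ℝ × ℝ)} {f g : ℝ × ℝ → ℝ} {p : ℝ × ℝ}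

/-- `f` vanishes to order `m` at `p`: all its derivatives of order `< m` vanish at `p`. -/
def Van (p : ℝ × ℝ) : ℕ → (ℝ × ℝ → ℝ) → Prop
  | 0, _ => True
  | m + 1, f => f p = 0 ∧ ∀ v, Van p m (dd v f)

lemma Van.congr (hΩ : IsOpen Ω) (hp : p ∈ Ω) {m : ℕ} (h : EqOn f g Ω) (hf : Van p m f) :
    Van p m g := by
  induction m generalizing f g with
  | zero => trivial
  | succ m ih =>
    refine ⟨by rw [← h hp]; exact hf.1, fun v => ih (fun x hx => dd_congr hΩ h hx) (hf.2 v)⟩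

lemma Van.mono {m : ℕ} (hf : Van p (m + 1) f) : Van p m f := by
  induction m generalizing f with
  | zero => trivial
  | succ m ih => exact ⟨hf.1, fun v => ih (hf.2 v)⟩

lemma Van.mono_le {m k : ℕ} (h : k ≤ m) (hf : Van p m f) : Van p k f := by
  induction h with
  | refl => exact hf
  | step _ ih => exact ih hf.mono

lemma Van.add (hΩ : IsOpen Ω) (hp : p ∈ Ω) {m : ℕ} (hfs : ContDiffOn ℝ (⊤ : ℕ∞) f Ω)
    (hgs : ContDiffOn ℝ (⊤ : ℕ∞) g Ω) (hf : Van p m f) (hg : Van p m g) :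
    Van p m (fun x => f x + g x) := by
  induction m generalizing f g with
  | zero => trivial
  | succ m ih =>
    refine ⟨by simp [hf.1, hg.1], fun v => ?_⟩
    refine (ih (smooth_dd hΩ hfs v) (smooth_dd hΩ hgs v) (hf.2 v) (hg.2 v)).congr hΩ hp ?_
    intro x hx
    exact (dd_add (diffAt_of_smooth hΩ hfs hx) (diffAt_of_smooth hΩ hgs hx)).symm

lemma Van.mul (hΩ : IsOpen Ω) (hp : p ∈ Ω) {m k : ℕ} (hfs : ContDiffOn ℝ (⊤ : ℕ∞) f Ω)
    (hgs : ContDiffOn ℝ (⊤ : ℕ∞) g Ω) (hf : Van p m f) (hg : Van p k g) :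
    Van p (m + k) (fun x => f x * g x) := by
  obtain ⟨j, hj⟩ : ∃ j, j = m + k := ⟨_, rfl⟩
  rw [← hj]
  induction j generalizing m k f g with
  | zero => trivial
  | succ j ih =>
    refine ⟨?_, fun v => ?_⟩
    · cases m with
      | succ m => simp [hf.1]
      | zero =>
        cases k with
        | zero => omega
        | succ k => simp [hg.1]
    have hfv := smooth_dd hΩ hfs v
    have hgv := smooth_dd hΩ hgs v
    have h1 : Van p j (fun x => dd v f x * g x) := by
      cases m with
      | succ m => exact ih hfv hgs (hf.2 v) hg (by omega)
      | zero =>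
        cases k with
        | zero => omega
        | succ k => exact ih (m := 0) hfv hgs trivial hg.mono (by omega)
    have h2 : Van p j (fun x => f x * dd v g x) := by
      cases k with
      | succ k => exact ih hfs hgv hf (hg.2 v) (by omega)
      | zero =>
        cases m with
        | zero => omega
        | succ m => exact ih (k := 0) hfs hgv hf.mono trivial (by omega)
    refine (h1.add hΩ hp (hfv.mul hgs) (hfs.mul hgv) h2).congr hΩ hp ?_
    intro x hx
    exact (dd_mul (diffAt_of_smooth hΩ hfs hx) (diffAt_of_smooth hΩ hgs hx)).symm

lemma Van.const_mul (hΩ : IsOpen Ω) (hp : p ∈ Ω) {m : ℕ} (hfs : ContDiffOn ℝ (⊤ : ℕ∞) f Ω)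
    (hf : Van p m f) (c : ℝ) : Van p m (fun x => c * f x) := by
  have := Van.mul (m := 0) hΩ hp (f := fun _ => c) contDiffOn_const hfs trivial hf
  simpa using this

/-- Strict positivity along a ray from positivity of the leading derivative. -/
lemma Van.pos_on_ray (hΩ : IsOpen Ω) (hp : p ∈ Ω) {m : ℕ} (hfs : ContDiffOn ℝ (⊤ : ℕ∞) f Ω)
    (hf : Van p m f) {e : ℝ × ℝ} (he : 0 < (dd e)^[m] f p) :
    ∃ ε > 0, ∀ s ∈ Ioc (0 : ℝ) ε, p + s • e ∈ Ω ∧ 0 < f (p + s • e) := by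
  have hcont : Continuous fun s : ℝ => p + s • e := by fun_prop
  have h0 : p + (0 : ℝ) • e = p := by simp
  induction m generalizing f with
  | zero =>
    have hc : ContinuousAt (fun s : ℝ => f (p + s • e)) 0 := by
      refine ContinuousAt.comp (f := fun s : ℝ => p + s • e) ?_ hcont.continuousAt
      rw [h0]; exact (diffAt_of_smooth hΩ hfs hp).continuousAt
    have h1 : ∀ᶠ s in nhds (0 : ℝ), 0 < f (p + s • e) := by
      refine continuousAt_const.eventually_lt hc ?_
      rw [h0]; exact he
    have h2 : ∀ᶠ s in nhds (0 : ℝ), p + s • e ∈ Ω := by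
      refine hcont.continuousAt.eventually_mem ?_
      rw [h0]; exact hΩ.mem_nhds hp
    obtain ⟨ε, hε, h⟩ := Metric.eventually_nhds_iff.1 (h1.and h2)
    refine ⟨ε / 2, by positivity, fun s hs => ?_⟩
    have := h (y := s) (by rw [Real.dist_eq, sub_zero, abs_of_pos hs.1]; linarith [hs.2])
    exact ⟨this.2, this.1⟩
  | succ m ih =>
    obtain ⟨ε, hε, h⟩ := ih (smooth_dd hΩ hfs e) (hf.2 e) he
    refine ⟨ε, hε, fun s hs => ⟨(h s hs).1, ?_⟩⟩
    have hmem : ∀ r ∈ Icc 0 s, p + r • e ∈ Ω := by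
      intro r hr
      rcases hr.1.eq_or_lt with rfl | h0
      · simpa using hp
      · exact (h r ⟨h0, hr.2.trans hs.2⟩).1
    have hmono : StrictMonoOn (fun r : ℝ => f (p + r • e)) (Icc 0 s) := by
      refine strictMonoOn_of_deriv_pos (convex_Icc _ _) ?_ ?_
      · intro r hr
        exact (hasDerivAt_line (diffAt_of_smooth hΩ hfs (hmem r hr))).continuousAt.continuousWithinAt
      · intro r hr
        rw [interior_Icc] at hr
        rw [(hasDerivAt_line (diffAt_of_smooth hΩ hfs (hmem r ⟨hr.1.le, hr.2.le⟩))).deriv]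
        exact (h r ⟨hr.1, hr.2.le.trans hs.2⟩).2
    have := hmono (left_mem_Icc.2 hs.1.le) (right_mem_Icc.2 hs.1.le) hs.1
    simpa [hf.1] using this

lemma Van.bound (hΩ : IsOpen Ω) (hp : p ∈ Ω) {m : ℕ} (hfs : ContDiffOn ℝ (⊤ : ℕ∞) f Ω)
    (hf : Van p m f) :
    ∃ C > 0, ∃ r > 0, ∀ x, ‖x - p‖ < r → x ∈ Ω ∧ |f x| ≤ C * ‖x - p‖ ^ m := by
  induction m generalizing f with
  | zero =>
    have hc : ContinuousAt f p := (diffAt_of_smooth hΩ hfs hp).continuousAt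
    have h1 : ∀ᶠ x in nhds p, |f x| < |f p| + 1 :=
      hc.abs.eventually_lt continuousAt_const (by linarith)
    obtain ⟨ε, hε, h⟩ := Metric.eventually_nhds_iff.1 (h1.and (hΩ.mem_nhds hp))
    refine ⟨|f p| + 1, by positivity, ε, hε, fun x hx => ?_⟩
    have := h (y := x) (by rwa [dist_eq_norm])
    exact ⟨this.2, by simpa using this.1.le⟩
  | succ m ih =>
    obtain ⟨C1, hC1, r1, hr1, h1⟩ := ih (smooth_dd hΩ hfs (1, 0)) (hf.2 _)
    obtain ⟨C2, hC2, r2, hr2, h2⟩ := ih (smooth_dd hΩ hfs (0, 1)) (hf.2 _)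
    refine ⟨2 * (C1 + C2), by positivity, min r1 r2, by positivity, fun x hx => ?_⟩
    have hx1 := hx.trans_le (min_le_left _ _)
    have hx2 := hx.trans_le (min_le_right _ _)
    refine ⟨(h1 x hx1).1, ?_⟩
    have key := Convex.norm_image_sub_le_of_norm_fderiv_le (𝕜 := ℝ) (f := f)
      (s := Metric.closedBall p ‖x - p‖) (C := 2 * ((C1 + C2) * ‖x - p‖ ^ m)) (x := p) (y := x)
      ?_ ?_ (convex_closedBall _ _) (by simp) (by simp [dist_eq_norm])
    · rw [hf.1, sub_zero, Real.norm_eq_abs] at key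
      calc _ ≤ _ := key
        _ = _ := by ring
    · intro y hy
      have hy' : ‖y - p‖ ≤ ‖x - p‖ := by simpa [dist_eq_norm] using hy
      exact diffAt_of_smooth hΩ hfs (h1 y (hy'.trans_lt hx1)).1
    · intro y hy
      have hy' : ‖y - p‖ ≤ ‖x - p‖ := by simpa [dist_eq_norm] using hy
      have b1 := (h1 y (hy'.trans_lt hx1)).2
      have b2 := (h2 y (hy'.trans_lt hx2)).2
      have hpow : ‖y - p‖ ^ m ≤ ‖x - p‖ ^ m := by gcongr
      have hpow0 : 0 ≤ ‖x - p‖ ^ m := by positivity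
      apply fderiv_norm_le
      · exact b1.trans (by nlinarith)
      · exact b2.trans (by nlinarith)

lemma van_of_eventually_const_closure (hΩ : IsOpen Ω) (hp : p ∈ Ω)
    (hfs : ContDiffOn ℝ (⊤ : ℕ∞) f Ω)
    (h : p ∈ closure {y | ∀ᶠ z in nhds y, f z = 0}) (m : ℕ) : Van p m f := by
  induction m generalizing f with
  | zero => trivial
  | succ m ih =>
    refine ⟨?_, fun v => ih (smooth_dd hΩ hfs v) (closure_mono ?_ h)⟩
    · have hc : ContinuousAt f p := (diffAt_of_smooth hΩ hfs hp).continuousAt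
      have hmem : f p ∈ closure (f '' {y | ∀ᶠ z in nhds y, f z = 0}) :=
        hc.continuousWithinAt.mem_closure_image h
      have hsub : f '' {y | ∀ᶠ z in nhds y, f z = 0} ⊆ {0} := by
        rintro _ ⟨y, hy, rfl⟩
        exact hy.self_of_nhds
      simpa using closure_mono hsub hmem
    · intro y hy
      have hy' : f =ᶠ[nhds y] fun _ => 0 := hy
      filter_upwards [hy'.fderiv (𝕜 := ℝ)] with z hz
      rw [dd, hz]; simp

end Van

section Lead

variable {Ω : Set (ℝ × ℝ)} {f g : ℝ × ℝ → ℝ} {p : ℝ × ℝ}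

/-- The complex number attached to a plane vector. -/
def toC (v : ℝ × ℝ) : ℂ := ⟨v.1, v.2⟩

/-- The derivatives of order `m` of `f` at `p` are those of `Re (Z z ^ m) / m!`. -/
def Lead (p : ℝ × ℝ) : ℕ → (ℝ × ℝ → ℝ) → ℂ → Prop
  | 0, f, Z => f p = Z.re
  | m + 1, f, Z => ∀ v, Lead p m (dd v f) (Z * toC v)

lemma Lead.congr (hΩ : IsOpen Ω) (hp : p ∈ Ω) {m : ℕ} {Z : ℂ} (h : EqOn f g Ω)
    (hf : Lead p m f Z) : Lead p m g Z := by
  induction m generalizing f g Z with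
  | zero => exact (h hp).symm.trans hf
  | succ m ih => exact fun v => ih (fun x hx => dd_congr hΩ h hx) (hf v)

lemma Lead.lin (hΩ : IsOpen Ω) (hp : p ∈ Ω) {m : ℕ} {Z W : ℂ} (a b : ℝ)
    (hfs : ContDiffOn ℝ (⊤ : ℕ∞) f Ω) (hgs : ContDiffOn ℝ (⊤ : ℕ∞) g Ω)
    (hf : Lead p m f Z) (hg : Lead p m g W) :
    Lead p m (fun x => a * f x + b * g x) (a * Z + b * W) := by
  induction m generalizing f g Z W with
  | zero =>
    change f p = Z.re at hf
    change g p = W.re at hg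
    change a * f p + b * g p = _
    simp [hf, hg]
  | succ m ih =>
    intro v
    have := ih (smooth_dd hΩ hfs v) (smooth_dd hΩ hgs v) (hf v) (hg v)
    rw [show (a * Z + b * W) * toC v = a * (Z * toC v) + b * (W * toC v) by ring]
    refine this.congr hΩ hp fun x hx => ?_
    have d1 := diffAt_of_smooth hΩ hfs hx
    have d2 := diffAt_of_smooth hΩ hgs hx
    rw [dd_add (d1.const_mul a) (d2.const_mul b), dd_mul (differentiableAt_const _) d1,
      dd_mul (differentiableAt_const _) d2, dd_const, dd_const]
    ring

lemma Lead.iterate {m : ℕ} {Z : ℂ} (hf : Lead p m f Z) (e : ℝ × ℝ) :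
    (dd e)^[m] f p = (Z * toC e ^ m).re := by
  induction m generalizing f Z with
  | zero => simpa [Lead] using hf
  | succ m ih =>
    rw [Function.iterate_succ_apply, ih (hf e), pow_succ']
    congr 1; ring

lemma Lead.van {m : ℕ} (hf : Lead p m f 0) (hv : Van p m f) : Van p (m + 1) f := by
  induction m generalizing f with
  | zero => exact ⟨by simpa [Lead] using hf, fun v => trivial⟩
  | succ m ih => exact ⟨hv.1, fun v => ih (by simpa using hf v) (hv.2 v)⟩

lemma Van.iterate {m : ℕ} (hf : Van p (m + 1) f) (e : ℝ × ℝ) : (dd e)^[m] f p = 0 := by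
  induction m generalizing f with
  | zero => exact hf.1
  | succ m ih => rw [Function.iterate_succ_apply]; exact ih (hf.2 e)

lemma exists_lead (hΩ : IsOpen Ω) (hp : p ∈ Ω) {m : ℕ} (hfs : ContDiffOn ℝ (⊤ : ℕ∞) f Ω)
    (hv : Van p (m + 1) f)
    (hl : Van p m fun x => dd (1, 0) (dd (1, 0) f) x + dd (0, 1) (dd (0, 1) f) x) :
    ∃ Z, Lead p (m + 1) f Z := by
  induction m generalizing f with
  | zero =>
    refine ⟨⟨dd (1, 0) f p, - dd (0, 1) f p⟩, fun v => ?_⟩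
    rw [Lead, dd_eq]; simp [toC]; ring
  | succ m ih =>
    have s1 := smooth_dd hΩ hfs (1, 0)
    have s2 := smooth_dd hΩ hfs (0, 1)
    have s11 := smooth_dd hΩ s1 (1, 0)
    have s22 := smooth_dd hΩ s2 (0, 1)
    have hlap : ∀ v x, x ∈ Ω →
        dd v (fun x => dd (1, 0) (dd (1, 0) f) x + dd (0, 1) (dd (0, 1) f) x) x =
        dd (1, 0) (dd (1, 0) (dd v f)) x + dd (0, 1) (dd (0, 1) (dd v f)) x := by
      intro v x hx
      rw [dd_add (diffAt_of_smooth hΩ s11 hx) (diffAt_of_smooth hΩ s22 hx),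
        dd_comm hΩ s1 hx, dd_comm hΩ s2 hx,
        dd_congr hΩ (fun y hy => dd_comm (v := v) (w := (1, 0)) hΩ hfs hy) hx,
        dd_congr hΩ (fun y hy => dd_comm (v := v) (w := (0, 1)) hΩ hfs hy) hx]
    obtain ⟨Z1, h1⟩ := ih s1 (hv.2 _) ((hl.2 (1, 0)).congr hΩ hp (hlap _))
    obtain ⟨Z2, h2⟩ := ih s2 (hv.2 _) ((hl.2 (0, 1)).congr hΩ hp (hlap _))
    have e1 : Z2.re = -Z1.im := by
      have a := (h2 (1, 0)).iterate (1, 0)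
      have b := ((h1 (0, 1)).congr hΩ hp
        (fun y hy => dd_comm (v := (0, 1)) (w := (1, 0)) hΩ hfs hy)).iterate (1, 0)
      rw [a] at b
      simpa [toC, show (⟨1, 0⟩ : ℂ) = 1 from rfl] using b
    have e2 : Z1.re = Z2.im := by
      have a := ((h1 (1, 0)).lin hΩ hp 1 1 s11 s22 (h2 (0, 1))).iterate (1, 0)
      have b := hl.iterate (1, 0)
      simp only [one_mul, b] at a
      simp [toC, show (⟨1, 0⟩ : ℂ) = 1 from rfl] at a
      linarith
    have e3 : Z2 = Complex.I * Z1 := by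
      apply Complex.ext <;> simp [e1, e2]
    refine ⟨Z1, fun v => ?_⟩
    have := (h1.lin hΩ hp v.1 v.2 s1 s2 h2).congr hΩ hp (g := dd v f)
      fun x _ => (dd_eq v f x).symm
    convert this using 1
    rw [e3]; apply Complex.ext <;> simp [toC] <;> ring

end Lead

section Energy

open MeasureTheory

lemma contDiff_of_tsupport_subset {U : Set (ℝ × ℝ)} {g : ℝ × ℝ → ℝ} (hU : IsOpen U)
    (hg : ContDiffOn ℝ (⊤ : ℕ∞) g U) (h : tsupport g ⊆ U) : ContDiff ℝ (⊤ : ℕ∞) g := by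
  rw [contDiff_iff_contDiffAt]
  intro x
  by_cases hx : x ∈ tsupport g
  · exact hg.contDiffAt (hU.mem_nhds (h hx))
  · have : g =ᶠ[nhds x] 0 := notMem_tsupport_iff_eventuallyEq.1 hx
    exact (contDiffAt_const (c := (0 : ℝ))).congr_of_eventuallyEq this

lemma continuous_dd {g : ℝ × ℝ → ℝ} (hg : ContDiff ℝ (⊤ : ℕ∞) g) (v : ℝ × ℝ) :
    Continuous (dd v g) :=
  (hg.continuous_fderiv (by simp)).clm_apply continuous_const

lemma hasCompactSupport_dd {g : ℝ × ℝ → ℝ} (hg : HasCompactSupport g) (v : ℝ × ℝ) :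
    HasCompactSupport (dd v g) := hg.fderiv_apply ℝ v

lemma integral_dd_eq_zero {g : ℝ × ℝ → ℝ} (hg : ContDiff ℝ (⊤ : ℕ∞) g)
    (hc : HasCompactSupport g) (v : ℝ × ℝ) : ∫ x, dd v g x = 0 := by
  have h := integral_mul_fderiv_eq_neg_fderiv_mul_of_integrable (μ := (volume : Measure (ℝ × ℝ)))
    (f := fun _ => (1 : ℝ)) (g := g) (v := v) (by simp)
    (by
      simp only [one_mul]
      exact (continuous_dd hg v).integrable_of_hasCompactSupport (hasCompactSupport_dd hc v))
    (by simpa using hg.continuous.integrable_of_hasCompactSupport hc)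
    (fun x _ => differentiableAt_const _) (fun x _ => (hg.differentiable (by simp)) x)
  simpa [dd] using h

/-- Energy form of the maximum principle for a field `B` with `B · ∇f ≥ 0`, `div B ≥ 0`. -/
lemma energy_principle {U : Set (ℝ × ℝ)} {f B1 B2 : ℝ × ℝ → ℝ} {c : ℝ} (hU : IsOpen U)
    (hb : Bornology.IsBounded U) (hf : ContDiffOn ℝ (⊤ : ℕ∞) f U)
    (h1 : ContDiffOn ℝ (⊤ : ℕ∞) B1 U) (h2 : ContDiffOn ℝ (⊤ : ℕ∞) B2 U)
    (hfc : ContinuousOn f (closure U)) (hfr : ∀ x ∈ frontier U, f x ≤ c)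
    (hB : ∀ x ∈ U, 0 ≤ B1 x * dd (1, 0) f x + B2 x * dd (0, 1) f x)
    (hdiv : ∀ x ∈ U, 0 ≤ dd (1, 0) B1 x + dd (0, 1) B2 x) :
    (∀ x ∈ U, c < f x → dd (1, 0) B1 x + dd (0, 1) B2 x = 0) ∧
    ((∀ x ∈ U, B1 x * dd (1, 0) f x + B2 x * dd (0, 1) f x = 0 →
      dd (1, 0) f x = 0 ∧ dd (0, 1) f x = 0) → ∀ x ∈ U, f x ≤ c) := by
  classical
  suffices H : ∀ ε > 0, (∀ x ∈ U, c + ε < f x → dd (1, 0) B1 x + dd (0, 1) B2 x = 0) ∧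
    ((∀ x ∈ U, B1 x * dd (1, 0) f x + B2 x * dd (0, 1) f x = 0 →
      dd (1, 0) f x = 0 ∧ dd (0, 1) f x = 0) → ∀ x ∈ U, f x ≤ c + ε) by
    refine ⟨fun x hx hc => (H ((f x - c) / 2) (by linarith)).1 x hx (by linarith), ?_⟩
    exact fun h x hx => le_of_forall_pos_le_add fun ε hε => (H ε hε).2 h x hx
  intro ε hε
  set ρ : ℝ × ℝ → ℝ := fun x => if x ∈ U then expNegInvGlue (f x - (c + ε)) else 0 with hρ
  set K : Set (ℝ × ℝ) := {x ∈ closure U | c + ε ≤ f x} with hK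
  have hKc : IsCompact K := by
    have : IsClosed K := hfc.preimage_isClosed_of_isClosed isClosed_closure isClosed_Ici
    exact hb.isCompact_closure.of_isClosed_subset this fun x hx => hx.1
  have hKU : K ⊆ U := by
    intro x hx
    by_contra hxU
    have : x ∈ frontier U := ⟨hx.1, by rwa [hU.interior_eq]⟩
    linarith [hfr x this, hx.2]
  have hsupp : ∀ x, ρ x ≠ 0 → x ∈ K := by
    intro x hx
    by_cases hxU : x ∈ U
    · refine ⟨subset_closure hxU, ?_⟩
      simp only [hρ, hxU, if_true, ne_eq, expNegInvGlue.zero_iff_nonpos] at hx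
      linarith
    · simp [hρ, hxU] at hx
  have hts : ∀ g : ℝ × ℝ → ℝ, tsupport (fun x => ρ x * g x) ⊆ K := fun g =>
    closure_minimal (fun x hx => hsupp x (left_ne_zero_of_mul hx)) hKc.isClosed
  have hcs : ∀ g : ℝ × ℝ → ℝ, HasCompactSupport (fun x => ρ x * g x) := fun g =>
    hKc.of_isClosed_subset (isClosed_tsupport _) (hts g)
  have hglue : ContDiff ℝ (⊤ : ℕ∞) expNegInvGlue := expNegInvGlue.contDiff
  have hρU : EqOn ρ (fun x => expNegInvGlue (f x - (c + ε))) U := fun x hx => by simp [hρ, hx]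
  have hρs : ContDiffOn ℝ (⊤ : ℕ∞) ρ U :=
    (hglue.comp_contDiffOn (hf.sub contDiffOn_const)).congr hρU
  have hsm : ∀ g : ℝ × ℝ → ℝ, ContDiffOn ℝ (⊤ : ℕ∞) g U →
      ContDiff ℝ (⊤ : ℕ∞) (fun x => ρ x * g x) := fun g hg =>
    contDiff_of_tsupport_subset hU (hρs.mul hg) ((hts g).trans hKU)
  have hρd : ∀ v, ∀ x ∈ U, dd v ρ x = deriv expNegInvGlue (f x - (c + ε)) * dd v f x := by
    intro v x hx
    have hfx := diffAt_of_smooth hU hf hx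
    rw [dd_congr hU hρU hx]
    have := dd_comp (v := v) (f := fun x => f x - (c + ε)) (x := x) (h := expNegInvGlue)
      ((hglue.differentiable (by simp)) (f x - (c + ε))).hasDerivAt
      (hfx.sub_const _)
    rw [this, dd_sub hfx (differentiableAt_const _), dd_const, sub_zero]
  have hmono : ∀ t, 0 ≤ deriv expNegInvGlue t := fun t => expNegInvGlue.monotone.deriv_nonneg
  have hρ0 : ∀ x ∈ U, 0 ≤ ρ x := fun x hx => by rw [hρU hx]; exact expNegInvGlue.nonneg _
  set G : ℝ × ℝ → ℝ := fun x => dd (1, 0) (fun x => ρ x * B1 x) x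
    + dd (0, 1) (fun x => ρ x * B2 x) x with hG
  have hGU : ∀ x ∈ U, G x = deriv expNegInvGlue (f x - (c + ε)) *
      (B1 x * dd (1, 0) f x + B2 x * dd (0, 1) f x)
      + ρ x * (dd (1, 0) B1 x + dd (0, 1) B2 x) := by
    intro x hx
    have hr := diffAt_of_smooth hU hρs hx
    simp only [hG]
    rw [dd_mul hr (diffAt_of_smooth hU h1 hx), dd_mul hr (diffAt_of_smooth hU h2 hx),
      hρd _ x hx, hρd _ x hx]
    ring
  have hG0 : ∀ x, 0 ≤ G x := by
    intro x
    by_cases hx : x ∈ U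
    · rw [hGU x hx]
      exact add_nonneg (mul_nonneg (hmono _) (hB x hx)) (mul_nonneg (hρ0 x hx) (hdiv x hx))
    · have : ∀ (g : ℝ × ℝ → ℝ) v, dd v (fun x => ρ x * g x) x = 0 := by
        intro g v
        have hx' : x ∉ tsupport (fun x => ρ x * g x) := fun h => hx (hKU (hts g h))
        have := (notMem_tsupport_iff_eventuallyEq.1 hx').fderiv_eq (𝕜 := ℝ)
        rw [dd, this]; simp
      simp [hG, this]
  have hGc : Continuous G := (continuous_dd (hsm _ h1) _).add (continuous_dd (hsm _ h2) _)
  have i1 := (continuous_dd (hsm _ h1) (1, 0)).integrable_of_hasCompactSupport (μ := volume)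
    (hasCompactSupport_dd (hcs B1) _)
  have i2 := (continuous_dd (hsm _ h2) (0, 1)).integrable_of_hasCompactSupport (μ := volume)
    (hasCompactSupport_dd (hcs B2) _)
  have hGint : ∫ x, G x = 0 := by
    rw [hG, integral_add i1 i2, integral_dd_eq_zero (hsm _ h1) (hcs _),
      integral_dd_eq_zero (hsm _ h2) (hcs _), add_zero]
  have hGz : ∀ x, G x = 0 := by
    have := (integral_eq_zero_iff_of_nonneg hG0 (i1.add i2)).1 hGint
    have := (hGc.ae_eq_iff_eq (μ := (volume : Measure (ℝ × ℝ))) continuous_const).1 this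
    exact fun x => congrFun this x
  have hboth : ∀ x ∈ U, deriv expNegInvGlue (f x - (c + ε)) *
      (B1 x * dd (1, 0) f x + B2 x * dd (0, 1) f x) = 0 ∧
      ρ x * (dd (1, 0) B1 x + dd (0, 1) B2 x) = 0 := by
    intro x hx
    have := hGz x
    rw [hGU x hx] at this
    exact (add_eq_zero_iff_of_nonneg (mul_nonneg (hmono _) (hB x hx))
      (mul_nonneg (hρ0 x hx) (hdiv x hx))).1 this
  refine ⟨fun x hx hlt => ?_, fun hstr x hx => ?_⟩
  · have hpos : 0 < ρ x := by
      rw [hρU hx]; exact expNegInvGlue.pos_of_pos (by linarith)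
    exact (mul_eq_zero.1 (hboth x hx).2).resolve_left hpos.ne'
  · have hρsm : ContDiff ℝ (⊤ : ℕ∞) ρ := by simpa using hsm (fun _ => 1) contDiffOn_const
    have hz : ∀ y, fderiv ℝ ρ y = 0 := by
      intro y
      have hdz : ∀ v, dd v ρ y = 0 := by
        intro v
        by_cases hy : y ∈ U
        · rw [hρd v y hy]
          rcases mul_eq_zero.1 (hboth y hy).1 with h | h
          · rw [h, zero_mul]
          · rw [dd_eq_zero_of (hstr y hy h).1 (hstr y hy h).2, mul_zero]
        · have hy' : y ∉ tsupport ρ := fun h => hy (hKU (hts (fun _ => 1) (by simpa using h)))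
          have := (notMem_tsupport_iff_eventuallyEq.1 hy').fderiv_eq (𝕜 := ℝ)
          rw [dd, this]; simp
      ext <;> exact hdz _
    have hconst := is_const_of_fderiv_eq_zero (hρsm.differentiable (by simp)) hz
    obtain ⟨y, hy⟩ : ∃ y, y ∉ K := by
      by_contra! h
      exact noncompact_univ (ℝ × ℝ) (by rwa [eq_univ_of_forall h] at hKc)
    have hx0 : ρ x = 0 := by
      rw [hconst x y]
      by_contra h
      exact hy (hsupp y h)
    rw [hρU hx, expNegInvGlue.zero_iff_nonpos] at hx0
    linarith

end Energy

section FrequencyODE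

lemma nonneg_of_deriv_nonneg_of_decay {G G' : ℝ → ℝ} {t0 C : ℝ}
    (hG : ∀ t < t0, HasDerivAt G (G' t) t) (h0 : ∀ t < t0, 0 ≤ G' t)
    (hb : ∀ t < t0, |G t| ≤ C * exp t) : ∀ t < t0, 0 ≤ G t := by
  intro t ht
  have hmono : MonotoneOn G (Iio t0) := by
    refine monotoneOn_of_deriv_nonneg (convex_Iio _) ?_ ?_ ?_
    · exact fun s hs => (hG s hs).continuousAt.continuousWithinAt
    · rw [interior_Iio]
      exact fun s hs => (hG s hs).differentiableAt.differentiableWithinAt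
    · rw [interior_Iio]
      exact fun s hs => by rw [(hG s hs).deriv]; exact h0 s hs
  have hlim : Filter.Tendsto (fun s => -(C * exp s)) Filter.atBot (nhds 0) := by
    simpa using (tendsto_exp_atBot.const_mul C).neg
  refine le_of_tendsto hlim ?_
  filter_upwards [Filter.Iic_mem_atBot t] with s hs
  have hs0 : s < t0 := lt_of_le_of_lt hs ht
  calc -(C * exp s) ≤ G s := neg_le_of_abs_le (hb s hs0)
    _ ≤ G t := hmono hs0 ht hs

/-- Almgren-type monotonicity: a height function with bounded frequency and infinite order of decay
vanishes identically. -/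
lemma height_eq_zero {H D E Q A H' Q' : ℝ → ℝ} {t0 C : ℝ} (ht0 : t0 ≤ 0) (hC : 0 ≤ C)
    (hH : ∀ t < t0, HasDerivAt H (H' t) t) (hD : ∀ t < t0, HasDerivAt D (E t) t)
    (hQ : ∀ t < t0, HasDerivAt Q (Q' t) t)
    (hH' : ∀ t < t0, |H' t - 2 * D t| ≤ C * exp t * H t)
    (hQ' : ∀ t < t0, |Q' t| ≤ C * exp t * E t)
    (hEQ : ∀ t < t0, E t = 2 * A t - Q t) (hCS : ∀ t < t0, D t ^ 2 ≤ H t * A t)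
    (hH0 : ∀ t < t0, 0 ≤ H t) (hE0 : ∀ t < t0, 0 ≤ E t)
    (hDb : ∀ t < t0, |D t| ≤ C * exp t) (hQb : ∀ t < t0, |Q t| ≤ C * exp t)
    (hdec : ∀ m : ℕ, ∃ B, ∀ t < t0, H t ≤ B * exp (m * t)) : ∀ t < t0, H t = 0 := by
  have hD0 := nonneg_of_deriv_nonneg_of_decay hD hE0 hDb
  have hexp1 : ∀ t < t0, exp t ≤ 1 := fun t ht => exp_le_one_iff.2 (by linarith)
  have hQD : ∀ t < t0, Q t ≤ C * exp t * D t := by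
    have := nonneg_of_deriv_nonneg_of_decay (G := fun t => C * exp t * D t - Q t)
      (G' := fun t => C * exp t * D t + C * exp t * E t - Q' t) (C := C * C + C) (t0 := t0)
      (fun t ht => (((Real.hasDerivAt_exp t).const_mul C).mul (hD t ht)).sub (hQ t ht))
      (fun t ht => by
        have h1 := (abs_le.1 (hQ' t ht)).2
        have h2 : 0 ≤ C * exp t * D t := mul_nonneg (by positivity) (hD0 t ht)
        linarith)
      (fun t ht => by
        have h1 := hQb t ht
        have h2 : |C * exp t * D t| ≤ C * C * exp t := by
          rw [abs_mul, abs_of_nonneg (by positivity : 0 ≤ C * exp t)]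
          calc C * exp t * |D t| ≤ C * 1 * (C * exp t) := by
                gcongr
                · exact hexp1 t ht
                · exact hDb t ht
            _ = _ := by ring
        calc |C * exp t * D t - Q t| ≤ |C * exp t * D t| + |Q t| := abs_sub _ _
          _ ≤ _ := by linarith)
    exact fun t ht => by linarith [this t ht]
  intro t1 ht1
  by_contra hne
  have hpos : 0 < H t1 := lt_of_le_of_ne (hH0 t1 ht1) (Ne.symm hne)
  set M := D t1 / H t1 * exp (2 * C * exp t1) with hM
  set L := 2 * M + C with hL
  have hmain : ∀ ε > 0, ∀ t ≤ t1, H t1 * exp (-L * t1) ≤ (H t + ε) * exp (-L * t) := by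
    intro ε hε t htt
    have hHe : ∀ s < t0, 0 < H s + ε := fun s hs => by linarith [hH0 s hs]
    have hN : MonotoneOn (fun s => D s / (H s + ε) * exp (2 * C * exp s)) (Iio t0) := by
      have hder : ∀ s < t0, HasDerivAt (fun s => D s / (H s + ε) * exp (2 * C * exp s))
          ((E s * (H s + ε) - D s * H' s) / (H s + ε) ^ 2 * exp (2 * C * exp s)
            + D s / (H s + ε) * (exp (2 * C * exp s) * (2 * C * exp s))) s := by
        intro s hs
        exact ((hD s hs).div ((hH s hs).add_const ε) (hHe s hs).ne').mul
          (((Real.hasDerivAt_exp s).const_mul (2 * C)).exp)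
      refine monotoneOn_of_deriv_nonneg (convex_Iio _) ?_ ?_ ?_
      · exact fun s hs => (hder s hs).continuousAt.continuousWithinAt
      · rw [interior_Iio]
        exact fun s hs => (hder s hs).differentiableAt.differentiableWithinAt
      · rw [interior_Iio]
        intro s hs
        have hs' : s < t0 := hs
        rw [(hder s hs).deriv]
        have h1 := hHe s hs
        have hd := hD0 s hs
        have hce : 0 ≤ C * exp s := by positivity
        have k1 : D s * H' s ≤ 2 * D s ^ 2 + C * exp s * D s * (H s + ε) := by
          have := (abs_le.1 (hH' s hs)).2
          have h3 : D s * (H' s - 2 * D s) ≤ D s * (C * exp s * H s) :=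
            mul_le_mul_of_nonneg_left this hd
          have h4 : 0 ≤ C * exp s * D s * ε := by positivity
          nlinarith
        have k2 : 2 * D s ^ 2 - C * exp s * D s * (H s + ε) ≤ E s * (H s + ε) := by
          have e1 : 2 * A s - C * exp s * D s ≤ E s := by
            rw [hEQ s hs]; linarith [hQD s hs]
          have e2 := mul_le_mul_of_nonneg_right e1 (hH0 s hs)
          have e3 := mul_nonneg (hE0 s hs) hε.le
          have h4 : 0 ≤ C * exp s * D s * ε := by positivity
          nlinarith [hCS s hs]
        have k3 : -(2 * C * exp s * D s / (H s + ε)) ≤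
            (E s * (H s + ε) - D s * H' s) / (H s + ε) ^ 2 := by
          rw [le_div_iff₀ (by positivity)]
          have : -(2 * C * exp s * D s / (H s + ε)) * (H s + ε) ^ 2 =
            -(2 * C * exp s * D s * (H s + ε)) := by field_simp
          rw [this]; linarith
        have k4 : (E s * (H s + ε) - D s * H' s) / (H s + ε) ^ 2 * exp (2 * C * exp s)
            + D s / (H s + ε) * (exp (2 * C * exp s) * (2 * C * exp s)) =
            exp (2 * C * exp s) * ((E s * (H s + ε) - D s * H' s) / (H s + ε) ^ 2
              - -(2 * C * exp s * D s / (H s + ε))) := by ring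
        rw [k4]
        exact mul_nonneg (exp_pos _).le (by linarith)
    have hDM : ∀ s ≤ t1, D s ≤ M * (H s + ε) := by
      intro s hs
      have hs0 : s < t0 := hs.trans_lt ht1
      have h1 := hN hs0 ht1 hs
      simp only at h1
      have h2 : D s / (H s + ε) ≤ D s / (H s + ε) * exp (2 * C * exp s) :=
        le_mul_of_one_le_right (div_nonneg (hD0 s hs0) (hHe s hs0).le)
          (one_le_exp (by positivity))
      have h3 : D t1 / (H t1 + ε) * exp (2 * C * exp t1) ≤ M := by
        rw [hM]; gcongr
        · exact hD0 t1 ht1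
        · linarith
      rw [← div_le_iff₀ (hHe s hs0)]
      linarith
    have hanti : AntitoneOn (fun s => (H s + ε) * exp (-L * s)) (Iic t1) := by
      have hder : ∀ s ≤ t1, HasDerivAt (fun s => (H s + ε) * exp (-L * s))
          (H' s * exp (-L * s) + (H s + ε) * (exp (-L * s) * (-L))) s := by
        intro s hs
        exact ((hH s (hs.trans_lt ht1)).add_const ε).mul (hasDerivAt_const_mul (-L)).exp
      refine antitoneOn_of_deriv_nonpos (convex_Iic _) ?_ ?_ ?_
      · exact fun s hs => (hder s hs).continuousAt.continuousWithinAt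
      · rw [interior_Iic]
        exact fun s hs => (hder s (le_of_lt hs)).differentiableAt.differentiableWithinAt
      · rw [interior_Iic]
        intro s hs
        have hs1 : s ≤ t1 := le_of_lt hs
        have hs0 : s < t0 := hs1.trans_lt ht1
        rw [(hder s hs1).deriv]
        have h1 := (abs_le.1 (hH' s hs0)).2
        have h2 := hDM s hs1
        have h3 : C * exp s * H s ≤ C * (H s + ε) := by
          have := hexp1 s hs0
          have h5 := hH0 s hs0
          calc C * exp s * H s ≤ C * 1 * H s := by gcongr
            _ ≤ C * (H s + ε) := by nlinarith
        have h4 : H' s ≤ L * (H s + ε) := by rw [hL]; nlinarith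
        have := (exp_pos (-L * s))
        nlinarith
    have := hanti (mem_Iic.2 htt) (mem_Iic.2 le_rfl) htt
    simp only at this
    refine le_trans ?_ this
    gcongr
    linarith
  have hgrow : ∀ t ≤ t1, H t1 * exp (-L * t1) ≤ H t * exp (-L * t) := by
    intro t ht
    refine le_of_forall_pos_le_add fun δ hδ => ?_
    have := hmain (δ * exp (L * t)) (by positivity) t ht
    rw [add_mul, mul_assoc δ, ← exp_add] at this
    simpa using this
  obtain ⟨m, hm⟩ := exists_nat_ge (L + 1)
  obtain ⟨B, hB⟩ := hdec m
  have hB0 : 0 < B := by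
    have := hB t1 ht1
    by_contra hB0
    have : B * exp (m * t1) ≤ 0 := mul_nonpos_of_nonpos_of_nonneg (not_lt.1 hB0) (exp_pos _).le
    linarith
  have hle : ∀ t ≤ t1, H t1 * exp (-L * t1) ≤ B * exp t := by
    intro t ht
    have ht0' : t < t0 := ht.trans_lt ht1
    calc _ ≤ H t * exp (-L * t) := hgrow t ht
      _ ≤ B * exp (m * t) * exp (-L * t) := by gcongr; exact hB t ht0'
      _ = B * exp ((m - L) * t) := by rw [mul_assoc, ← exp_add]; ring_nf
      _ ≤ B * exp t := by
        gcongr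
        nlinarith
  have hlim : Filter.Tendsto (fun s => B * exp s) Filter.atBot (nhds 0) := by
    simpa using (tendsto_exp_atBot.const_mul B)
  have := ge_of_tendsto hlim (Filter.eventually_atBot.2 ⟨t1, hle⟩)
  have : 0 < H t1 * exp (-L * t1) := by positivity
  linarith

end FrequencyODE

section CircleIntegrals

open MeasureTheory intervalIntegral

variable {t0 : ℝ} {F G : ℝ × ℝ → ℝ}

/-- The half-cylinder `t < t0`, with periodic coordinate `θ`. -/
def strip (t0 : ℝ) : Set (ℝ × ℝ) := {z | z.1 < t0}

lemma isOpen_strip (t0 : ℝ) : IsOpen (strip t0) := isOpen_lt continuous_fst continuous_const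

/-- Integral of `F` over the circle at height `t`. -/
noncomputable def circInt (F : ℝ × ℝ → ℝ) (t : ℝ) : ℝ := ∫ θ in (0 : ℝ)..(2 * π), F (t, θ)

lemma continuous_slice (hF : ContDiffOn ℝ (⊤ : ℕ∞) F (strip t0)) {t : ℝ} (ht : t < t0) :
    Continuous fun θ => F (t, θ) := by
  rw [← continuousOn_univ]
  exact hF.continuousOn.comp (f := fun θ : ℝ => (t, θ)) (by fun_prop) fun θ _ => ht

lemma slice_integrable (hF : ContDiffOn ℝ (⊤ : ℕ∞) F (strip t0)) {t : ℝ} (ht : t < t0) :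
    IntervalIntegrable (fun θ => F (t, θ)) volume 0 (2 * π) :=
  (continuous_slice hF ht).intervalIntegrable _ _

lemma hasDerivAt_fst {t θ : ℝ} (hF : DifferentiableAt ℝ F (t, θ)) :
    HasDerivAt (fun t => F (t, θ)) (dd (1, 0) F (t, θ)) t := by
  have h1 : HasDerivAt (fun t : ℝ => (t, θ)) ((1 : ℝ), (0 : ℝ)) t :=
    (hasDerivAt_id t).prodMk (hasDerivAt_const t θ)
  exact HasFDerivAt.comp_hasDerivAt t (f := fun t : ℝ => (t, θ)) hF.hasFDerivAt h1

lemma hasDerivAt_snd {t θ : ℝ} (hF : DifferentiableAt ℝ F (t, θ)) :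
    HasDerivAt (fun θ => F (t, θ)) (dd (0, 1) F (t, θ)) θ := by
  have h1 : HasDerivAt (fun θ : ℝ => (t, θ)) ((0 : ℝ), (1 : ℝ)) θ :=
    (hasDerivAt_const θ t).prodMk (hasDerivAt_id θ)
  exact HasFDerivAt.comp_hasDerivAt θ (f := fun θ : ℝ => (t, θ)) hF.hasFDerivAt h1

lemma hasDerivAt_circInt (hF : ContDiffOn ℝ (⊤ : ℕ∞) F (strip t0)) {t : ℝ} (ht : t < t0) :
    HasDerivAt (circInt F) (circInt (dd (1, 0) F) t) t := by
  have hdF := smooth_dd (isOpen_strip t0) hF (1, 0)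
  obtain ⟨a, ha⟩ : ∃ a, a < t := ⟨t - 1, by linarith⟩
  obtain ⟨b, hb1, hb2⟩ := exists_between ht
  have hcomp : IsCompact (Icc a b ×ˢ Icc (0 : ℝ) (2 * π)) := isCompact_Icc.prod isCompact_Icc
  have hsub : Icc a b ×ˢ Icc (0 : ℝ) (2 * π) ⊆ strip t0 := fun z hz => hz.1.2.trans_lt hb2
  obtain ⟨B, hB⟩ := hcomp.exists_bound_of_continuousOn (hdF.continuousOn.mono hsub)
  have hpi : (0 : ℝ) ≤ 2 * π := by positivity
  refine (hasDerivAt_integral_of_dominated_loc_of_deriv_le (F := fun t θ => F (t, θ))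
    (F' := fun t θ => dd (1, 0) F (t, θ)) (s := Icc a b) (bound := fun _ => B)
    (Icc_mem_nhds ha hb1) ?_ (slice_integrable hF ht)
    (continuous_slice hdF ht).aestronglyMeasurable ?_ (by simp) ?_).2
  · filter_upwards [Iio_mem_nhds ht] with s hs
    exact (continuous_slice hF hs).aestronglyMeasurable
  · refine Filter.Eventually.of_forall fun θ hθ s hs => hB (s, θ) ⟨hs, ?_⟩
    rw [uIoc_of_le hpi] at hθ
    exact ⟨hθ.1.le, hθ.2⟩
  · refine Filter.Eventually.of_forall fun θ hθ s hs => ?_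
    exact hasDerivAt_fst (diffAt_of_smooth (isOpen_strip t0) hF (lt_of_le_of_lt hs.2 hb2))

/-- Periodicity in the angular variable. -/
def Per (F : ℝ × ℝ → ℝ) : Prop := ∀ t θ, F (t, θ + 2 * π) = F (t, θ)

lemma Per.dd (h : Per F) (v : ℝ × ℝ) : Per (dd v F) := by
  intro t θ
  have h1 : (fun z : ℝ × ℝ => F (z + (0, 2 * π))) = F := by
    ext ⟨a, b⟩
    simpa using h a b
  have h2 := fderiv_comp_add_right (𝕜 := ℝ) (f := F) (x := (t, θ)) ((0 : ℝ), 2 * π)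
  rw [h1] at h2
  rw [_root_.dd, _root_.dd, h2]; simp

lemma circInt_dd_snd (hF : ContDiffOn ℝ (⊤ : ℕ∞) F (strip t0)) (hp : Per F) {t : ℝ}
    (ht : t < t0) : circInt (dd (0, 1) F) t = 0 := by
  have hdF := smooth_dd (isOpen_strip t0) hF (0, 1)
  rw [circInt, integral_eq_sub_of_hasDerivAt (f := fun θ => F (t, θ))
    (fun θ _ => hasDerivAt_snd (diffAt_of_smooth (isOpen_strip t0) hF ht))
    (slice_integrable hdF ht)]
  have := hp t 0
  simp only [zero_add] at this
  simp [this]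

lemma circInt_add (hF : ContDiffOn ℝ (⊤ : ℕ∞) F (strip t0))
    (hG : ContDiffOn ℝ (⊤ : ℕ∞) G (strip t0)) {t : ℝ} (ht : t < t0) :
    circInt (fun z => F z + G z) t = circInt F t + circInt G t :=
  integral_add (slice_integrable hF ht) (slice_integrable hG ht)

lemma circInt_const_mul (c t : ℝ) :
    circInt (fun z => c * F z) t = c * circInt F t := integral_const_mul _ _

lemma circInt_congr {t : ℝ} (h : ∀ θ, F (t, θ) = G (t, θ)) : circInt F t = circInt G t := by
  simp only [circInt, h]

lemma circInt_mono (hF : ContDiffOn ℝ (⊤ : ℕ∞) F (strip t0))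
    (hG : ContDiffOn ℝ (⊤ : ℕ∞) G (strip t0)) {t : ℝ} (ht : t < t0)
    (h : ∀ θ, F (t, θ) ≤ G (t, θ)) : circInt F t ≤ circInt G t :=
  integral_mono_on (by positivity) (slice_integrable hF ht) (slice_integrable hG ht)
    fun θ _ => h θ

lemma circInt_nonneg {t : ℝ} (h : ∀ θ, 0 ≤ F (t, θ)) : 0 ≤ circInt F t :=
  integral_nonneg (by positivity) fun θ _ => h θ

lemma abs_circInt_le {t B : ℝ} (h : ∀ θ, |F (t, θ)| ≤ B) : |circInt F t| ≤ B * (2 * π) := by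
  have := norm_integral_le_of_norm_le_const (a := 0) (b := 2 * π) (f := fun θ => F (t, θ))
    (C := B) fun θ _ => h θ
  rwa [sub_zero, abs_of_nonneg (by positivity : (0 : ℝ) ≤ 2 * π)] at this

lemma eq_zero_of_circInt_eq_zero (hF : ContDiffOn ℝ (⊤ : ℕ∞) F (strip t0)) {t : ℝ}
    (ht : t < t0) (h : ∀ θ, 0 ≤ F (t, θ)) (h0 : circInt F t = 0) {θ : ℝ}
    (hθ : θ ∈ Ico 0 (2 * π)) : F (t, θ) = 0 := by
  by_contra hne
  have hpos : 0 < F (t, θ) := lt_of_le_of_ne (h θ) (Ne.symm hne)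
  have := integral_pos (a := 0) (b := 2 * π) (f := fun θ => F (t, θ)) (by positivity)
    (continuous_slice hF ht).continuousOn (fun θ _ => h θ) ⟨θ, ⟨hθ.1, hθ.2.le⟩, hpos⟩
  exact this.ne' h0

lemma abs_circInt_le_circInt (hF : ContDiffOn ℝ (⊤ : ℕ∞) F (strip t0))
    (hG : ContDiffOn ℝ (⊤ : ℕ∞) G (strip t0)) {t : ℝ} (ht : t < t0)
    (h : ∀ θ, |F (t, θ)| ≤ G (t, θ)) : |circInt F t| ≤ circInt G t := by
  refine abs_le.2 ⟨?_, circInt_mono hF hG ht fun θ => (abs_le.1 (h θ)).2⟩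
  have := circInt_mono (contDiffOn_const.mul hG) hF ht (F := fun z => (-1) * G z)
    fun θ => by linarith [(abs_le.1 (h θ)).1]
  rw [circInt_const_mul] at this
  linarith

lemma circInt_eq_of_flux {P : ℝ × ℝ → ℝ} (hF : ContDiffOn ℝ (⊤ : ℕ∞) F (strip t0))
    (hP : ContDiffOn ℝ (⊤ : ℕ∞) P (strip t0)) (pP : Per P) {t : ℝ} (ht : t < t0)
    (h : ∀ θ, F (t, θ) + dd (0, 1) P (t, θ) = G (t, θ)) : circInt F t = circInt G t := by
  have := circInt_add hF (smooth_dd (isOpen_strip t0) hP (0, 1)) ht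
  rw [circInt_dd_snd hP pP ht, add_zero] at this
  rw [← this]
  exact circInt_congr h

end CircleIntegrals

section Frequency

/-- Unique continuation on the half-cylinder for a first-order elliptic system that is
asymptotically Cauchy-Riemann. -/
lemma strip_unique_continuation {t0 C : ℝ} {f X α β k a : ℝ × ℝ → ℝ} (ht0 : t0 ≤ 0) (hC : 0 ≤ C)
    (sf : ContDiffOn ℝ (⊤ : ℕ∞) f (strip t0)) (sX : ContDiffOn ℝ (⊤ : ℕ∞) X (strip t0))
    (sα : ContDiffOn ℝ (⊤ : ℕ∞) α (strip t0)) (sβ : ContDiffOn ℝ (⊤ : ℕ∞) β (strip t0))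
    (sk : ContDiffOn ℝ (⊤ : ℕ∞) k (strip t0)) (sa : ContDiffOn ℝ (⊤ : ℕ∞) a (strip t0))
    (pf : Per f) (pX : Per X) (pα : Per α) (pβ : Per β) (pk : Per k) (pa : Per a)
    (haα : ∀ z ∈ strip t0, a z * α z = 1)
    (hft : ∀ z ∈ strip t0, dd (1, 0) f z = α z * X z - β z * dd (0, 1) f z)
    (hXt : ∀ z ∈ strip t0, dd (1, 0) X z = - dd (0, 1) (fun z => β z * X z + k z * dd (0, 1) f z) z)
    (hα : ∀ z ∈ strip t0, 1 / 2 ≤ α z ∧ α z ≤ 2) (hk : ∀ z ∈ strip t0, 1 / 2 ≤ k z ∧ k z ≤ 2)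
    (b1 : ∀ z ∈ strip t0, |dd (1, 0) α z + dd (0, 1) α z * β z - α z * dd (0, 1) β z|
      ≤ C * exp z.1)
    (b2 : ∀ z ∈ strip t0, |- dd (1, 0) k z + k z * dd (0, 1) β z - dd (0, 1) k z * β z|
      ≤ C * exp z.1)
    (b3 : ∀ z ∈ strip t0, |dd (1, 0) a z + dd (0, 1) (fun z => a z * β z) z| ≤ C * exp z.1)
    (df : ∀ m : ℕ, ∃ B, ∀ z ∈ strip t0, |f z| ≤ B * exp (m * z.1))
    (bX : ∀ z ∈ strip t0, |X z| ≤ C * exp z.1)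
    (bf : ∀ z ∈ strip t0, |dd (0, 1) f z| ≤ C * exp z.1)
    (bf0 : ∀ z ∈ strip t0, |f z| ≤ C) :
    ∀ t < t0, ∀ θ ∈ Ico 0 (2 * π), f (t, θ) = 0 := by
  have ho := isOpen_strip t0
  have sfθ := smooth_dd ho sf (0, 1)
  have pfθ := pf.dd (0, 1)
  have sH : ContDiffOn ℝ (⊤ : ℕ∞) (fun z => a z * f z ^ 2) (strip t0) := sa.mul (sf.pow 2)
  have sD : ContDiffOn ℝ (⊤ : ℕ∞) (fun z => f z * X z) (strip t0) := sf.mul sX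
  have sA : ContDiffOn ℝ (⊤ : ℕ∞) (fun z => α z * X z ^ 2) (strip t0) := sα.mul (sX.pow 2)
  have sK : ContDiffOn ℝ (⊤ : ℕ∞) (fun z => k z * dd (0, 1) f z ^ 2) (strip t0) :=
    sk.mul (sfθ.pow 2)
  have sE : ContDiffOn ℝ (⊤ : ℕ∞) (fun z => α z * X z ^ 2 + k z * dd (0, 1) f z ^ 2)
    (strip t0) := sA.add sK
  have sQ : ContDiffOn ℝ (⊤ : ℕ∞) (fun z => α z * X z ^ 2 - k z * dd (0, 1) f z ^ 2)
    (strip t0) := sA.sub sK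
  have sY : ContDiffOn ℝ (⊤ : ℕ∞) (fun z => β z * X z + k z * dd (0, 1) f z) (strip t0) :=
    (sβ.mul sX).add (sk.mul sfθ)
  have df' := fun {z} (hz : z ∈ strip t0) => diffAt_of_smooth ho sf hz
  have dX := fun {z} (hz : z ∈ strip t0) => diffAt_of_smooth ho sX hz
  have dα := fun {z} (hz : z ∈ strip t0) => diffAt_of_smooth ho sα hz
  have dβ := fun {z} (hz : z ∈ strip t0) => diffAt_of_smooth ho sβ hz
  have dk := fun {z} (hz : z ∈ strip t0) => diffAt_of_smooth ho sk hz
  have da := fun {z} (hz : z ∈ strip t0) => diffAt_of_smooth ho sa hz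
  have dfθ := fun {z} (hz : z ∈ strip t0) => diffAt_of_smooth ho sfθ hz
  have dY := fun {z} (hz : z ∈ strip t0) => diffAt_of_smooth ho sY hz
  have hsq : ∀ {g : ℝ × ℝ → ℝ} {z v}, DifferentiableAt ℝ g z →
      dd v (fun y => g y ^ 2) z = 2 * g z * dd v g z := by
    intro g z v hg
    simp only [pow_two]
    rw [dd_mul hg hg]; ring
  have hapos : ∀ z ∈ strip t0, 1 / 2 ≤ a z := by
    intro z hz
    have h1 := haα z hz
    have h2 := hα z hz
    by_contra! h
    nlinarith
  have hHder : ∀ t < t0, circInt (dd (1, 0) fun z => a z * f z ^ 2) t =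
      2 * circInt (fun z => f z * X z) t + circInt (fun z =>
        (dd (1, 0) a z + dd (0, 1) (fun z => a z * β z) z) * f z ^ 2) t := by
    intro t ht
    have sfl : ContDiffOn ℝ (⊤ : ℕ∞) (fun z => a z * β z * f z ^ 2) (strip t0) :=
      (sa.mul sβ).mul (sf.pow 2)
    rw [← circInt_const_mul, ← circInt_add (contDiffOn_const.mul sD) (((smooth_dd ho sa _).add
        (smooth_dd ho (sa.mul sβ) _)).mul (sf.pow 2)) ht]
    refine circInt_eq_of_flux (smooth_dd ho sH _) sfl
      (fun t θ => by simp only [pf t θ, pa t θ, pβ t θ]) ht fun θ => ?_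
    have hz : (t, θ) ∈ strip t0 := ht
    rw [dd_mul (da hz) ((df' hz).fun_pow 2), dd_mul ((da hz).fun_mul (dβ hz)) ((df' hz).fun_pow 2),
      hsq (df' hz), hsq (df' hz), hft _ hz]
    linear_combination 2 * f (t, θ) * X (t, θ) * haα _ hz
  have hDder : ∀ t < t0, circInt (dd (1, 0) fun z => f z * X z) t =
      circInt (fun z => α z * X z ^ 2 + k z * dd (0, 1) f z ^ 2) t := by
    intro t ht
    have sfl : ContDiffOn ℝ (⊤ : ℕ∞) (fun z => f z * (β z * X z + k z * dd (0, 1) f z))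
      (strip t0) := sf.mul sY
    refine circInt_eq_of_flux (smooth_dd ho sD _) sfl
      (fun t θ => by simp only [pf t θ, pk t θ, pβ t θ, pX t θ, pfθ t θ]) ht fun θ => ?_
    have hz : (t, θ) ∈ strip t0 := ht
    rw [dd_mul (df' hz) (dX hz), dd_mul (df' hz) (dY hz), hft _ hz, hXt _ hz]
    ring
  have hQder : ∀ t < t0, circInt (dd (1, 0) fun z => α z * X z ^ 2 - k z * dd (0, 1) f z ^ 2) t =
      circInt (fun z =>
        (dd (1, 0) α z + dd (0, 1) α z * β z - α z * dd (0, 1) β z) * X z ^ 2 +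
        (- dd (1, 0) k z + k z * dd (0, 1) β z - dd (0, 1) k z * β z) * dd (0, 1) f z ^ 2) t := by
    intro t ht
    have sfl : ContDiffOn ℝ (⊤ : ℕ∞) (fun z => (α z * β z) * X z ^ 2 +
        (α z * k z) * (2 * (X z * dd (0, 1) f z)) - (k z * β z) * dd (0, 1) f z ^ 2)
      (strip t0) := (((sα.mul sβ).mul (sX.pow 2)).add ((sα.mul sk).mul (contDiffOn_const.mul
        (sX.mul sfθ)))).sub ((sk.mul sβ).mul (sfθ.pow 2))
    refine circInt_eq_of_flux (smooth_dd ho sQ _) sfl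
      (fun t θ => by simp only [pα t θ, pk t θ, pβ t θ, pX t θ, pfθ t θ]) ht fun θ => ?_
    have hz : (t, θ) ∈ strip t0 := ht
    have e1 : dd (1, 0) (dd (0, 1) f) (t, θ) = dd (0, 1) α (t, θ) * X (t, θ)
        + α (t, θ) * dd (0, 1) X (t, θ) - (dd (0, 1) β (t, θ) * dd (0, 1) f (t, θ)
        + β (t, θ) * dd (0, 1) (dd (0, 1) f) (t, θ)) := by
      rw [dd_comm ho sf hz, dd_congr ho hft hz, dd_sub ((dα hz).fun_mul (dX hz))
        ((dβ hz).fun_mul (dfθ hz)), dd_mul (dα hz) (dX hz), dd_mul (dβ hz) (dfθ hz)]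
    have e2 := hXt _ hz
    rw [dd_add ((dβ hz).fun_mul (dX hz)) ((dk hz).fun_mul (dfθ hz)), dd_mul (dβ hz) (dX hz),
      dd_mul (dk hz) (dfθ hz)] at e2
    rw [dd_sub ((dα hz).fun_mul ((dX hz).fun_pow 2)) ((dk hz).fun_mul ((dfθ hz).fun_pow 2)),
      dd_mul (dα hz) ((dX hz).fun_pow 2), dd_mul (dk hz) ((dfθ hz).fun_pow 2),
      hsq (dX hz), hsq (dfθ hz), e1, e2,
      dd_sub ((((dα hz).fun_mul (dβ hz)).fun_mul ((dX hz).fun_pow 2)).fun_add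
        (((dα hz).fun_mul (dk hz)).fun_mul (((dX hz).fun_mul (dfθ hz)).const_mul 2)))
        (((dk hz).fun_mul (dβ hz)).fun_mul ((dfθ hz).fun_pow 2)),
      dd_add (((dα hz).fun_mul (dβ hz)).fun_mul ((dX hz).fun_pow 2))
        (((dα hz).fun_mul (dk hz)).fun_mul (((dX hz).fun_mul (dfθ hz)).const_mul 2)),
      dd_mul ((dα hz).fun_mul (dβ hz)) ((dX hz).fun_pow 2),
      dd_mul ((dα hz).fun_mul (dk hz)) (((dX hz).fun_mul (dfθ hz)).const_mul 2),
      dd_mul ((dk hz).fun_mul (dβ hz)) ((dfθ hz).fun_pow 2),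
      dd_mul (differentiableAt_const _) ((dX hz).fun_mul (dfθ hz)), dd_const,
      dd_mul (dα hz) (dβ hz), dd_mul (dα hz) (dk hz), dd_mul (dk hz) (dβ hz),
      dd_mul (dX hz) (dfθ hz), hsq (dX hz), hsq (dfθ hz)]
    ring
  have hHz := height_eq_zero (t0 := t0) (C := C * C * (2 * π) + 8 * (C * C) * π + 2 * C) ht0
    (by positivity)
    (H := circInt fun z => a z * f z ^ 2) (D := circInt fun z => f z * X z)
    (E := circInt fun z => α z * X z ^ 2 + k z * dd (0, 1) f z ^ 2)
    (Q := circInt fun z => α z * X z ^ 2 - k z * dd (0, 1) f z ^ 2)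
    (A := circInt fun z => α z * X z ^ 2)
    (fun t ht => hasDerivAt_circInt sH ht)
    (fun t ht => by rw [← hDder t ht]; exact hasDerivAt_circInt sD ht)
    (fun t ht => hasDerivAt_circInt sQ ht)
    ?_ ?_ ?_ ?_ ?_ ?_ ?_ ?_ ?_
  · intro t ht θ hθ
    have hz : (t, θ) ∈ strip t0 := ht
    have h0 : ∀ θ, 0 ≤ a (t, θ) * f (t, θ) ^ 2 := fun θ =>
      mul_nonneg (by linarith [hapos (t, θ) ht]) (sq_nonneg _)
    have := eq_zero_of_circInt_eq_zero sH ht h0 (hHz t ht) hθ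
    simpa [(show a (t, θ) ≠ 0 by linarith [hapos _ hz])] using this
  · intro t ht
    rw [hHder t ht, add_sub_cancel_left, ← circInt_const_mul]
    refine abs_circInt_le_circInt (((smooth_dd ho sa _).add
        (smooth_dd ho (sa.mul sβ) _)).mul (sf.pow 2)) (contDiffOn_const.mul sH) ht fun θ => ?_
    have hz : (t, θ) ∈ strip t0 := ht
    have h1 := b3 _ hz
    have h2 := hapos _ hz
    rw [abs_mul, abs_of_nonneg (sq_nonneg (f (t, θ)))]
    calc _ ≤ C * exp t * f (t, θ) ^ 2 := by gcongr
      _ = C * exp t * (1 * f (t, θ) ^ 2) := by ring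
      _ ≤ C * exp t * (2 * a (t, θ) * f (t, θ) ^ 2) := by gcongr; linarith
      _ = 2 * C * exp t * (a (t, θ) * f (t, θ) ^ 2) := by ring
      _ ≤ _ := by
        gcongr
        have : 0 ≤ C * C * (2 * π) + 8 * (C * C) * π := by positivity
        linarith
  · intro t ht
    simp only [hQder t ht]
    rw [← circInt_const_mul]
    refine abs_circInt_le_circInt ?_ (contDiffOn_const.mul sE) ht fun θ => ?_
    · have e1 := smooth_dd ho sα
      have e2 := smooth_dd ho sβ
      have e3 := smooth_dd ho sk
      exact ((((e1 _).add ((e1 _).mul sβ)).sub (sα.mul (e2 _))).mul (sX.pow 2)).add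
        ((((e3 _).neg.add (sk.mul (e2 _))).sub ((e3 _).mul sβ)).mul (sfθ.pow 2))
    · have hz : (t, θ) ∈ strip t0 := ht
      have h1 := b1 _ hz
      have h2 := b2 _ hz
      have h3 := (hα _ hz).1
      have h4 := (hk _ hz).1
      refine (abs_add_le _ _).trans ?_
      rw [abs_mul, abs_mul, abs_of_nonneg (sq_nonneg (X (t, θ))),
        abs_of_nonneg (sq_nonneg (dd (0, 1) f (t, θ)))]
      calc _ ≤ C * exp t * X (t, θ) ^ 2 + C * exp t * dd (0, 1) f (t, θ) ^ 2 := by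
            gcongr
        _ = C * exp t * (1 * X (t, θ) ^ 2 + 1 * dd (0, 1) f (t, θ) ^ 2) := by ring
        _ ≤ C * exp t * (2 * α (t, θ) * X (t, θ) ^ 2 +
            2 * k (t, θ) * dd (0, 1) f (t, θ) ^ 2) := by
          gcongr
          · linarith
          · linarith
        _ = 2 * C * exp t * (α (t, θ) * X (t, θ) ^ 2 + k (t, θ) * dd (0, 1) f (t, θ) ^ 2) := by
          ring
        _ ≤ _ := by
          gcongr
          have : 0 ≤ C * C * (2 * π) + 8 * (C * C) * π := by positivity
          linarith
  · intro t ht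
    have := circInt_add sE sQ ht
    rw [← circInt_const_mul, eq_sub_iff_add_eq, ← this]
    exact circInt_congr fun θ => by ring
  · intro t ht
    have hlam : ∀ l : ℝ, 0 ≤ circInt (fun z => a z * f z ^ 2) t * (l * l) +
        (2 * circInt (fun z => f z * X z) t) * l + circInt (fun z => α z * X z ^ 2) t := by
      intro l
      have e : circInt (fun z => a z * (l * f z + α z * X z) ^ 2) t =
          circInt (fun z => a z * f z ^ 2) t * (l * l) +
          (2 * circInt (fun z => f z * X z) t) * l + circInt (fun z => α z * X z ^ 2) t := by
        rw [mul_comm (circInt (fun z => a z * f z ^ 2) t) (l * l),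
          mul_comm (2 * circInt (fun z => f z * X z) t) l, ← circInt_const_mul, ← circInt_const_mul,
          ← circInt_const_mul, ← circInt_add (contDiffOn_const.mul sH)
            (contDiffOn_const.mul (contDiffOn_const.mul sD)),
          ← circInt_add ((contDiffOn_const.mul sH).add
            (contDiffOn_const.mul (contDiffOn_const.mul sD))) sA ht]
        · refine circInt_congr fun θ => ?_
          have h := haα (t, θ) ht
          linear_combination (2 * l * f (t, θ) * X (t, θ) + α (t, θ) * X (t, θ) ^ 2) * h
        · exact ht
      rw [← e]
      exact circInt_nonneg fun θ => mul_nonneg (by linarith [hapos (t, θ) ht]) (sq_nonneg _)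
    have := discrim_le_zero hlam
    rw [discrim] at this
    nlinarith
  · exact fun t ht => circInt_nonneg fun θ =>
      mul_nonneg (by linarith [hapos (t, θ) ht]) (sq_nonneg _)
  · exact fun t ht => circInt_nonneg fun θ => add_nonneg
      (mul_nonneg (by linarith [(hα (t, θ) ht).1]) (sq_nonneg _))
      (mul_nonneg (by linarith [(hk (t, θ) ht).1]) (sq_nonneg _))
  · intro t ht
    have h := abs_circInt_le (F := fun z => f z * X z) (t := t) (B := C * (C * exp t)) fun θ => by
      rw [abs_mul]
      exact mul_le_mul (bf0 _ ht) (bX (t, θ) ht) (abs_nonneg _) hC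
    calc _ ≤ _ := h
      _ = C * C * (2 * π) * exp t := by ring
      _ ≤ _ := by
        gcongr
        have : 0 ≤ 8 * (C * C) * π := by positivity
        linarith
  · intro t ht
    have hsq' : ∀ y : ℝ, |y| ≤ C * exp t → y ^ 2 ≤ C * C * exp t := by
      intro y hy
      have h1 : exp t ≤ 1 := exp_le_one_iff.2 (by linarith)
      calc y ^ 2 = |y| ^ 2 := (sq_abs y).symm
        _ ≤ (C * exp t) ^ 2 := by gcongr
        _ = C * C * exp t * exp t := by ring
        _ ≤ C * C * exp t * 1 := by gcongr
        _ = _ := by ring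
    have h := abs_circInt_le (F := fun z => α z * X z ^ 2 - k z * dd (0, 1) f z ^ 2) (t := t)
      (B := 4 * (C * C) * exp t) fun θ => by
        have h1 := hsq' _ (bX (t, θ) ht)
        have h2 := hsq' _ (bf (t, θ) ht)
        have h3 := hα (t, θ) ht
        have h4 := hk (t, θ) ht
        have h5 : 0 ≤ α (t, θ) * X (t, θ) ^ 2 := mul_nonneg (by linarith) (sq_nonneg _)
        have h6 : 0 ≤ k (t, θ) * dd (0, 1) f (t, θ) ^ 2 := mul_nonneg (by linarith) (sq_nonneg _)
        have h7 : α (t, θ) * X (t, θ) ^ 2 ≤ 2 * (C * C * exp t) :=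
          mul_le_mul h3.2 h1 (sq_nonneg _) (by norm_num)
        have h8 : k (t, θ) * dd (0, 1) f (t, θ) ^ 2 ≤ 2 * (C * C * exp t) :=
          mul_le_mul h4.2 h2 (sq_nonneg _) (by norm_num)
        rw [abs_le]
        constructor <;> nlinarith
    calc _ ≤ _ := h
      _ = 8 * (C * C) * π * exp t := by ring
      _ ≤ _ := by
        gcongr
        have : 0 ≤ C * C * (2 * π) := by positivity
        linarith
  · intro m
    obtain ⟨B, hB⟩ := df m
    refine ⟨2 * B ^ 2 * (2 * π), fun t ht => ?_⟩
    refine (le_abs_self _).trans ((abs_circInt_le (B := 2 * B ^ 2 * exp (m * t)) fun θ => ?_).trans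
      (le_of_eq (by ring)))
    have hz : (t, θ) ∈ strip t0 := ht
    have h1 := hB _ hz
    have h2 : a (t, θ) ≤ 2 := by
      have := haα _ hz
      have := (hα _ hz).1
      have := hapos _ hz
      nlinarith
    have h3 := hapos _ hz
    have h4 : exp (m * t) ≤ 1 := exp_le_one_iff.2
      (mul_nonpos_of_nonneg_of_nonpos (by positivity) (by linarith))
    rw [abs_of_nonneg (mul_nonneg (by linarith) (sq_nonneg _))]
    calc a (t, θ) * f (t, θ) ^ 2 = a (t, θ) * |f (t, θ)| ^ 2 := by rw [sq_abs]
      _ ≤ 2 * (B * exp (m * t)) ^ 2 := by gcongr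
      _ = 2 * B ^ 2 * exp (m * t) * exp (m * t) := by ring
      _ ≤ 2 * B ^ 2 * exp (m * t) * 1 := by gcongr
      _ = _ := by ring

end Frequency

section LogPolar

open Asymptotics Filter Topology

variable {S : Set (ℝ × ℝ)} {E F f g : ℝ × ℝ → ℝ} {v p : ℝ × ℝ} {t0 : ℝ}

/-- `g` is smooth on `S`, and `g` and its first derivatives are `O(E)` there. -/
def Bd (S : Set (ℝ × ℝ)) (E g : ℝ × ℝ → ℝ) : Prop :=
  ContDiffOn ℝ (⊤ : ℕ∞) g S ∧ g =O[𝓟 S] E ∧ ∀ v, dd v g =O[𝓟 S] E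

lemma isBigO_congr_left_on (h : EqOn f g S) (hf : f =O[𝓟 S] E) : g =O[𝓟 S] E :=
  hf.congr' (eventually_principal.2 fun _ hx => h hx) EventuallyEq.rfl

lemma isBigO_mul_one (hf : f =O[𝓟 S] E) (hg : g =O[𝓟 S] fun _ => (1 : ℝ)) :
    (fun z => f z * g z) =O[𝓟 S] E := by simpa using hf.mul hg

lemma isBigO_one_mul (hf : f =O[𝓟 S] fun _ => (1 : ℝ)) (hg : g =O[𝓟 S] E) :
    (fun z => f z * g z) =O[𝓟 S] E := by simpa using hf.mul hg

lemma Bd.mono (hf : Bd S E f) (h : E =O[𝓟 S] F) : Bd S F f :=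
  ⟨hf.1, hf.2.1.trans h, fun v => (hf.2.2 v).trans h⟩

lemma Bd.add (hS : IsOpen S) (hf : Bd S E f) (hg : Bd S E g) : Bd S E fun z => f z + g z :=
  ⟨hf.1.add hg.1, hf.2.1.add hg.2.1, fun v => isBigO_congr_left_on
    (fun _ hx => (dd_add (diffAt_of_smooth hS hf.1 hx) (diffAt_of_smooth hS hg.1 hx)).symm)
    ((hf.2.2 v).add (hg.2.2 v))⟩

lemma Bd.mul_one (hS : IsOpen S) (hf : Bd S E f) (hg : Bd S (fun _ => 1) g) : Bd S E fun z => f z * g z := by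
  refine ⟨hf.1.mul hg.1, isBigO_mul_one hf.2.1 hg.2.1, fun v => isBigO_congr_left_on
    (fun _ hx => (dd_mul (diffAt_of_smooth hS hf.1 hx) (diffAt_of_smooth hS hg.1 hx)).symm)
    ((isBigO_mul_one (hf.2.2 v) hg.2.1).add (isBigO_mul_one hf.2.1 (hg.2.2 v)))⟩

lemma bd_const (c : ℝ) : Bd S (fun _ => 1) fun _ => c := by
  refine ⟨contDiffOn_const, isBigO_const_const _ one_ne_zero _, fun v => ?_⟩
  exact isBigO_congr_left_on (fun x _ => (dd_const c).symm) (isBigO_zero _ _)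

lemma Bd.neg (hS : IsOpen S) (hf : Bd S E f) :
    Bd S E fun z => - f z := by
  simpa using hf.mul_one hS (bd_const (-1))

lemma Bd.inv (hS : IsOpen S) (hg : Bd S (fun _ => 1) g) (h : ∀ z ∈ S, 1 / 2 ≤ g z) :
    Bd S (fun _ => 1) fun z => (g z)⁻¹ := by
  have h0 : ∀ z ∈ S, g z ≠ 0 := fun z hz => by linarith [h z hz]
  have h1 : (fun z => (g z)⁻¹) =O[𝓟 S] fun _ => (1 : ℝ) := by
    refine isBigO_principal.2 ⟨2, fun z hz => ?_⟩
    have := h z hz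
    rw [norm_of_nonneg (inv_nonneg.2 (by linarith))]
    simpa using inv_anti₀ (by norm_num) this
  refine ⟨hg.1.inv h0, h1, fun v => ?_⟩
  refine isBigO_congr_left_on (f := fun z => dd v g z * ((g z)⁻¹ * (- (g z)⁻¹))) (fun z hz => ?_)
    (isBigO_mul_one (hg.2.2 v) (isBigO_mul_one h1 h1.neg_left))
  have := dd_comp (v := v) (hasDerivAt_inv (h0 z hz)) (diffAt_of_smooth hS hg.1 hz)
  simp only [this]
  field_simp

/-- Logarithmic polar coordinates centred at `p`. -/
noncomputable def logPolar (p y : ℝ × ℝ) : ℝ × ℝ :=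
  (p.1 + exp y.1 * cos y.2, p.2 + exp y.1 * sin y.2)

lemma contDiff_logPolar : ContDiff ℝ (⊤ : ℕ∞) (logPolar p) := by
  unfold logPolar
  fun_prop

lemma norm_logPolar_sub_le (y : ℝ × ℝ) : ‖logPolar p y - p‖ ≤ exp y.1 := by
  have h := (exp_pos y.1).le
  simp only [logPolar, Prod.norm_def, Prod.fst_sub, Prod.snd_sub, add_sub_cancel_left, norm_mul,
    norm_eq_abs, abs_of_nonneg h]
  exact max_le (mul_le_of_le_one_right h (abs_cos_le_one _))
    (mul_le_of_le_one_right h (abs_sin_le_one _))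

lemma per_comp_logPolar : Per fun y => g (logPolar p y) := by
  intro t θ
  simp [logPolar]

lemma dd_comp_logPolar {y : ℝ × ℝ} (hg : DifferentiableAt ℝ g (logPolar p y)) :
    dd v (fun y => g (logPolar p y)) y =
      exp y.1 * ((v.1 * cos y.2 - v.2 * sin y.2) * dd (1, 0) g (logPolar p y) +
        (v.1 * sin y.2 + v.2 * cos y.2) * dd (0, 1) g (logPolar p y)) := by
  have hd : DifferentiableAt ℝ (logPolar p) y := contDiff_logPolar.differentiable (by simp) y
  have h1 := (hg.hasFDerivAt.comp y hd.hasFDerivAt).fderiv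
  have h2 : fderiv ℝ (logPolar p) y v = (exp y.1 * (v.1 * cos y.2 - v.2 * sin y.2),
      exp y.1 * (v.1 * sin y.2 + v.2 * cos y.2)) := by
    have hl : HasDerivAt (fun s : ℝ => logPolar p (y + s • v)) (fderiv ℝ (logPolar p) y v) 0 := by
      have h3 : HasDerivAt (fun s : ℝ => y + s • v) v 0 := by
        simpa using ((hasDerivAt_id (0 : ℝ)).smul_const v).const_add y
      have h4 : HasFDerivAt (logPolar p) (fderiv ℝ (logPolar p) y) (y + (0 : ℝ) • v) := by
        simpa using hd.hasFDerivAt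
      exact h4.comp_hasDerivAt (0 : ℝ) h3
    refine hl.unique ?_
    have ha : HasDerivAt (fun s : ℝ => y.1 + s * v.1) v.1 0 := by
      simpa using ((hasDerivAt_id (0 : ℝ)).mul_const v.1).const_add y.1
    have hb : HasDerivAt (fun s : ℝ => y.2 + s * v.2) v.2 0 := by
      simpa using ((hasDerivAt_id (0 : ℝ)).mul_const v.2).const_add y.2
    have hc := (ha.exp.mul hb.cos).const_add p.1
    have hs := (ha.exp.mul hb.sin).const_add p.2
    refine (hc.prodMk hs).congr_deriv ?_
    ext <;> simp <;> ring
  rw [dd]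
  change fderiv ℝ (g ∘ logPolar p) y v = _
  rw [h1, ContinuousLinearMap.comp_apply, h2]
  change dd _ g (logPolar p y) = _
  rw [dd_eq]
  ring

lemma isBigO_exp_one (ht : t0 ≤ 0) :
    (fun z : ℝ × ℝ => exp z.1) =O[𝓟 (strip t0)] fun _ => (1 : ℝ) := by
  refine isBigO_principal.2 ⟨1, fun z hz => ?_⟩
  have : z.1 < t0 := hz
  simp only [norm_eq_abs, abs_exp, abs_one, mul_one]
  exact exp_le_one_iff.2 (by linarith)

lemma mapsTo_logPolar {Ω : Set (ℝ × ℝ)} {r : ℝ} (hr : ∀ x, ‖x - p‖ < r → x ∈ Ω)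
    (ht : exp t0 ≤ r) : MapsTo (logPolar p) (strip t0) Ω := fun y hy =>
  hr _ ((norm_logPolar_sub_le y).trans_lt ((exp_lt_exp.2 hy).trans_le ht))

lemma isBigO_comp_logPolar {Ω : Set (ℝ × ℝ)} (hΩ : IsOpen Ω) (hp : p ∈ Ω)
    (hg : ContDiffOn ℝ (⊤ : ℕ∞) g Ω) : ∃ r > 0, ∀ t0, exp t0 ≤ r →
      (fun y => g (logPolar p y)) =O[𝓟 (strip t0)] fun _ => (1 : ℝ) := by
  obtain ⟨C, -, r, hr, h⟩ := Van.bound (m := 0) hΩ hp hg trivial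
  refine ⟨r, hr, fun t0 ht => isBigO_principal.2 ⟨C, fun y hy => ?_⟩⟩
  simpa using (h (logPolar p y)
    ((norm_logPolar_sub_le y).trans_lt ((exp_lt_exp.2 hy).trans_le ht))).2

lemma bd_comp_logPolar {Ω : Set (ℝ × ℝ)} (hΩ : IsOpen Ω) (hp : p ∈ Ω)
    (hg : ContDiffOn ℝ (⊤ : ℕ∞) g Ω) (h0 : g p = 0) : ∃ r > 0, ∀ t0, exp t0 ≤ r →
      MapsTo (logPolar p) (strip t0) Ω ∧
      Bd (strip t0) (fun z => exp z.1) fun y => g (logPolar p y) := by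
  obtain ⟨C, hC, r, hr, h⟩ := Van.bound (m := 1) hΩ hp hg ⟨h0, fun _ => trivial⟩
  obtain ⟨r1, hr1, h1⟩ := isBigO_comp_logPolar hΩ hp (smooth_dd hΩ hg (1, 0))
  obtain ⟨r2, hr2, h2⟩ := isBigO_comp_logPolar hΩ hp (smooth_dd hΩ hg (0, 1))
  refine ⟨min r (min r1 r2), by positivity, fun t0 ht => ?_⟩
  rw [le_min_iff, le_min_iff] at ht
  have hm : MapsTo (logPolar p) (strip t0) Ω := mapsTo_logPolar (fun x hx => (h x hx).1) ht.1
  refine ⟨hm, hg.comp contDiff_logPolar.contDiffOn hm,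
    isBigO_principal.2 ⟨C, fun y hy => ?_⟩, fun v => ?_⟩
  · have h3 := norm_logPolar_sub_le (p := p) y
    have h4 := (h (logPolar p y) (h3.trans_lt ((exp_lt_exp.2 hy).trans_le ht.1))).2
    simp only [norm_eq_abs, abs_exp, pow_one] at *
    exact h4.trans (by gcongr)
  · refine isBigO_congr_left_on (fun y hy => (dd_comp_logPolar
      (diffAt_of_smooth hΩ hg (hm hy))).symm) ?_
    have bc : ∀ a b : ℝ, (fun y : ℝ × ℝ => a * cos y.2 + b * sin y.2)
        =O[𝓟 (strip t0)] fun _ => (1 : ℝ) := fun a b => by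
      refine isBigO_of_le' (c := |a| + |b|) _ fun y => ?_
      have e1 := abs_cos_le_one y.2
      have e2 := abs_sin_le_one y.2
      calc ‖a * cos y.2 + b * sin y.2‖ ≤ |a * cos y.2| + |b * sin y.2| := abs_add_le _ _
        _ ≤ |a| * 1 + |b| * 1 := by
          rw [abs_mul, abs_mul]; gcongr
        _ = _ := by simp
    refine isBigO_mul_one (isBigO_refl _ _) (IsBigO.add ?_ ?_)
    · exact isBigO_mul_one ((bc v.1 (-v.2)).congr_left fun y => by ring) (h1 t0 ht.2.1)
    · exact isBigO_mul_one ((bc v.2 v.1).congr_left fun y => by ring) (h2 t0 ht.2.2)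

lemma bd_cos : Bd S (fun _ => 1) fun y => cos y.2 := by
  refine ⟨by fun_prop, isBigO_of_le _ fun y => by simpa using abs_cos_le_one _, fun v => ?_⟩
  refine isBigO_congr_left_on (f := fun y => -sin y.2 * v.2) (fun y _ => ?_)
    (isBigO_of_le' (c := |v.2|) _ fun y => ?_)
  · rw [dd_comp (f := Prod.snd) (hasDerivAt_cos _) differentiableAt_snd, dd, fderiv_snd]; rfl
  · have := abs_sin_le_one y.2
    rw [norm_mul, norm_neg, norm_one, _root_.mul_one]
    exact mul_le_of_le_one_left (abs_nonneg _) this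

lemma bd_sin : Bd S (fun _ => 1) fun y => sin y.2 := by
  refine ⟨by fun_prop, isBigO_of_le _ fun y => by simpa using abs_sin_le_one _, fun v => ?_⟩
  refine isBigO_congr_left_on (f := fun y => cos y.2 * v.2) (fun y _ => ?_)
    (isBigO_of_le' (c := |v.2|) _ fun y => ?_)
  · rw [dd_comp (f := Prod.snd) (hasDerivAt_sin _) differentiableAt_snd, dd, fderiv_snd]; rfl
  · have := abs_cos_le_one y.2
    rw [norm_mul, norm_one, _root_.mul_one]
    exact mul_le_of_le_one_left (abs_nonneg _) this

lemma eventually_eq_zero_of_logPolar (h0 : g p = 0)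
    (h : ∀ t < t0, ∀ θ ∈ Ico 0 (2 * π), g (logPolar p (t, θ)) = 0) : ∀ᶠ x in 𝓝 p, g x = 0 := by
  have hc : Continuous fun x : ℝ × ℝ => ‖toC (x - p)‖ := by
    have : (fun x : ℝ × ℝ => toC (x - p)) =
        fun x => ((x - p).1 : ℂ) + ((x - p).2 : ℂ) * Complex.I := by
      ext x; simp [toC, Complex.mk_eq_add_mul_I]
    rw [show (fun x : ℝ × ℝ => ‖toC (x - p)‖) =
        fun x => ‖((x - p).1 : ℂ) + ((x - p).2 : ℂ) * Complex.I‖ from by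
      ext x; rw [← congr_fun this x]]
    fun_prop
  have : ∀ᶠ x in 𝓝 p, ‖toC (x - p)‖ < exp t0 := by
    refine hc.continuousAt.eventually_lt_const ?_
    simp only [sub_self]
    have : toC 0 = 0 := rfl
    rw [this, norm_zero]; exact exp_pos _
  filter_upwards [this] with x hx
  by_cases hxp : toC (x - p) = 0
  · have h1 : x - p = 0 := Prod.ext (congrArg Complex.re hxp) (congrArg Complex.im hxp)
    rwa [sub_eq_zero.1 h1]
  have hn : 0 < ‖toC (x - p)‖ := norm_pos_iff.2 hxp
  have ht : log ‖toC (x - p)‖ < t0 := (log_lt_iff_lt_exp hn).2 hx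
  have hz : logPolar p (log ‖toC (x - p)‖, (toC (x - p)).arg) = x := by
    ext
    · simp only [logPolar, exp_log hn, Complex.norm_mul_cos_arg]; simp [toC]
    · simp only [logPolar, exp_log hn, Complex.norm_mul_sin_arg]; simp [toC]
  have ha := Complex.neg_pi_lt_arg (toC (x - p))
  have hb := Complex.arg_le_pi (toC (x - p))
  rcases le_or_gt 0 (toC (x - p)).arg with hs | hs
  · rw [← hz]; exact h _ ht _ ⟨hs, by linarith [pi_pos]⟩
  · have := h _ ht ((toC (x - p)).arg + 2 * π) ⟨by linarith [pi_pos], by linarith⟩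
    have hper := per_comp_logPolar (g := g) (p := p) (log ‖toC (x - p)‖) (toC (x - p)).arg
    simp only [hz] at hper
    rw [← hper, this]

end LogPolar

section StrongUniqueContinuation

open Asymptotics Filter Topology

lemma abs_rotated_quad_le {c s x y z : ℝ} (h : c ^ 2 + s ^ 2 = 1) (hx : |x| ≤ 1 / 16)
    (hy : |y| ≤ 1 / 16) (hz : |z| ≤ 1 / 16) :
    |c * c * x + 2 * (c * s) * y + s * s * z| ≤ 1 / 8 ∧
    |(c * c - s * s) * y + c * s * (z - x)| ≤ 1 / 8 := by
  have h1 : |2 * (c * s)| ≤ 1 := abs_le.2 ⟨by nlinarith [sq_nonneg (c + s)],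
    by nlinarith [sq_nonneg (c - s)]⟩
  have h2 : |c * c - s * s| ≤ 1 := abs_le.2 ⟨by nlinarith [sq_nonneg c],
    by nlinarith [sq_nonneg s]⟩
  have h3 : |2 * (c * s) * y| ≤ 1 * (1 / 16) := by rw [abs_mul]; gcongr
  have h4 : |(c * c - s * s) * y| ≤ 1 * (1 / 16) := by rw [abs_mul]; gcongr
  have h5 : |2 * (c * s) * (z - x)| ≤ 1 * (1 / 8) := by
    rw [abs_mul]
    gcongr
    rw [abs_le] at hx hz ⊢
    constructor <;> linarith
  simp only [abs_le] at *
  refine ⟨⟨?_, ?_⟩, ⟨?_, ?_⟩⟩ <;> nlinarith [sq_nonneg c, sq_nonneg s]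

set_option maxHeartbeats 1000000 in
theorem strong_unique_continuation {Ω : Set (ℝ × ℝ)} {w A11 A12 A22 B1 B2 : ℝ × ℝ → ℝ}
    {p : ℝ × ℝ} (hΩ : IsOpen Ω) (hp : p ∈ Ω) (sw : ContDiffOn ℝ (⊤ : ℕ∞) w Ω)
    (s11 : ContDiffOn ℝ (⊤ : ℕ∞) A11 Ω) (s12 : ContDiffOn ℝ (⊤ : ℕ∞) A12 Ω)
    (s22 : ContDiffOn ℝ (⊤ : ℕ∞) A22 Ω) (sB1 : ContDiffOn ℝ (⊤ : ℕ∞) B1 Ω)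
    (sB2 : ContDiffOn ℝ (⊤ : ℕ∞) B2 Ω) (h11 : A11 p = 1) (h12 : A12 p = 0) (h22 : A22 p = 1)
    (hB1 : ∀ x ∈ Ω, B1 x = A11 x * dd (1, 0) w x + A12 x * dd (0, 1) w x)
    (hB2 : ∀ x ∈ Ω, B2 x = A12 x * dd (1, 0) w x + A22 x * dd (0, 1) w x)
    (hdiv : ∀ x ∈ Ω, dd (1, 0) B1 x + dd (0, 1) B2 x = 0) (hv : ∀ m, Van p m w) :
    ∀ᶠ x in 𝓝 p, w x = 0 := by
  have hw0 : w p = 0 := (hv 1).1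
  have hdw : ∀ v, dd v w p = 0 := fun v => ((hv 2).2 v).1
  obtain ⟨r1, hr1, b1⟩ := bd_comp_logPolar hΩ hp sw hw0
  obtain ⟨r2, hr2, b2⟩ := bd_comp_logPolar hΩ hp (s11.sub contDiffOn_const)
    (show A11 p - 1 = 0 by rw [h11, sub_self])
  obtain ⟨r3, hr3, b3⟩ := bd_comp_logPolar hΩ hp s12 h12
  obtain ⟨r4, hr4, b4⟩ := bd_comp_logPolar hΩ hp (s22.sub contDiffOn_const)
    (show A22 p - 1 = 0 by rw [h22, sub_self])
  obtain ⟨r5, hr5, b5⟩ := bd_comp_logPolar hΩ hp sB1 (by rw [hB1 p hp, hdw, hdw]; ring)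
  obtain ⟨r6, hr6, b6⟩ := bd_comp_logPolar hΩ hp sB2 (by rw [hB2 p hp, hdw, hdw]; ring)
  have hsmall : ∀ g : ℝ × ℝ → ℝ, ContDiffOn ℝ (⊤ : ℕ∞) g Ω → g p = 0 →
      ∃ r > 0, ∀ x, ‖x - p‖ < r → |g x| ≤ 1 / 16 := by
    intro g hg h0
    have := (diffAt_of_smooth hΩ hg hp).continuousAt.abs.eventually_le_const
      (show |g p| < 1 / 16 by rw [h0]; norm_num)
    obtain ⟨r, hr, h⟩ := Metric.eventually_nhds_iff.1 this
    exact ⟨r, hr, fun x hx => h (by rwa [dist_eq_norm])⟩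
  obtain ⟨r7, hr7, b7⟩ := hsmall _ (s11.sub contDiffOn_const)
    (show A11 p - 1 = 0 by rw [h11, sub_self])
  obtain ⟨r8, hr8, b8⟩ := hsmall _ s12 h12
  obtain ⟨r9, hr9, b9⟩ := hsmall _ (s22.sub contDiffOn_const)
    (show A22 p - 1 = 0 by rw [h22, sub_self])
  obtain ⟨t0, ht0, hr⟩ : ∃ t0 ≤ (0 : ℝ), exp t0 ≤ r1 ∧ exp t0 ≤ r2 ∧ exp t0 ≤ r3 ∧
      exp t0 ≤ r4 ∧ exp t0 ≤ r5 ∧ exp t0 ≤ r6 ∧ exp t0 ≤ r7 ∧ exp t0 ≤ r8 ∧ exp t0 ≤ r9 := by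
    have h0 : Tendsto exp atBot (𝓝 0) := tendsto_exp_atBot
    have hh : ∀ r > 0, ∀ᶠ t in atBot, exp t ≤ r := fun r hr => h0.eventually_le_const hr
    have := ((((((((((eventually_le_atBot (0 : ℝ)).and (hh r1 hr1)).and (hh r2 hr2)).and
      (hh r3 hr3)).and (hh r4 hr4)).and (hh r5 hr5)).and (hh r6 hr6)).and (hh r7 hr7)).and
      (hh r8 hr8)).and (hh r9 hr9)).exists
    obtain ⟨t, ht⟩ := this
    exact ⟨t, by tauto, by tauto⟩
  obtain ⟨e1, e2, e3, e4, e5, e6, e7, e8, e9⟩ := hr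
  obtain ⟨hm, b1⟩ := b1 t0 e1
  replace b2 := (b2 t0 e2).2
  replace b3 := (b3 t0 e3).2
  replace b4 := (b4 t0 e4).2
  replace b5 := (b5 t0 e5).2
  replace b6 := (b6 t0 e6).2
  have hclose : ∀ y ∈ strip t0, ∀ r, exp t0 ≤ r → ‖logPolar p y - p‖ < r := fun y hy r h =>
    (norm_logPolar_sub_le y).trans_lt ((exp_lt_exp.2 hy).trans_le h)
  have ho := isOpen_strip t0
  have hE := isBigO_exp_one ht0
  set S := strip t0 with hS
  set f : ℝ × ℝ → ℝ := fun y => w (logPolar p y) with hf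
  set q1 : ℝ × ℝ → ℝ := fun y => A11 (logPolar p y) - 1 with hq1
  set q2 : ℝ × ℝ → ℝ := fun y => A12 (logPolar p y) with hq2
  set q3 : ℝ × ℝ → ℝ := fun y => A22 (logPolar p y) - 1 with hq3
  set D1 : ℝ × ℝ → ℝ := fun y => B1 (logPolar p y) with hD1
  set D2 : ℝ × ℝ → ℝ := fun y => B2 (logPolar p y) with hD2
  have bcc := (bd_cos (S := S)).mul_one ho bd_cos
  have bcs := (bd_cos (S := S)).mul_one ho bd_sin
  have bss := (bd_sin (S := S)).mul_one ho bd_sin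
  set a' : ℝ × ℝ → ℝ := fun y => q1 y * (cos y.2 * cos y.2) + q2 y * (cos y.2 * sin y.2 * 2) +
    q3 y * (sin y.2 * sin y.2) with ha'
  set c' : ℝ × ℝ → ℝ := fun y => q1 y * (sin y.2 * sin y.2) + q2 y * (cos y.2 * sin y.2 * (-2)) +
    q3 y * (cos y.2 * cos y.2) with hc'
  set b : ℝ × ℝ → ℝ := fun y => q1 y * (cos y.2 * sin y.2 * (-1)) +
    q2 y * (cos y.2 * cos y.2 + sin y.2 * sin y.2 * (-1)) + q3 y * (cos y.2 * sin y.2) with hb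
  have Ba' : Bd S (fun z => exp z.1) a' := ((b2.mul_one ho bcc).add ho
    (b3.mul_one ho (bcs.mul_one ho (bd_const 2)))).add ho (b4.mul_one ho bss)
  have Bc' : Bd S (fun z => exp z.1) c' := ((b2.mul_one ho bss).add ho
    (b3.mul_one ho (bcs.mul_one ho (bd_const (-2))))).add ho (b4.mul_one ho bcc)
  have Bb : Bd S (fun z => exp z.1) b := ((b2.mul_one ho (bcs.mul_one ho (bd_const (-1)))).add ho
    (b3.mul_one ho (bcc.add ho (bss.mul_one ho (bd_const (-1)))))).add ho (b4.mul_one ho bcs)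
  have hcs : ∀ θ : ℝ, cos θ ^ 2 + sin θ ^ 2 = 1 := cos_sq_add_sin_sq
  have hq : ∀ y ∈ S, |q1 y| ≤ 1 / 16 ∧ |q2 y| ≤ 1 / 16 ∧ |q3 y| ≤ 1 / 16 := fun y hy =>
    ⟨b7 _ (hclose y hy _ e7), b8 _ (hclose y hy _ e8), b9 _ (hclose y hy _ e9)⟩
  have la' : ∀ y ∈ S, |a' y| ≤ 1 / 8 := fun y hy => by
    have := (abs_rotated_quad_le (hcs y.2) (hq y hy).1 (hq y hy).2.1 (hq y hy).2.2).1
    convert this using 2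
    simp only [ha']; ring
  have lc' : ∀ y ∈ S, |c' y| ≤ 1 / 8 := fun y hy => by
    have := (abs_rotated_quad_le (s := - cos y.2) (c := sin y.2) (by linarith [hcs y.2])
      (hq y hy).1 (hq y hy).2.1 (hq y hy).2.2).1
    convert this using 2
    simp only [hc']; ring
  have lb : ∀ y ∈ S, |b y| ≤ 1 / 8 := fun y hy => by
    have := (abs_rotated_quad_le (hcs y.2) (hq y hy).1 (hq y hy).2.1 (hq y hy).2.2).2
    convert this using 2
    simp only [hb]; ring
  set a : ℝ × ℝ → ℝ := fun y => 1 + a' y with ha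
  have Ba : Bd S (fun _ => 1) a := (bd_const 1).add ho (Ba'.mono hE)
  have la : ∀ y ∈ S, 7 / 8 ≤ a y ∧ a y ≤ 9 / 8 := fun y hy => by
    have := abs_le.1 (la' y hy)
    simp only [ha]
    constructor <;> linarith
  set α : ℝ × ℝ → ℝ := fun y => (a y)⁻¹ with hα
  have Bα : Bd S (fun _ => 1) α := Ba.inv ho fun z hz => by linarith [(la z hz).1]
  have haα : ∀ z ∈ S, a z * α z = 1 := fun z hz => mul_inv_cancel₀ (by linarith [(la z hz).1])
  have lα : ∀ z ∈ S, 1 / 2 ≤ α z ∧ α z ≤ 8 / 7 := fun z hz => by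
    have h1 := haα z hz
    have h2 := la z hz
    have h3 : 0 < α z := inv_pos.2 (by linarith)
    constructor <;> nlinarith
  set β : ℝ × ℝ → ℝ := fun y => b y * α y with hβ
  have Bβ : Bd S (fun z => exp z.1) β := Bb.mul_one ho Bα
  set k' : ℝ × ℝ → ℝ := fun y => c' y + b y * (-β y) with hk'
  have Bk' : Bd S (fun z => exp z.1) k' := Bc'.add ho (Bb.mul_one ho ((Bβ.mono hE).neg ho))
  set k : ℝ × ℝ → ℝ := fun y => 1 + k' y with hk
  have Bk : Bd S (fun _ => 1) k := (bd_const 1).add ho (Bk'.mono hE)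
  have lk : ∀ z ∈ S, 1 / 2 ≤ k z ∧ k z ≤ 2 := fun z hz => by
    have h1 := abs_le.1 (lc' z hz)
    have h2 := lα z hz
    have h3 : b z ^ 2 ≤ 1 / 64 := by
      have := lb z hz
      calc b z ^ 2 = |b z| ^ 2 := (sq_abs _).symm
        _ ≤ (1 / 8) ^ 2 := by gcongr
        _ = _ := by norm_num
    have h4 : b z * (-β z) = - (b z ^ 2 * α z) := by simp only [hβ]; ring
    have h5 : 0 ≤ b z ^ 2 * α z := by
      have := h2.1
      positivity
    have h6 : b z ^ 2 * α z ≤ 1 / 64 * (8 / 7) := by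
      gcongr
      · linarith
      · linarith
    simp only [hk, hk', h4]
    constructor <;> linarith
  have dshift : ∀ {g : ℝ × ℝ → ℝ}, Bd S (fun z => exp z.1) g → ∀ v,
      dd v (fun y => 1 + g y) =O[𝓟 S] fun z => exp z.1 := fun {g} hg v => by
    refine isBigO_congr_left_on (fun x hx => ?_) (hg.2.2 v)
    rw [dd_add (differentiableAt_const _) (diffAt_of_smooth ho hg.1 hx), dd_const, zero_add]
  have dα : ∀ v, dd v α =O[𝓟 S] fun z => exp z.1 := fun v => by
    have h1 : Bd S (fun z => exp z.1) fun z => a' z * (- α z) :=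
      Ba'.mul_one ho (Bα.neg ho)
    refine isBigO_congr_left_on (fun x hx => dd_congr ho (fun z hz => ?_) hx) (dshift h1 v)
    have := haα z hz
    simp only [ha] at this
    linarith
  set X : ℝ × ℝ → ℝ := fun y => exp y.1 * (cos y.2 * D1 y + sin y.2 * D2 y) with hX
  set Y : ℝ × ℝ → ℝ := fun y => exp y.1 * (cos y.2 * D2 y - sin y.2 * D1 y) with hY
  have hBD1 : ∀ z ∈ S, D1 z = (1 + q1 z) * dd (1, 0) w (logPolar p z) +
      q2 z * dd (0, 1) w (logPolar p z) := fun z hz => by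
    simp only [hD1, hB1 _ (hm hz), hq1, hq2]; ring
  have hBD2 : ∀ z ∈ S, D2 z = q2 z * dd (1, 0) w (logPolar p z) +
      (1 + q3 z) * dd (0, 1) w (logPolar p z) := fun z hz => by
    simp only [hD2, hB2 _ (hm hz), hq3, hq2]; ring
  have hfv : ∀ v, ∀ z ∈ S, dd v f z = _ := fun v z hz =>
    dd_comp_logPolar (v := v) (diffAt_of_smooth hΩ sw (hm hz))
  have eX : ∀ z ∈ S, X z = a z * dd (1, 0) f z + b z * dd (0, 1) f z := fun z hz => by
    rw [hfv _ z hz, hfv _ z hz]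
    simp only [hX, hBD1 z hz, hBD2 z hz, ha, ha', hb]
    linear_combination (-(exp z.1) * (cos z.2 * q1 z * dd (1, 0) w (logPolar p z) +
      sin z.2 * q2 z * dd (1, 0) w (logPolar p z) + cos z.2 * q2 z * dd (0, 1) w (logPolar p z) +
      sin z.2 * q3 z * dd (0, 1) w (logPolar p z))) * hcs z.2
  have eY : ∀ z ∈ S, Y z = b z * dd (1, 0) f z + (1 + c' z) * dd (0, 1) f z := fun z hz => by
    rw [hfv _ z hz, hfv _ z hz]
    simp only [hY, hBD1 z hz, hBD2 z hz, hc', hb]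
    linear_combination (-(exp z.1) * (-sin z.2 * q1 z * dd (1, 0) w (logPolar p z) +
      cos z.2 * q2 z * dd (1, 0) w (logPolar p z) - sin z.2 * q2 z * dd (0, 1) w (logPolar p z) +
      cos z.2 * q3 z * dd (0, 1) w (logPolar p z))) * hcs z.2
  have hft : ∀ z ∈ S, dd (1, 0) f z = α z * X z - β z * dd (0, 1) f z := fun z hz => by
    rw [eX z hz]
    simp only [hβ]
    linear_combination (-dd (1, 0) f z) * haα z hz
  have hY' : ∀ z ∈ S, β z * X z + k z * dd (0, 1) f z = Y z := fun z hz => by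
    rw [eY z hz, eX z hz]
    simp only [hk, hk', hβ]
    linear_combination (b z * dd (1, 0) f z) * haα z hz
  have sexp : ContDiffOn ℝ (⊤ : ℕ∞) (fun z : ℝ × ℝ => exp z.1) S := by fun_prop
  have scos : ContDiffOn ℝ (⊤ : ℕ∞) (fun z : ℝ × ℝ => cos z.2) S := by fun_prop
  have ssin : ContDiffOn ℝ (⊤ : ℕ∞) (fun z : ℝ × ℝ => sin z.2) S := by fun_prop
  have sX : ContDiffOn ℝ (⊤ : ℕ∞) X S := sexp.mul ((scos.mul b5.1).add (ssin.mul b6.1))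
  have dexp : ∀ (v z : ℝ × ℝ), dd v (fun z : ℝ × ℝ => exp z.1) z = exp z.1 * v.1 := fun v z => by
    rw [dd_comp (f := Prod.fst) (hasDerivAt_exp _) differentiableAt_fst, dd, fderiv_fst]; rfl
  have dcos : ∀ (v z : ℝ × ℝ), dd v (fun z : ℝ × ℝ => cos z.2) z = -sin z.2 * v.2 := fun v z => by
    rw [dd_comp (f := Prod.snd) (hasDerivAt_cos _) differentiableAt_snd, dd, fderiv_snd]; rfl
  have dsin : ∀ (v z : ℝ × ℝ), dd v (fun z : ℝ × ℝ => sin z.2) z = cos z.2 * v.2 := fun v z => by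
    rw [dd_comp (f := Prod.snd) (hasDerivAt_sin _) differentiableAt_snd, dd, fderiv_snd]; rfl
  have hXt : ∀ z ∈ S, dd (1, 0) X z =
      - dd (0, 1) (fun z => β z * X z + k z * dd (0, 1) f z) z := fun z hz => by
    have he := diffAt_of_smooth ho sexp hz
    have hc := diffAt_of_smooth ho scos hz
    have hs := diffAt_of_smooth ho ssin hz
    have h1 := diffAt_of_smooth ho b5.1 hz
    have h2 := diffAt_of_smooth ho b6.1 hz
    have hd1 : ∀ v, dd v D1 z = _ := fun v =>
      dd_comp_logPolar (v := v) (diffAt_of_smooth hΩ sB1 (hm hz))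
    have hd2 : ∀ v, dd v D2 z = _ := fun v =>
      dd_comp_logPolar (v := v) (diffAt_of_smooth hΩ sB2 (hm hz))
    rw [dd_congr ho hY' hz, hX, hY, dd_mul he ((hc.fun_mul h1).fun_add (hs.fun_mul h2)),
      dd_mul he ((hc.fun_mul h2).fun_sub (hs.fun_mul h1)),
      dd_add (hc.fun_mul h1) (hs.fun_mul h2), dd_sub (hc.fun_mul h2) (hs.fun_mul h1),
      dd_mul hc h1, dd_mul hs h2, dd_mul hc h2, dd_mul hs h1]
    simp only [dexp, dcos, dsin, hd1, hd2]
    have hz0 := hdiv _ (hm hz)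
    linear_combination (exp z.1 * exp z.1 * (cos z.2 ^ 2 + sin z.2 ^ 2)) * hz0
  have oneE : ∀ {g h : ℝ × ℝ → ℝ}, Bd S (fun _ => 1) g → h =O[𝓟 S] (fun z => exp z.1) →
      (fun z => g z * h z) =O[𝓟 S] fun z => exp z.1 := fun hg hh => isBigO_one_mul hg.2.1 hh
  have o1 : (fun z => dd (1, 0) α z + dd (0, 1) α z * β z - α z * dd (0, 1) β z) =O[𝓟 S]
      fun z => exp z.1 :=
    ((dα _).add (isBigO_mul_one (dα _) (Bβ.2.1.trans hE))).sub (oneE Bα (Bβ.2.2 _))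
  have o2 : (fun z => - dd (1, 0) k z + k z * dd (0, 1) β z - dd (0, 1) k z * β z) =O[𝓟 S]
      fun z => exp z.1 :=
    ((dshift Bk' _).neg_left.add (oneE Bk (Bβ.2.2 _))).sub
      (isBigO_mul_one (dshift Bk' _) (Bβ.2.1.trans hE))
  have o3 : (fun z => dd (1, 0) a z + dd (0, 1) (fun z => a z * β z) z) =O[𝓟 S]
      fun z => exp z.1 := by
    refine (dshift Ba' _).add ?_
    have h1 := (Bβ.mul_one ho Ba).2.2 (0, 1)
    simpa only [mul_comm] using h1
  have o4 : X =O[𝓟 S] fun z => exp z.1 :=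
    isBigO_mul_one (isBigO_refl _ _) ((isBigO_one_mul bd_cos.2.1 (b5.2.1.trans hE)).add
      (isBigO_one_mul bd_sin.2.1 (b6.2.1.trans hE)))
  obtain ⟨C1, hC1⟩ := isBigO_principal.1 o1
  obtain ⟨C2, hC2⟩ := isBigO_principal.1 o2
  obtain ⟨C3, hC3⟩ := isBigO_principal.1 o3
  obtain ⟨C4, hC4⟩ := isBigO_principal.1 o4
  obtain ⟨C5, hC5⟩ := isBigO_principal.1 (b1.2.2 (0, 1))
  obtain ⟨C6, hC6⟩ := isBigO_principal.1 (b1.2.1.trans hE)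
  simp only [norm_eq_abs, abs_exp, abs_one, _root_.mul_one] at hC1 hC2 hC3 hC4 hC5 hC6
  obtain ⟨C, hC, g1, g2, g3, g4, g5, g6⟩ : ∃ C, 0 ≤ C ∧ C1 ≤ C ∧ C2 ≤ C ∧ C3 ≤ C ∧ C4 ≤ C ∧
      C5 ≤ C ∧ C6 ≤ C := by
    have := ((((((Filter.eventually_ge_atTop (0 : ℝ)).and (eventually_ge_atTop C1)).and
      (eventually_ge_atTop C2)).and (eventually_ge_atTop C3)).and (eventually_ge_atTop C4)).and
      (eventually_ge_atTop C5)).and (eventually_ge_atTop C6)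
    obtain ⟨C, h⟩ := this.exists
    exact ⟨C, by tauto, by tauto⟩
  have up : ∀ {x c y : ℝ}, x ≤ c * exp y → c ≤ C → x ≤ C * exp y := fun h hc =>
    h.trans (mul_le_mul_of_nonneg_right hc (exp_pos _).le)
  refine eventually_eq_zero_of_logPolar hw0 (strip_unique_continuation ht0 hC b1.1 sX Bα.1 Bβ.1
    Bk.1 Ba.1 per_comp_logPolar ?_ ?_ ?_ ?_ ?_ haα hft hXt (fun z hz => ⟨(lα z hz).1, ?_⟩) lk
    (fun z hz => up (hC1 z hz) g1) (fun z hz => up (hC2 z hz) g2)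
    (fun z hz => up (hC3 z hz) g3) ?_ (fun z hz => up (hC4 z hz) g4)
    (fun z hz => up (hC5 z hz) g5) (fun z hz => (hC6 z hz).trans g6))
  · intro t θ
    simp [hX, hD1, hD2, logPolar]
  · intro t θ
    simp [hα, ha, ha', hq1, hq2, hq3, logPolar]
  · intro t θ
    simp [hβ, hb, hα, ha, ha', hq1, hq2, hq3, logPolar]
  · intro t θ
    simp [hk, hk', hc', hβ, hb, hα, ha, ha', hq1, hq2, hq3, logPolar]
  · intro t θ
    simp [ha, ha', hq1, hq2, hq3, logPolar]
  · linarith [(lα z hz).2]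
  · intro m
    obtain ⟨M, hM, r, hr, hb⟩ := (hv m).bound hΩ hp sw
    refine ⟨M + C / r ^ m, fun z hz => ?_⟩
    have hexp : exp (m * z.1) = exp z.1 ^ m := exp_nat_mul _ _
    have hn := norm_logPolar_sub_le (p := p) z
    rw [hexp, add_mul]
    rcases lt_or_ge (exp z.1) r with h | h
    · have h1 := (hb _ (hn.trans_lt h)).2
      have h2 : M * ‖logPolar p z - p‖ ^ m ≤ M * exp z.1 ^ m := by gcongr
      have h3 : 0 ≤ C / r ^ m * exp z.1 ^ m := by positivity
      exact h1.trans (by linarith)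
    · have h1 : |f z| ≤ C := (hC6 z hz).trans g6
      have h2 : C / r ^ m * r ^ m ≤ C / r ^ m * exp z.1 ^ m := by gcongr
      rw [div_mul_cancel₀ _ (by positivity)] at h2
      have h3 : 0 ≤ M * exp z.1 ^ m := by positivity
      linarith

end StrongUniqueContinuation

section Winding

open Topology Filter

lemma toC_sub (x y : ℝ × ℝ) : toC (x - y) = toC x - toC y := by
  apply Complex.ext <;> simp [toC]

lemma toC_add (x y : ℝ × ℝ) : toC (x + y) = toC x + toC y := by
  apply Complex.ext <;> simp [toC]

lemma toC_smul (s : ℝ) (x : ℝ × ℝ) : toC (s • x) = s * toC x := by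
  apply Complex.ext <;> simp [toC]

@[fun_prop]
lemma continuous_toC : Continuous toC := Complex.equivRealProdCLM.symm.continuous

lemma toC_injective : Function.Injective toC := fun _ _ h =>
  Prod.ext (congrArg Complex.re h) (congrArg Complex.im h)

lemma toC_ne_zero {x y : ℝ × ℝ} (h : x ≠ y) : toC (x - y) ≠ 0 := fun h0 =>
  h (toC_injective (sub_eq_zero.1 (by rwa [← toC_sub])))

lemma eqOn_of_exp_eqOn_const {α : Type*} [TopologicalSpace α] {S : Set α} {g : α → ℂ} {κ : ℂ}
    (hS : IsPreconnected S) (hg : ContinuousOn g S) (h : ∀ z ∈ S, Complex.exp (g z) = κ)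
    {x y : α} (hx : x ∈ S) (hy : y ∈ S) : g x = g y := by
  refine hS.induction₂ (fun x y => g x = g y) (fun x hx => ?_)
    (fun _ _ _ _ _ _ h1 h2 => h1.trans h2) (fun _ _ _ _ h => h.symm) hx hy
  have h1 : ∀ᶠ y in 𝓝[S] x, ‖g y - g x‖ < 2 * π := by
    have := ((hg x hx).sub (continuousWithinAt_const (b := g x))).norm.tendsto
    simp only [Pi.sub_apply, sub_self, norm_zero] at this
    exact this.eventually_lt_const (by positivity)
  filter_upwards [h1, self_mem_nhdsWithin] with y hy hyS
  have he : Complex.exp (g y - g x) = 1 := by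
    rw [Complex.exp_sub, h y hyS, h x hx, div_self]
    rw [← h x hx]; exact Complex.exp_ne_zero _
  obtain ⟨n, hn⟩ := Complex.exp_eq_one_iff.1 he
  rw [hn, norm_mul] at hy
  have h2 : ‖(2 * π * Complex.I : ℂ)‖ = 2 * π := by
    simp [abs_of_pos pi_pos]
  rw [h2, Complex.norm_intCast] at hy
  have h3 : |(n : ℝ)| < 1 := by
    have := pi_pos
    by_contra! hcon
    nlinarith
  have h4 : n = 0 := by
    rw [← Int.abs_lt_one_iff]
    exact_mod_cast h3
  rw [h4, Int.cast_zero, zero_mul, sub_eq_zero] at hn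
  exact hn.symm

/-- There is a continuous branch of `log (z - a)` on `K`. -/
def HasLog (K : Set (ℝ × ℝ)) (a : ℝ × ℝ) : Prop :=
  ∃ l : ℝ × ℝ → ℂ, ContinuousOn l K ∧ ∀ z ∈ K, Complex.exp (l z) = toC (z - a)

lemma HasLog.of_near {K : Set (ℝ × ℝ)} {a b : ℝ × ℝ} (ha : HasLog K a)
    (h : ∀ z ∈ K, ‖toC (b - a)‖ < ‖toC (z - a)‖) : HasLog K b := by
  obtain ⟨l, hl, he⟩ := ha
  have h0 : ∀ z ∈ K, toC (z - a) ≠ 0 := fun z hz =>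
    norm_pos_iff.1 ((norm_nonneg _).trans_lt (h z hz))
  have hs : ∀ z ∈ K, 1 + - (toC (b - a) / toC (z - a)) ∈ Complex.slitPlane := fun z hz => by
    refine Complex.mem_slitPlane_of_norm_lt_one ?_
    rw [norm_neg, norm_div, div_lt_one (norm_pos_iff.2 (h0 z hz))]
    exact h z hz
  refine ⟨fun z => l z + Complex.log (1 + - (toC (b - a) / toC (z - a))), ?_, fun z hz => ?_⟩
  · refine hl.add (ContinuousOn.clog ?_ hs)
    refine continuousOn_const.add (ContinuousOn.neg (continuousOn_const.div ?_ h0))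
    fun_prop
  · rw [Complex.exp_add, he z hz, Complex.exp_log (Complex.slitPlane_ne_zero (hs z hz)), mul_add,
      mul_neg, mul_div_cancel₀ _ (h0 z hz), toC_sub, toC_sub, toC_sub]
    ring

lemma HasLog.of_isPreconnected {K C : Set (ℝ × ℝ)} {a b : ℝ × ℝ} (ha : HasLog K a)
    (hK : IsClosed K) (hC : IsPreconnected C) (hd : Disjoint C K) (haC : a ∈ C) (hbC : b ∈ C) :
    HasLog K b := by
  refine (hC.induction₂ (fun x y => HasLog K x ↔ HasLog K y) (fun x hx => ?_)
    (fun _ _ _ _ _ _ h1 h2 => h1.trans h2) (fun _ _ _ _ h => h.symm) haC hbC).1 ha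
  have hx : x ∉ K := disjoint_left.1 hd hx
  have h1 : ∀ᶠ y in 𝓝 x, ∀ z ∈ K, ‖toC (y - x)‖ < ‖toC (z - x)‖ ∧
      ‖toC (x - y)‖ < ‖toC (z - y)‖ := by
    obtain ⟨δ, hδ, hball⟩ : ∃ δ > 0, ∀ z ∈ K, δ ≤ ‖toC (z - x)‖ := by
      obtain ⟨δ, hδ, hb⟩ := Metric.isOpen_iff.1 hK.isOpen_compl x hx
      refine ⟨δ, hδ, fun z hz => ?_⟩
      by_contra! hcon
      refine hb (?_ : z ∈ Metric.ball x δ) hz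
      rw [mem_ball_iff_norm, Prod.norm_def]
      refine lt_of_le_of_lt (max_le ?_ ?_) hcon
      · exact Complex.abs_re_le_norm (toC (z - x))
      · exact Complex.abs_im_le_norm (toC (z - x))
    have hc : Continuous fun y => ‖toC (y - x)‖ := by fun_prop
    have : ∀ᶠ y in 𝓝 x, ‖toC (y - x)‖ < δ / 2 := by
      refine hc.continuousAt.eventually_lt_const ?_
      have : toC 0 = 0 := rfl
      simp only [sub_self, this, norm_zero]; positivity
    filter_upwards [this] with y hy z hz
    have h2 := hball z hz
    have h3 : ‖toC (x - y)‖ = ‖toC (y - x)‖ := by rw [toC_sub, toC_sub, norm_sub_rev]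
    have h4 : ‖toC (z - x)‖ ≤ ‖toC (z - y)‖ + ‖toC (y - x)‖ := by
      rw [← sub_add_sub_cancel z y x, toC_add]; exact norm_add_le _ _
    constructor <;> linarith
  exact (h1.filter_mono nhdsWithin_le_nhds).mono fun y hy =>
    ⟨fun h => h.of_near fun z hz => (hy z hz).1, fun h => h.of_near fun z hz => (hy z hz).2⟩

lemma hasLog_of_convex {Ω K : Set (ℝ × ℝ)} {b : ℝ × ℝ} (hΩ : IsOpen Ω) (hc : Convex ℝ Ω)
    (hK : K ⊆ Ω) (hb : b ∉ Ω) : HasLog K b := by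
  obtain ⟨φ, hφ⟩ := geometric_hahn_banach_open_point hc hΩ hb
  set Z : ℂ := ⟨φ (1, 0), φ (0, 1)⟩ with hZ
  have hre : ∀ x : ℝ × ℝ, ((starRingEnd ℂ Z) * toC x).re = φ x := fun x => by
    have : x = x.1 • ((1 : ℝ), (0 : ℝ)) + x.2 • ((0 : ℝ), (1 : ℝ)) := by ext <;> simp
    conv_rhs => rw [this, map_add, map_smul, map_smul]
    simp [hZ, toC]; ring
  have hs : ∀ z ∈ K, - ((starRingEnd ℂ Z) * toC (z - b)) ∈ Complex.slitPlane := fun z hz => by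
    refine Complex.mem_slitPlane_iff.2 (Or.inl ?_)
    rw [Complex.neg_re, hre, map_sub]
    linarith [hφ z (hK hz)]
  rcases K.eq_empty_or_nonempty with rfl | ⟨z0, hz0⟩
  · exact ⟨fun _ => 0, by simp, by simp⟩
  have hZ0 : starRingEnd ℂ Z ≠ 0 := fun h0 => by
    have := Complex.slitPlane_ne_zero (hs z0 hz0)
    simp [h0] at this
  refine ⟨fun z => Complex.log (- ((starRingEnd ℂ Z) * toC (z - b))) -
    Complex.log (- starRingEnd ℂ Z), ?_, fun z hz => ?_⟩
  · refine ContinuousOn.sub (ContinuousOn.clog ?_ hs) continuousOn_const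
    fun_prop
  · rw [Complex.exp_sub, Complex.exp_log (Complex.slitPlane_ne_zero (hs z hz)),
      Complex.exp_log (neg_ne_zero.2 hZ0), neg_div_neg_eq, mul_div_cancel_left₀ _ hZ0]

lemma add_smul_mem_slitPlane {u : ℂ} (hu : u ∈ Complex.slitPlane) {δ s : ℝ} (hs : 0 ≤ s)
    (hδ : 0 ≤ δ) (h : 0 < s + δ) : (δ : ℂ) + s * u ∈ Complex.slitPlane := by
  rcases hs.eq_or_lt with rfl | hs
  · simpa using h
  rw [Complex.mem_slitPlane_iff] at hu ⊢
  simp only [Complex.add_re, Complex.ofReal_re, Complex.mul_re, Complex.ofReal_im, zero_mul,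
    sub_zero, Complex.add_im, Complex.mul_im, zero_add, add_zero]
  rcases hu with hu | hu
  · left; positivity
  · right; positivity

lemma slitPlane_exp {φ : ℝ} (h : φ ∈ Ioo (-π) π) : Complex.exp (φ * Complex.I) ∈ Complex.slitPlane := by
  rw [Complex.mem_slitPlane_iff_arg]
  refine ⟨?_, Complex.exp_ne_zero _⟩
  rw [Complex.arg_exp_mul_I, toIocMod_eq_self _ |>.2 ⟨h.1, by linarith [h.2]⟩]
  exact h.2.ne

lemma arg_exp {φ : ℝ} (h : φ ∈ Ioo (-π) π) : (Complex.exp (φ * Complex.I)).arg = φ := by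
  rw [Complex.arg_exp_mul_I, toIocMod_eq_self _ |>.2 ⟨h.1, by linarith [h.2]⟩]

lemma log_ratio_ray {p v e e' : ℝ × ℝ} {U U' : ℂ} (hU : U ∈ Complex.slitPlane)
    (hU' : U' ∈ Complex.slitPlane) (h : U * toC e = - toC v) (h' : U' * toC e' = - toC v)
    (he0' : toC e' ≠ 0) {δ ε : ℝ} (hδ : 0 < δ) (hε : 0 ≤ ε)
    {l : ℝ × ℝ → ℂ} (hl : ContinuousOn l ((fun s : ℝ => p + s • v) '' Icc 0 ε))
    (he : ∀ s ∈ Icc 0 ε, Complex.exp (l (p + s • v)) * toC (p + s • v - (p + δ • e')) =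
      toC (p + s • v - (p + δ • e))) :
    l (p + ε • v) = l p + (Complex.log (δ + ε * U) - Complex.log (δ + ε * U')) := by
  have hs : ∀ s ∈ Icc 0 ε, (δ : ℂ) + s * U ∈ Complex.slitPlane := fun s hs =>
    add_smul_mem_slitPlane hU hs.1 hδ.le (by linarith [hs.1])
  have hs' : ∀ s ∈ Icc 0 ε, (δ : ℂ) + s * U' ∈ Complex.slitPlane := fun s hs =>
    add_smul_mem_slitPlane hU' hs.1 hδ.le (by linarith [hs.1])
  have := eqOn_of_exp_eqOn_const (S := Icc 0 ε) (κ := toC e / toC e')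
    (g := fun s : ℝ => l (p + s • v) - (Complex.log (δ + s * U) - Complex.log (δ + s * U')))
    isPreconnected_Icc ?_ (fun s hs0 => ?_) (right_mem_Icc.2 hε) (left_mem_Icc.2 hε)
  · simp only [Complex.ofReal_zero, zero_mul, add_zero, sub_self, sub_zero, zero_smul] at this
    linear_combination this
  · refine ContinuousOn.sub (hl.comp (f := fun s : ℝ => p + s • v) (by fun_prop)
      (mapsTo_image _ _)) (ContinuousOn.sub (ContinuousOn.clog (by fun_prop) hs)
      (ContinuousOn.clog (by fun_prop) hs'))
  · have h1 := he s hs0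
    have n1 := Complex.slitPlane_ne_zero (hs s hs0)
    have n2 := Complex.slitPlane_ne_zero (hs' s hs0)
    have t : ∀ x : ℝ × ℝ, toC (p + s • v - (p + δ • x)) = s * toC v - δ * toC x := fun x => by
      rw [add_sub_add_left_eq_sub, toC_sub, toC_smul, toC_smul]
    rw [t, t] at h1
    rw [Complex.exp_sub, Complex.exp_sub, Complex.exp_log n1, Complex.exp_log n2, div_div_eq_mul_div,
      div_eq_div_iff n1 he0']
    linear_combination (-1 : ℂ) * h1 + Complex.exp (l (p + s • v)) * s * h' - (s : ℂ) * h

lemma log_ratio_path {J : Set (ℝ × ℝ)} (hJ : IsPreconnected J) {a a' x y : ℝ × ℝ} {l : ℝ × ℝ → ℂ}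
    (hl : ContinuousOn l J) (he : ∀ z ∈ J, Complex.exp (l z) * toC (z - a') = toC (z - a))
    (h : ∀ z ∈ J, ‖toC (a' - a)‖ < ‖toC (z - a')‖) (hx : x ∈ J) (hy : y ∈ J) :
    l x - Complex.log (1 + toC (a' - a) / toC (x - a')) =
      l y - Complex.log (1 + toC (a' - a) / toC (y - a')) := by
  have h0 : ∀ z ∈ J, toC (z - a') ≠ 0 := fun z hz =>
    norm_pos_iff.1 ((norm_nonneg _).trans_lt (h z hz))
  have hs : ∀ z ∈ J, 1 + toC (a' - a) / toC (z - a') ∈ Complex.slitPlane := fun z hz => by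
    refine Complex.mem_slitPlane_of_norm_lt_one ?_
    rw [norm_div, div_lt_one (norm_pos_iff.2 (h0 z hz))]
    exact h z hz
  refine eqOn_of_exp_eqOn_const (κ := 1)
    (g := fun z => l z - Complex.log (1 + toC (a' - a) / toC (z - a'))) hJ ?_ (fun z hz => ?_) hx hy
  · refine hl.sub (ContinuousOn.clog (continuousOn_const.add (continuousOn_const.div ?_ h0)) hs)
    fun_prop
  · have n1 := Complex.slitPlane_ne_zero (hs z hz)
    rw [Complex.exp_sub, Complex.exp_log n1, div_eq_one_iff_eq n1, ← mul_left_inj' (h0 z hz),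
      he z hz, add_mul, div_mul_cancel₀ _ (h0 z hz), one_mul, ← toC_add]
    congr 1; abel

/-- If `V` contains two opposite sectors at `p` and reaches out to the complement of `Ω` from each
of its points, then no set in `Ω \ V` avoiding `p` joins the two complementary sectors. -/
theorem no_connection_between_sectors {Ω V J : Set (ℝ × ℝ)} {p : ℝ × ℝ} {e : ℕ → ℝ × ℝ}
    {τ θ ε : ℝ} (hΩ : IsOpen Ω) (hc : Convex ℝ Ω) (hp : p ∈ Ω) (hpV : p ∉ V)
    (hτ : 0 < τ) (hτ2 : τ ≤ π / 2) (hε : 0 < ε)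
    (he : ∀ k, toC (e k) = Complex.exp ((θ + k * τ : ℝ) * Complex.I))
    (h0 : ∀ s ∈ Ioc 0 ε, p + s • e 0 ∈ V) (h2 : ∀ s ∈ Ioc 0 ε, p + s • e 2 ∈ V)
    (h1 : ∀ s ∈ Ioc 0 ε, p + s • e 1 ∈ Ω \ V) (h3 : ∀ s ∈ Ioc 0 ε, p + s • e 3 ∈ Ω \ V)
    (hV : ∀ a ∈ V, ∃ C b, IsPreconnected C ∧ a ∈ C ∧ b ∈ C ∧ b ∉ Ω ∧ C ∩ Ω ⊆ V)
    (hJ : IsCompact J) (hJc : IsPreconnected J) (hJV : J ⊆ Ω \ V) (hpJ : p ∉ J)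
    (hJ1 : p + ε • e 1 ∈ J) (hJ3 : p + ε • e 3 ∈ J) : False := by
  set R : ℕ → Set (ℝ × ℝ) := fun j => (fun s : ℝ => p + s • e j) '' Icc 0 ε with hR
  have hRc : ∀ j, IsCompact (R j) := fun j => isCompact_Icc.image (by fun_prop)
  have hRV : ∀ j, (∀ s ∈ Ioc 0 ε, p + s • e j ∈ Ω \ V) → R j ⊆ Ω \ V := by
    rintro j h _ ⟨s, hs, rfl⟩
    rcases hs.1.eq_or_lt with rfl | h0
    · simpa using ⟨hp, hpV⟩
    · exact h s ⟨h0, hs.2⟩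
  set K := R 1 ∪ R 3 ∪ J with hK
  have hKc : IsCompact K := ((hRc 1).union (hRc 3)).union hJ
  have hKV : K ⊆ Ω \ V := union_subset (union_subset (hRV 1 h1) (hRV 3 h3)) hJV
  have hlog : ∀ a ∈ V, HasLog K a := fun a ha => by
    obtain ⟨C, b, hC, haC, hbC, hb, hCV⟩ := hV a ha
    refine (hasLog_of_convex hΩ hc (fun z hz => (hKV hz).1) hb).of_isPreconnected hKc.isClosed hC
      ?_ hbC haC
    exact disjoint_left.2 fun z hzC hzK => (hKV hzK).2 (hCV ⟨hzC, (hKV hzK).1⟩)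
  obtain ⟨ρ, hρ, hρJ⟩ : ∃ ρ > 0, ∀ z ∈ J, ρ ≤ ‖toC (z - p)‖ := by
    obtain ⟨z0, hz0, hmin⟩ := hJ.exists_isMinOn ⟨_, hJ1⟩
      (f := fun z => ‖toC (z - p)‖) (by fun_prop)
    exact ⟨_, norm_pos_iff.2 (toC_ne_zero fun (h : z0 = p) => hpJ (h ▸ hz0)), fun z hz => hmin hz⟩
  have hne : ∀ k, toC (e k) ≠ 0 := fun k => by rw [he]; exact Complex.exp_ne_zero _
  have hnorm : ∀ k, ‖toC (e k)‖ = 1 := fun k => by rw [he]; exact Complex.norm_exp_ofReal_mul_I _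
  have hU : ∀ {j k : ℕ} {φ : ℝ}, (φ = (j : ℝ) * τ - k * τ + π ∨ φ = (j : ℝ) * τ - k * τ - π) →
      Complex.exp (φ * Complex.I) * toC (e k) = - toC (e j) := fun {j k φ} hφ => by
    rw [he, he, ← Complex.exp_add]
    rcases hφ with rfl | rfl
    · rw [← Complex.exp_add_pi_mul_I]; congr 1; push_cast; ring
    · rw [← Complex.exp_sub_pi_mul_I]; congr 1; push_cast; ring
  have i12 : π - τ ∈ Ioo (-π) π := ⟨by linarith [pi_pos], by linarith⟩
  have i10 : τ - π ∈ Ioo (-π) π := ⟨by linarith, by linarith [pi_pos]⟩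
  have i30 : 3 * τ - π ∈ Ioo (-π) π := ⟨by linarith, by linarith [pi_pos]⟩
  have u12 := hU (j := 1) (k := 2) (φ := π - τ) (Or.inl (by push_cast; ring))
  have u10 := hU (j := 1) (k := 0) (φ := τ - π) (Or.inr (by push_cast; ring))
  have u32 := hU (j := 3) (k := 2) (φ := τ - π) (Or.inr (by push_cast; ring))
  have u30 := hU (j := 3) (k := 0) (φ := 3 * τ - π) (Or.inr (by push_cast; ring))
  set M : ℝ → ℝ → ℂ := fun φ δ => Complex.log (δ + ε * Complex.exp (φ * Complex.I)) with hM
  set N : ℕ → ℝ → ℂ := fun j δ => Complex.log (1 + toC (p + δ • e 0 - (p + δ • e 2)) /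
    toC (p + ε • e j - (p + δ • e 0))) with hN
  have key : ∀ δ : ℝ, 0 < δ → δ ≤ ε → 3 * δ < ρ →
      M (π - τ) δ - M (τ - π) δ - N 1 δ = M (τ - π) δ - M (3 * τ - π) δ - N 3 δ := by
    intro δ hδ hδε hδρ
    obtain ⟨l2, hl2, hl2e⟩ := hlog _ (h2 δ ⟨hδ, hδε⟩)
    obtain ⟨l0, hl0, hl0e⟩ := hlog _ (h0 δ ⟨hδ, hδε⟩)
    set l : ℝ × ℝ → ℂ := fun z => l2 z - l0 z with hl
    have lc : ContinuousOn l K := hl2.sub hl0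
    have le : ∀ z ∈ K, Complex.exp (l z) * toC (z - (p + δ • e 0)) = toC (z - (p + δ • e 2)) :=
      fun z hz => by
        rw [← hl2e z hz, ← hl0e z hz, ← Complex.exp_add]
        simp [hl]
    have s1 : R 1 ⊆ K := fun z hz => Or.inl (Or.inl hz)
    have s3 : R 3 ⊆ K := fun z hz => Or.inl (Or.inr hz)
    have r1 := log_ratio_ray (slitPlane_exp i12) (slitPlane_exp i10) u12 u10 (hne 0) hδ
      hε.le (lc.mono s1) fun s hs => le _ (s1 ⟨s, hs, rfl⟩)
    have r3 := log_ratio_ray (slitPlane_exp i10) (slitPlane_exp i30) u32 u30 (hne 0) hδ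
      hε.le (lc.mono s3) fun s hs => le _ (s3 ⟨s, hs, rfl⟩)
    have hJK : J ⊆ K := subset_union_right
    have r := log_ratio_path hJc (lc.mono hJK) (fun z hz => le z (hJK hz)) (fun z hz => ?_) hJ1 hJ3
    · simp only [hM, hN]
      linear_combination r - r1 + r3
    · have b1 : ‖toC (p + δ • e 0 - (p + δ • e 2))‖ ≤ 2 * δ := by
        rw [add_sub_add_left_eq_sub, toC_sub, toC_smul, toC_smul, ← mul_sub, norm_mul,
          Complex.norm_real, norm_of_nonneg hδ.le]
        have := norm_sub_le (toC (e 0)) (toC (e 2))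
        rw [hnorm, hnorm] at this
        nlinarith
      have b2 : ρ ≤ ‖toC (z - (p + δ • e 0))‖ + δ := by
        have h5 : toC (z - p) = toC (z - (p + δ • e 0)) + δ * toC (e 0) := by
          rw [← toC_smul, ← toC_add]; congr 1; abel
        have h6 := norm_add_le (toC (z - (p + δ • e 0))) (δ * toC (e 0))
        rw [← h5, norm_mul, hnorm, Complex.norm_real, norm_of_nonneg hδ.le, mul_one] at h6
        exact (hρJ z hz).trans h6
      linarith
  have hMc : ∀ φ ∈ Ioo (-π) π, Tendsto (M φ) (𝓝[>] 0) (𝓝 (M φ 0)) := fun φ hφ => by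
    have : ContinuousAt (M φ) 0 := by
      refine ContinuousAt.clog (by fun_prop) ?_
      exact add_smul_mem_slitPlane (slitPlane_exp hφ) hε.le le_rfl (by linarith)
    exact this.tendsto.mono_left nhdsWithin_le_nhds
  have hNc : ∀ j, Tendsto (N j) (𝓝[>] 0) (𝓝 (N j 0)) := fun j => by
    have : ContinuousAt (N j) 0 := by
      refine ContinuousAt.clog (continuousAt_const.add (ContinuousAt.div ?_ ?_ ?_)) ?_
      · fun_prop
      · fun_prop
      · simp [toC_smul, hne, hε.ne']
      · simp [show toC 0 = 0 from rfl]
    exact this.tendsto.mono_left nhdsWithin_le_nhds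
  have hlim := tendsto_nhds_unique_of_eventuallyEq
    (((hMc _ i12).sub (hMc _ i10)).sub (hNc 1)) (((hMc _ i10).sub (hMc _ i30)).sub (hNc 3)) (by
      filter_upwards [self_mem_nhdsWithin, Ioo_mem_nhdsGT hε,
        Ioo_mem_nhdsGT (show 0 < ρ / 3 by positivity)] with δ a1 a2 a3
      exact key δ a1 a2.2.le (by linarith [a3.2]))
  have hN0 : ∀ j, N j 0 = 0 := fun j => by simp [hN, show toC 0 = 0 from rfl]
  have hMi : ∀ φ ∈ Ioo (-π) π, (M φ 0).im = φ := fun φ hφ => by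
    simp only [hM, Complex.ofReal_zero, zero_add, Complex.log_im]
    rw [Complex.arg_real_mul _ hε, arg_exp hφ]
  have := congrArg Complex.im hlim
  rw [hN0, hN0] at this
  simp only [Complex.sub_im, Complex.zero_im, hMi _ i12, hMi _ i10, hMi _ i30] at this
  linarith [pi_pos]

end Winding

section Linearization

/-- Signed distance to the line through `p` with normal `n`. -/
def lineDist (n p x : ℝ × ℝ) : ℝ := n.1 * (x.1 - p.1) + n.2 * (x.2 - p.2)

/-- The hyperbolic cylinder of mean curvature `H` over the line through `p` with normal `n`. -/
noncomputable def cylinder (H : ℝ) (n p x : ℝ × ℝ) : ℝ :=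
  √(1 / (4 * H ^ 2) + lineDist n p x ^ 2)

variable {Ω : Set (ℝ × ℝ)} {H : ℝ} {u : ℝ × ℝ → ℝ} {n p x v : ℝ × ℝ}

lemma contDiff_lineDist : ContDiff ℝ (⊤ : ℕ∞) (lineDist n p) := by
  unfold lineDist; fun_prop

lemma dd_lineDist : dd v (lineDist n p) x = n.1 * v.1 + n.2 * v.2 := by
  have hl : HasFDerivAt (lineDist n p)
      (n.1 • ContinuousLinearMap.fst ℝ ℝ ℝ + n.2 • ContinuousLinearMap.snd ℝ ℝ ℝ) x :=
    ((hasFDerivAt_fst.sub_const p.1).const_mul n.1).add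
      ((hasFDerivAt_snd.sub_const p.2).const_mul n.2)
  rw [dd, hl.fderiv]
  simp

lemma cylinder_arg_pos (hH : 0 < H) : 0 < 1 / (4 * H ^ 2) + lineDist n p x ^ 2 := by positivity

lemma cylinder_pos (hH : 0 < H) : 0 < cylinder H n p x := sqrt_pos.2 (cylinder_arg_pos hH)

lemma cylinder_sq (hH : 0 < H) : cylinder H n p x ^ 2 = 1 / (4 * H ^ 2) + lineDist n p x ^ 2 :=
  sq_sqrt (cylinder_arg_pos hH).le

lemma contDiff_cylinder (hH : 0 < H) : ContDiff ℝ (⊤ : ℕ∞) (cylinder H n p) :=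
  (contDiff_const.add (contDiff_lineDist.pow 2)).sqrt fun _ => (cylinder_arg_pos hH).ne'

lemma dd_cylinder (hH : 0 < H) : dd v (cylinder H n p) x =
    lineDist n p x * (n.1 * v.1 + n.2 * v.2) / cylinder H n p x := by
  have hd : DifferentiableAt ℝ (lineDist n p) x := contDiff_lineDist.differentiable (by simp) x
  have h1 : HasDerivAt (fun s => √(1 / (4 * H ^ 2) + s ^ 2))
      (2 * lineDist n p x / (2 * cylinder H n p x)) (lineDist n p x) := by
    have h2 : HasDerivAt (fun s : ℝ => 1 / (4 * H ^ 2) + s ^ 2) (2 * lineDist n p x)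
        (lineDist n p x) := by
      simpa using (hasDerivAt_pow 2 (lineDist n p x)).const_add (1 / (4 * H ^ 2))
    exact h2.sqrt (cylinder_arg_pos hH).ne'
  have := dd_comp (v := v) h1 hd
  change dd v (cylinder H n p) x = _ at this
  rw [this, dd_lineDist]
  have := (cylinder_pos (n := n) (p := p) (x := x) hH).ne'
  field_simp

lemma cylinder_of_lineDist_eq_zero (hH : 0 < H) (h : lineDist n p x = 0) :
    cylinder H n p x = 1 / (2 * H) := by
  rw [cylinder, h, show 1 / (4 * H ^ 2) + (0 : ℝ) ^ 2 = (1 / (2 * H)) ^ 2 by field_simp; ring]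
  exact sqrt_sq (by positivity)

/-- The flux difference of `r a` and `s b` as a positive definite linear map of `a - b`. -/
lemma flux_difference_algebra {r s a1 a2 b1 b2 : ℝ} (hr : 0 < r) (hs : 0 < s)
    (ha : r ^ 2 * (1 - (a1 ^ 2 + a2 ^ 2)) = 1) (hb : s ^ 2 * (1 - (b1 ^ 2 + b2 ^ 2)) = 1) :
    r * a1 - s * b1 = ((r + s) / 2 + r ^ 2 * s ^ 2 / (2 * (r + s)) * (a1 + b1) ^ 2) * (a1 - b1) +
      (r ^ 2 * s ^ 2 / (2 * (r + s)) * ((a1 + b1) * (a2 + b2))) * (a2 - b2) ∧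
    r * a2 - s * b2 = (r ^ 2 * s ^ 2 / (2 * (r + s)) * ((a1 + b1) * (a2 + b2))) * (a1 - b1) +
      ((r + s) / 2 + r ^ 2 * s ^ 2 / (2 * (r + s)) * (a2 + b2) ^ 2) * (a2 - b2) := by
  have h0 : r + s ≠ 0 := by positivity
  constructor <;> field_simp
  · linear_combination (a1 + b1) * s ^ 2 * ha - (a1 + b1) * r ^ 2 * hb
  · linear_combination (a2 + b2) * s ^ 2 * ha - (a2 + b2) * r ^ 2 * hb

theorem exists_linearization (hΩ : IsOpen Ω) (hH : 0 < H) (hn : n.1 ^ 2 + n.2 ^ 2 = 1)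
    (hu : ContDiffOn ℝ (⊤ : ℕ∞) u Ω) (hs : ∀ x ∈ Ω, gradSq u x < 1)
    (hc : ∀ x ∈ Ω, cmcDiv u x = 2 * H) {w : ℝ × ℝ → ℝ}
    (hw : w = fun x => u x - cylinder H n p x) :
    ∃ A11 A12 A22 B1 B2 : ℝ × ℝ → ℝ, (ContDiffOn ℝ (⊤ : ℕ∞) A11 Ω ∧
      ContDiffOn ℝ (⊤ : ℕ∞) A12 Ω ∧ ContDiffOn ℝ (⊤ : ℕ∞) A22 Ω ∧
      ContDiffOn ℝ (⊤ : ℕ∞) B1 Ω ∧ ContDiffOn ℝ (⊤ : ℕ∞) B2 Ω) ∧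
      (∀ x ∈ Ω, B1 x = A11 x * dd (1, 0) w x + A12 x * dd (0, 1) w x) ∧
      (∀ x ∈ Ω, B2 x = A12 x * dd (1, 0) w x + A22 x * dd (0, 1) w x) ∧
      (∀ x ∈ Ω, dd (1, 0) B1 x + dd (0, 1) B2 x = 0) ∧
      (∀ x ∈ Ω, 0 ≤ B1 x * dd (1, 0) w x + B2 x * dd (0, 1) w x) ∧
      (∀ x ∈ Ω, B1 x * dd (1, 0) w x + B2 x * dd (0, 1) w x = 0 →
        dd (1, 0) w x = 0 ∧ dd (0, 1) w x = 0) ∧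
      (∀ x ∈ Ω, dd (1, 0) u x = 0 → dd (0, 1) u x = 0 → lineDist n p x = 0 →
        A11 x = 1 ∧ A12 x = 0 ∧ A22 x = 1) := by
  set a1 : ℝ × ℝ → ℝ := dd (1, 0) u with ha1
  set a2 : ℝ × ℝ → ℝ := dd (0, 1) u with ha2
  set b1 : ℝ × ℝ → ℝ := dd (1, 0) (cylinder H n p) with hb1
  set b2 : ℝ × ℝ → ℝ := dd (0, 1) (cylinder H n p) with hb2
  set r : ℝ × ℝ → ℝ := fun x => (√(1 - gradSq u x))⁻¹ with hr
  set s : ℝ × ℝ → ℝ := fun x => 2 * H * cylinder H n p x with hs'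
  have sφ : ContDiffOn ℝ (⊤ : ℕ∞) (cylinder H n p) Ω := (contDiff_cylinder hH).contDiffOn
  have sa1 := smooth_dd hΩ hu (1, 0)
  have sa2 := smooth_dd hΩ hu (0, 1)
  have sb1 := smooth_dd hΩ sφ (1, 0)
  have sb2 := smooth_dd hΩ sφ (0, 1)
  have hpos : ∀ x ∈ Ω, 0 < 1 - gradSq u x := fun x hx => by linarith [hs x hx]
  have sr : ContDiffOn ℝ (⊤ : ℕ∞) r Ω :=
    ((contDiffOn_const.sub ((sa1.pow 2).add (sa2.pow 2))).sqrt fun x hx => (hpos x hx).ne').inv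
      fun x hx => (sqrt_pos.2 (hpos x hx)).ne'
  have ss : ContDiffOn ℝ (⊤ : ℕ∞) s Ω := contDiffOn_const.mul sφ
  have rpos : ∀ x ∈ Ω, 0 < r x := fun x hx => inv_pos.2 (sqrt_pos.2 (hpos x hx))
  have spos : ∀ x, 0 < s x := fun x => mul_pos (by positivity) (cylinder_pos hH)
  have ra : ∀ x ∈ Ω, r x ^ 2 * (1 - (a1 x ^ 2 + a2 x ^ 2)) = 1 := fun x hx => by
    simp only [hr, inv_pow, sq_sqrt (hpos x hx).le]
    exact inv_mul_cancel₀ (hpos x hx).ne'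
  have eb1 : ∀ x, b1 x = lineDist n p x * n.1 / cylinder H n p x := fun x => by
    simp only [hb1, dd_cylinder hH]; simp
  have eb2 : ∀ x, b2 x = lineDist n p x * n.2 / cylinder H n p x := fun x => by
    simp only [hb2, dd_cylinder hH]; simp
  have sb : ∀ x, s x ^ 2 * (1 - (b1 x ^ 2 + b2 x ^ 2)) = 1 := fun x => by
    have h1 := cylinder_pos (n := n) (p := p) (x := x) hH
    have h2 := cylinder_sq (n := n) (p := p) (x := x) hH
    have h3 : 4 * H ^ 2 * cylinder H n p x ^ 2 = 1 + 4 * H ^ 2 * lineDist n p x ^ 2 := by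
      rw [h2]; field_simp
    rw [eb1, eb2, div_pow, div_pow, ← add_div]
    simp only [hs']
    field_simp
    linear_combination h3 - 4 * H ^ 2 * lineDist n p x ^ 2 * hn
  have dw1 : ∀ x ∈ Ω, dd (1, 0) w x = a1 x - b1 x := fun x hx => by
    rw [hw, dd_sub (diffAt_of_smooth hΩ hu hx) (diffAt_of_smooth hΩ sφ hx)]
  have dw2 : ∀ x ∈ Ω, dd (0, 1) w x = a2 x - b2 x := fun x hx => by
    rw [hw, dd_sub (diffAt_of_smooth hΩ hu hx) (diffAt_of_smooth hΩ sφ hx)]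
  set m : ℝ × ℝ → ℝ := fun x => r x ^ 2 * s x ^ 2 / (2 * (r x + s x)) with hm
  have mpos : ∀ x ∈ Ω, 0 < m x := fun x hx => by
    have := rpos x hx
    have := spos x
    positivity
  have sm : ContDiffOn ℝ (⊤ : ℕ∞) m Ω := ((sr.pow 2).mul (ss.pow 2)).div
    (contDiffOn_const.mul (sr.add ss)) fun x hx => by
      have := rpos x hx
      have := spos x
      positivity
  set B1 : ℝ × ℝ → ℝ := fun x => a1 x / √(1 - gradSq u x) - 2 * H * n.1 * lineDist n p x with hB1
  set B2 : ℝ × ℝ → ℝ := fun x => a2 x / √(1 - gradSq u x) - 2 * H * n.2 * lineDist n p x with hB2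
  have eB1 : ∀ x, B1 x = r x * a1 x - s x * b1 x := fun x => by
    have := (cylinder_pos (n := n) (p := p) (x := x) hH).ne'
    simp only [hB1, eb1, hr, hs']
    field_simp
  have eB2 : ∀ x, B2 x = r x * a2 x - s x * b2 x := fun x => by
    have := (cylinder_pos (n := n) (p := p) (x := x) hH).ne'
    simp only [hB2, eb2, hr, hs']
    field_simp
  have sl : ContDiffOn ℝ (⊤ : ℕ∞) (lineDist n p) Ω := contDiff_lineDist.contDiffOn
  have sg1 : ContDiffOn ℝ (⊤ : ℕ∞) (fun x => a1 x / √(1 - gradSq u x)) Ω := sa1.mul sr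
  have sg2 : ContDiffOn ℝ (⊤ : ℕ∞) (fun x => a2 x / √(1 - gradSq u x)) Ω := sa2.mul sr
  have key := fun x (hx : x ∈ Ω) => flux_difference_algebra (rpos x hx) (spos x) (ra x hx) (sb x)
  have quad : ∀ x ∈ Ω, B1 x * dd (1, 0) w x + B2 x * dd (0, 1) w x =
      (r x + s x) / 2 * (dd (1, 0) w x ^ 2 + dd (0, 1) w x ^ 2) +
        m x * ((a1 x + b1 x) * dd (1, 0) w x + (a2 x + b2 x) * dd (0, 1) w x) ^ 2 := fun x hx => by
    rw [eB1, eB2, (key x hx).1, (key x hx).2, dw1 x hx, dw2 x hx]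
    simp only [hm]
    ring
  refine ⟨fun x => (r x + s x) / 2 + m x * (a1 x + b1 x) ^ 2,
    fun x => m x * ((a1 x + b1 x) * (a2 x + b2 x)),
    fun x => (r x + s x) / 2 + m x * (a2 x + b2 x) ^ 2, B1, B2,
    ⟨((sr.add ss).div_const 2).add (sm.mul ((sa1.add sb1).pow 2)),
      sm.mul ((sa1.add sb1).mul (sa2.add sb2)),
      ((sr.add ss).div_const 2).add (sm.mul ((sa2.add sb2).pow 2)),
      sg1.sub (contDiffOn_const.mul sl), sg2.sub (contDiffOn_const.mul sl)⟩,
    fun x hx => ?_, fun x hx => ?_, fun x hx => ?_, fun x hx => ?_, fun x hx h => ?_,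
    fun x hx h1 h2 h0 => ?_⟩
  · rw [eB1, dw1 x hx, dw2 x hx]; exact (key x hx).1
  · rw [eB2, dw1 x hx, dw2 x hx]; exact (key x hx).2
  · have hd := diffAt_of_smooth hΩ sl hx
    rw [hB1, hB2, dd_sub (diffAt_of_smooth hΩ sg1 hx) (hd.const_mul _),
      dd_sub (diffAt_of_smooth hΩ sg2 hx) (hd.const_mul _), dd_mul (differentiableAt_const _) hd,
      dd_mul (differentiableAt_const _) hd, dd_const, dd_const, dd_lineDist, dd_lineDist]
    have := hc x hx
    rw [cmcDiv] at this
    change dd (1, 0) (fun x => a1 x / √(1 - gradSq u x)) x +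
      dd (0, 1) (fun x => a2 x / √(1 - gradSq u x)) x = _ at this
    linear_combination this - 2 * H * hn
  · rw [quad x hx]
    have := rpos x hx
    have := spos x
    have := mpos x hx
    positivity
  · rw [quad x hx] at h
    have h1 := rpos x hx
    have h2 := spos x
    have h3 : 0 ≤ m x * ((a1 x + b1 x) * dd (1, 0) w x + (a2 x + b2 x) * dd (0, 1) w x) ^ 2 :=
      mul_nonneg (mpos x hx).le (sq_nonneg _)
    have h4 : dd (1, 0) w x ^ 2 + dd (0, 1) w x ^ 2 ≤ 0 := by
      by_contra! hcon
      have : 0 < (r x + s x) / 2 * (dd (1, 0) w x ^ 2 + dd (0, 1) w x ^ 2) := by positivity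
      linarith
    constructor <;> nlinarith [sq_nonneg (dd (1, 0) w x), sq_nonneg (dd (0, 1) w x)]
  · have e1 : b1 x = 0 := by rw [eb1, h0]; simp
    have e2 : b2 x = 0 := by rw [eb2, h0]; simp
    have e3 : s x = 1 := by
      simp only [hs', cylinder_of_lineDist_eq_zero hH h0]; field_simp
    have e4 : r x = 1 := by
      have : gradSq u x = 0 := by
        change a1 x ^ 2 + a2 x ^ 2 = 0
        rw [h1, h2]; simp
      simp [hr, this]
    simp [h1, h2, e1, e2, e3, e4]

end Linearization

section EllipticEq

/-- `w` solves `div (A ∇w) = 0` on `Ω` with smooth elliptic flux `B = A ∇w`. -/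
structure EllipticEq (Ω : Set (ℝ × ℝ)) (w A11 A12 A22 B1 B2 : ℝ × ℝ → ℝ) : Prop where
  smooth : ContDiffOn ℝ (⊤ : ℕ∞) w Ω
  s11 : ContDiffOn ℝ (⊤ : ℕ∞) A11 Ω
  s12 : ContDiffOn ℝ (⊤ : ℕ∞) A12 Ω
  s22 : ContDiffOn ℝ (⊤ : ℕ∞) A22 Ω
  sB1 : ContDiffOn ℝ (⊤ : ℕ∞) B1 Ω
  sB2 : ContDiffOn ℝ (⊤ : ℕ∞) B2 Ω
  flux1 : ∀ x ∈ Ω, B1 x = A11 x * dd (1, 0) w x + A12 x * dd (0, 1) w x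
  flux2 : ∀ x ∈ Ω, B2 x = A12 x * dd (1, 0) w x + A22 x * dd (0, 1) w x
  div_eq : ∀ x ∈ Ω, dd (1, 0) B1 x + dd (0, 1) B2 x = 0
  nonneg : ∀ x ∈ Ω, 0 ≤ B1 x * dd (1, 0) w x + B2 x * dd (0, 1) w x
  definite : ∀ x ∈ Ω, B1 x * dd (1, 0) w x + B2 x * dd (0, 1) w x = 0 →
    dd (1, 0) w x = 0 ∧ dd (0, 1) w x = 0

variable {Ω U : Set (ℝ × ℝ)} {w A11 A12 A22 B1 B2 : ℝ × ℝ → ℝ} {p : ℝ × ℝ} {c : ℝ}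

lemma EllipticEq.neg (h : EllipticEq Ω w A11 A12 A22 B1 B2) :
    EllipticEq Ω (fun x => - w x) A11 A12 A22 (fun x => - B1 x) (fun x => - B2 x) where
  smooth := h.smooth.neg
  s11 := h.s11
  s12 := h.s12
  s22 := h.s22
  sB1 := h.sB1.neg
  sB2 := h.sB2.neg
  flux1 x hx := by rw [h.flux1 x hx, dd_neg, dd_neg]; ring
  flux2 x hx := by rw [h.flux2 x hx, dd_neg, dd_neg]; ring
  div_eq x hx := by rw [dd_neg, dd_neg]; linarith [h.div_eq x hx]
  nonneg x hx := by rw [dd_neg, dd_neg]; linarith [h.nonneg x hx]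
  definite x hx h0 := by
    rw [dd_neg, dd_neg] at h0 ⊢
    have := h.definite x hx (by linarith)
    exact ⟨by rw [this.1, neg_zero], by rw [this.2, neg_zero]⟩

lemma EllipticEq.sub_const (hΩ : IsOpen Ω) (h : EllipticEq Ω w A11 A12 A22 B1 B2) (c : ℝ) :
    EllipticEq Ω (fun x => w x - c) A11 A12 A22 B1 B2 := by
  have e : ∀ v, ∀ x ∈ Ω, dd v (fun x => w x - c) x = dd v w x := fun v x hx => by
    rw [dd_sub (diffAt_of_smooth hΩ h.smooth hx) (differentiableAt_const _), dd_const, sub_zero]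
  exact
    { smooth := h.smooth.sub contDiffOn_const
      s11 := h.s11
      s12 := h.s12
      s22 := h.s22
      sB1 := h.sB1
      sB2 := h.sB2
      flux1 := fun x hx => by rw [e _ x hx, e _ x hx, h.flux1 x hx]
      flux2 := fun x hx => by rw [e _ x hx, e _ x hx, h.flux2 x hx]
      div_eq := h.div_eq
      nonneg := fun x hx => by rw [e _ x hx, e _ x hx]; exact h.nonneg x hx
      definite := fun x hx => by rw [e _ x hx, e _ x hx]; exact h.definite x hx }

/-- Weak maximum principle. -/
lemma EllipticEq.le_of_frontier (h : EllipticEq Ω w A11 A12 A22 B1 B2)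
    (hb : Bornology.IsBounded Ω) (hw : ContinuousOn w (closure Ω)) (hU : IsOpen U) (hUΩ : U ⊆ Ω)
    (hfr : ∀ x ∈ frontier U, w x ≤ c) : ∀ x ∈ U, w x ≤ c :=
  (energy_principle hU (hb.subset hUΩ) (h.smooth.mono hUΩ) (h.sB1.mono hUΩ) (h.sB2.mono hUΩ)
    (hw.mono (closure_mono hUΩ)) hfr (fun x hx => h.nonneg x (hUΩ hx))
    (fun x hx => (h.div_eq x (hUΩ hx)).ge)).2 fun x hx => h.definite x (hUΩ hx)

/-- Every component of a superlevel set reaches the boundary of the domain. -/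
lemma EllipticEq.exists_frontier_of_lt (hΩ : IsOpen Ω) (h : EllipticEq Ω w A11 A12 A22 B1 B2)
    (hb : Bornology.IsBounded Ω) (hw : ContinuousOn w (closure Ω)) {a : ℝ × ℝ} (ha : a ∈ Ω)
    (hca : c < w a) :
    ∃ b ∈ frontier Ω, c < w b ∧ b ∈ closure (pathComponentIn {x ∈ Ω | c < w x} a) := by
  set S := {x ∈ Ω | c < w x} with hS
  have hSo : IsOpen S := by
    have := (hw.mono subset_closure).isOpen_inter_preimage hΩ (isOpen_Ioi (a := c))
    exact this
  have haS : a ∈ S := ⟨ha, hca⟩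
  set U := pathComponentIn S a with hUdef
  have hUo : IsOpen U := hSo.pathComponentIn a
  have hUS : U ⊆ S := pathComponentIn_subset
  have haU : a ∈ U := mem_pathComponentIn_self haS
  have hUΩ : U ⊆ Ω := fun x hx => (hUS hx).1
  obtain ⟨b, hbU, hbc⟩ : ∃ b ∈ frontier U, c < w b := by
    by_contra! hcon
    exact absurd (h.le_of_frontier hb hw hUo hUΩ hcon a haU) (not_le.2 hca)
  have hbcl : b ∈ closure U := frontier_subset_closure hbU
  refine ⟨b, ?_, hbc, hbcl⟩
  rw [hΩ.frontier_eq]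
  refine ⟨closure_mono hUΩ hbcl, fun hbΩ => ?_⟩
  have hbS : b ∈ S := ⟨hbΩ, hbc⟩
  have hVo : IsOpen (pathComponentIn S b) := hSo.pathComponentIn b
  obtain ⟨z, hz, hzU⟩ := mem_closure_iff.1 hbcl _ hVo (mem_pathComponentIn_self hbS)
  have hbU' : b ∈ U := JoinedIn.trans hzU (JoinedIn.symm hz)
  rw [hUo.frontier_eq] at hbU
  exact hbU.2 hbU'

lemma dd_iterate_neg (v : ℝ × ℝ) (m : ℕ) (f : ℝ × ℝ → ℝ) (x : ℝ × ℝ) :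
    (dd v)^[m] (fun y => - f y) x = - (dd v)^[m] f x := by
  induction m generalizing f with
  | zero => rfl
  | succ m ih =>
    rw [Function.iterate_succ_apply, Function.iterate_succ_apply, ← ih,
      show dd v (fun y => - f y) = fun y => - dd v f y from funext fun y => dd_neg]

/-- A solution at an isotropic critical point that is not infinitely flat has at least four
alternating sectors. -/
lemma EllipticEq.exists_sectors (hΩ : IsOpen Ω) (h : EllipticEq Ω w A11 A12 A22 B1 B2)
    (hp : p ∈ Ω) (h11 : A11 p = 1) (h12 : A12 p = 0) (h22 : A22 p = 1) (h0 : w p = 0)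
    (hd1 : dd (1, 0) w p = 0) (hd2 : dd (0, 1) w p = 0) (hv : ¬ ∀ m, Van p m w) :
    ∃ (e : ℕ → ℝ × ℝ) (τ θ ε : ℝ), 0 < τ ∧ τ ≤ π / 2 ∧ 0 < ε ∧
      (∀ k, toC (e k) = Complex.exp ((θ + k * τ : ℝ) * Complex.I)) ∧
      ∀ s ∈ Ioc 0 ε, (p + s • e 0 ∈ Ω ∧ 0 < w (p + s • e 0)) ∧
        (p + s • e 1 ∈ Ω ∧ w (p + s • e 1) < 0) ∧
        (p + s • e 2 ∈ Ω ∧ 0 < w (p + s • e 2)) ∧ (p + s • e 3 ∈ Ω ∧ w (p + s • e 3) < 0) := by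
  classical
  have hv2 : Van p 2 w := ⟨h0, fun v => ⟨dd_eq_zero_of hd1 hd2, fun _ => trivial⟩⟩
  push Not at hv
  set m := Nat.find hv with hm
  have hmv : ¬ Van p m w := Nat.find_spec hv
  have hmin : ∀ k < m, Van p k w := fun k hk => not_not.1 (Nat.find_min hv hk)
  have hm3 : 3 ≤ m := by
    by_contra! hlt
    exact hmv (hv2.mono_le (by omega))
  obtain ⟨j, hj⟩ : ∃ j, m = j + 2 := ⟨m - 2, by omega⟩
  have hj1 : 1 ≤ j := by omega
  have hvN : Van p (j + 1) w := hmin _ (by omega)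
  have smd : ∀ v, ContDiffOn ℝ (⊤ : ℕ∞) (dd v w) Ω := smooth_dd hΩ h.smooth
  have hA : ∀ {a b : ℝ × ℝ → ℝ} {v v' : ℝ × ℝ}, ContDiffOn ℝ (⊤ : ℕ∞) a Ω →
      ContDiffOn ℝ (⊤ : ℕ∞) b Ω → a p = 0 → b p = 0 →
      ContDiffOn ℝ (⊤ : ℕ∞) (fun x => a x * dd v w x + b x * dd v' w x) Ω ∧
      Van p (1 + j) (fun x => a x * dd v w x + b x * dd v' w x) := by
    intro a b v v' sa sb ha hb
    refine ⟨(sa.mul (smd v)).add (sb.mul (smd v')), Van.add hΩ hp (sa.mul (smd v))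
      (sb.mul (smd v')) ?_ ?_⟩
    · exact Van.mul hΩ hp sa (smd v) ⟨ha, fun _ => trivial⟩ (hvN.2 v)
    · exact Van.mul hΩ hp sb (smd v') ⟨hb, fun _ => trivial⟩ (hvN.2 v')
  obtain ⟨sg1, vg1⟩ := hA (v := (1, 0)) (v' := (0, 1)) (h.s11.sub (contDiffOn_const (c := 1)))
    h.s12 (sub_eq_zero.2 h11) h12
  obtain ⟨sg2, vg2⟩ := hA (v := (1, 0)) (v' := (0, 1)) h.s12
    (h.s22.sub (contDiffOn_const (c := 1))) h12 (sub_eq_zero.2 h22)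
  set g1 : ℝ × ℝ → ℝ := fun x => (A11 x - 1) * dd (1, 0) w x + A12 x * dd (0, 1) w x with hg1
  set g2 : ℝ × ℝ → ℝ := fun x => A12 x * dd (1, 0) w x + (A22 x - 1) * dd (0, 1) w x with hg2
  rw [add_comm] at vg1 vg2
  have hl : Van p j fun x => dd (1, 0) (dd (1, 0) w) x + dd (0, 1) (dd (0, 1) w) x := by
    have s1 := smooth_dd hΩ sg1 (1, 0)
    have s2 := smooth_dd hΩ sg2 (0, 1)
    refine ((Van.add hΩ hp s1 s2 (vg1.2 (1, 0)) (vg2.2 (0, 1))).const_mul hΩ hp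
      (s1.add s2) (-1)).congr hΩ hp fun x hx => ?_
    have e1 : dd (1, 0) g1 x = dd (1, 0) B1 x - dd (1, 0) (dd (1, 0) w) x := by
      rw [← dd_sub (diffAt_of_smooth hΩ h.sB1 hx) (diffAt_of_smooth hΩ (smd _) hx)]
      exact dd_congr hΩ (fun y hy => by rw [h.flux1 y hy]; simp only [hg1]; ring) hx
    have e2 : dd (0, 1) g2 x = dd (0, 1) B2 x - dd (0, 1) (dd (0, 1) w) x := by
      rw [← dd_sub (diffAt_of_smooth hΩ h.sB2 hx) (diffAt_of_smooth hΩ (smd _) hx)]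
      exact dd_congr hΩ (fun y hy => by rw [h.flux2 y hy]; simp only [hg2]; ring) hx
    change -1 * (dd (1, 0) g1 x + dd (0, 1) g2 x) = _
    rw [e1, e2]
    linear_combination -h.div_eq x hx
  obtain ⟨Z, hZ⟩ := exists_lead hΩ hp h.smooth hvN hl
  have hZ0 : Z ≠ 0 := by
    rintro rfl
    exact hmv (by rw [hj]; exact hZ.van hvN)
  set N : ℝ := ((j + 1 : ℕ) : ℝ) with hN
  have hN2 : 2 ≤ N := by rw [hN]; exact_mod_cast (by omega : 2 ≤ j + 1)
  have hNpos : 0 < N := by linarith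
  set τ := π / N with hτ
  set θ := - Z.arg / N with hθ
  set e : ℕ → ℝ × ℝ := fun k => (cos (θ + k * τ), sin (θ + k * τ)) with he
  have heC : ∀ k, toC (e k) = Complex.exp ((θ + k * τ : ℝ) * Complex.I) := fun k => by
    rw [Complex.exp_mul_I]
    apply Complex.ext <;> simp [toC, he, ← Complex.ofReal_cos, ← Complex.ofReal_sin,
      -Complex.ofReal_add, -Complex.ofReal_mul]
  have hder : ∀ k, (dd (e k))^[j + 1] w p = ‖Z‖ * cos (k * π) := fun k => by
    rw [hZ.iterate, heC, ← Complex.exp_nat_mul]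
    conv_lhs => rw [← Complex.norm_mul_exp_arg_mul_I Z]
    rw [mul_assoc, ← Complex.exp_add,
      show (Z.arg : ℂ) * Complex.I + ((j + 1 : ℕ) : ℂ) * (((θ + k * τ : ℝ) : ℂ) * Complex.I) =
        ((k * π : ℝ) : ℂ) * Complex.I by
          have : Z.arg + N * (θ + k * τ) = k * π := by
            rw [hθ, hτ]; field_simp; ring
          rw [← this, hN]; push_cast; ring]
    rw [Complex.re_ofReal_mul, Complex.exp_ofReal_mul_I_re]
  have hZn : 0 < ‖Z‖ := norm_pos_iff.2 hZ0
  have hpos : ∀ k : ℕ, Even k → ∃ ε > 0, ∀ s ∈ Ioc (0 : ℝ) ε,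
      p + s • e k ∈ Ω ∧ 0 < w (p + s • e k) := fun k hk =>
    hvN.pos_on_ray hΩ hp h.smooth (by rw [hder, cos_nat_mul_pi, hk.neg_one_pow]; simpa using hZn)
  have hneg : ∀ k : ℕ, Odd k → ∃ ε > 0, ∀ s ∈ Ioc (0 : ℝ) ε,
      p + s • e k ∈ Ω ∧ w (p + s • e k) < 0 := fun k hk => by
    have hvn : Van p (j + 1) fun x => - w x :=
      (hvN.const_mul hΩ hp h.smooth (-1)).congr hΩ hp fun x _ => by ring
    obtain ⟨ε, hε, H⟩ := hvn.pos_on_ray hΩ hp h.smooth.neg (e := e k) (by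
      rw [dd_iterate_neg, hder, cos_nat_mul_pi, hk.neg_one_pow]; simpa using hZn)
    exact ⟨ε, hε, fun s hs => ⟨(H s hs).1, neg_pos.1 (H s hs).2⟩⟩
  obtain ⟨ε0, hε0, H0⟩ := hpos 0 (by decide)
  obtain ⟨ε1, hε1, H1⟩ := hneg 1 (by decide)
  obtain ⟨ε2, hε2, H2⟩ := hpos 2 (by decide)
  obtain ⟨ε3, hε3, H3⟩ := hneg 3 (by decide)
  refine ⟨e, τ, θ, min (min ε0 ε1) (min ε2 ε3), by positivity,
    div_le_div_of_nonneg_left pi_pos.le two_pos hN2, by positivity, heC, fun s hs => ?_⟩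
  simp only [mem_Ioc, le_min_iff] at hs
  exact ⟨H0 s ⟨hs.1, hs.2.1.1⟩, H1 s ⟨hs.1, hs.2.1.2⟩, H2 s ⟨hs.1, hs.2.2.1⟩,
    H3 s ⟨hs.1, hs.2.2.2⟩⟩

end EllipticEq

section Comparison

variable {Ω : Set (ℝ × ℝ)} {H c : ℝ} {u w A11 A12 A22 B1 B2 : ℝ × ℝ → ℝ} {n p x : ℝ × ℝ}

lemma IsCMCSol.smooth (h : IsCMCSol Ω H u) : ContDiffOn ℝ (⊤ : ℕ∞) u Ω := h.1.mono subset_closure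

/-- Solutions with positive mean curvature are nonpositive. -/
lemma IsCMCSol.nonpos (h : IsCMCSol Ω H u) (hΩ : IsOpen Ω) (hb : Bornology.IsBounded Ω)
    (hH : 0 < H) (hx : x ∈ Ω) : u x ≤ 0 := by
  have hpos : ∀ x ∈ Ω, 0 < 1 - gradSq u x := fun x hx => by linarith [h.2.1 x hx]
  have s1 := smooth_dd hΩ h.smooth (1, 0)
  have s2 := smooth_dd hΩ h.smooth (0, 1)
  have sr : ContDiffOn ℝ (⊤ : ℕ∞) (fun x => √(1 - gradSq u x)) Ω :=
    (contDiffOn_const.sub ((s1.pow 2).add (s2.pow 2))).sqrt fun x hx => (hpos x hx).ne'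
  have sr0 : ∀ x ∈ Ω, √(1 - gradSq u x) ≠ 0 := fun x hx => (sqrt_pos.2 (hpos x hx)).ne'
  have key := (energy_principle (c := 0) hΩ hb h.smooth (s1.div sr sr0) (s2.div sr sr0)
    h.1.continuousOn (fun x hx => (h.2.2.2 x hx).le) (fun x hx => ?_) fun x hx => ?_).1 x hx
  · by_contra! hlt
    have h1 := key hlt
    have h2 : cmcDiv u x = 2 * H := h.2.2.1 x hx
    exact absurd (h2.symm.trans h1) (by positivity)
  · have := sqrt_pos.2 (hpos x hx)
    simp only [Pi.div_apply]
    rw [div_mul_eq_mul_div, div_mul_eq_mul_div, ← add_div]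
    exact div_nonneg (add_nonneg (mul_self_nonneg _) (mul_self_nonneg _)) this.le
  · have h2 : cmcDiv u x = 2 * H := h.2.2.1 x hx
    change 0 ≤ cmcDiv u x
    rw [h2]; positivity

lemma convex_lineDist (a : ℝ) : Convex ℝ {x | a < lineDist n p x} := by
  intro x hx y hy s t hs ht hst
  simp only [mem_ofPred_eq, lineDist, Prod.fst_add, Prod.snd_add, Prod.smul_fst, Prod.smul_snd,
    smul_eq_mul] at *
  rcases hs.eq_or_lt with rfl | hs
  · obtain rfl : t = 1 := by linarith
    linarith
  · have h1 := mul_lt_mul_of_pos_left hx hs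
    have h2 := mul_le_mul_of_nonneg_left hy.le ht
    obtain rfl : t = 1 - s := by linarith
    linarith

lemma convex_lineDist_eq_zero : Convex ℝ {x | lineDist n p x = 0} := by
  intro x hx y hy s t hs ht hst
  simp only [mem_ofPred_eq, lineDist, Prod.fst_add, Prod.snd_add, Prod.smul_fst, Prod.smul_snd,
    smul_eq_mul] at *
  obtain rfl : t = 1 - s := by linarith
  linear_combination s * hx + (1 - s) * hy

lemma lineDist_self : lineDist n p p = 0 := by simp [lineDist]

lemma dd_cylinder_eq_zero (hH : 0 < H) (h : lineDist n p x = 0) (v : ℝ × ℝ) :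
    dd v (cylinder H n p) x = 0 := by
  rw [dd_cylinder hH, h]; simp

lemma dd_sub_cylinder (hΩ : IsOpen Ω) (hu : ContDiffOn ℝ (⊤ : ℕ∞) u Ω) (hH : 0 < H) (hx : x ∈ Ω)
    (h : lineDist n p x = 0) (v : ℝ × ℝ) :
    dd v (fun x => u x - cylinder H n p x) x = dd v u x := by
  rw [dd_sub (diffAt_of_smooth hΩ hu hx)
    (diffAt_of_smooth hΩ (contDiff_cylinder hH).contDiffOn hx), dd_cylinder_eq_zero hH h, sub_zero]

/-- The difference with the osculating cylinder is not infinitely flat. -/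
lemma IsCMCSol.not_flat (h : IsCMCSol Ω H u) (hΩ : IsOpen Ω) (hc : Convex ℝ Ω)
    (hb : Bornology.IsBounded Ω) (hH : 0 < H) (hn : n.1 ^ 2 + n.2 ^ 2 = 1)
    (hw : w = fun x => u x - cylinder H n p x)
    (E : EllipticEq Ω w A11 A12 A22 B1 B2)
    (iso : ∀ x ∈ Ω, dd (1, 0) u x = 0 → dd (0, 1) u x = 0 → lineDist n p x = 0 →
      A11 x = 1 ∧ A12 x = 0 ∧ A22 x = 1)
    (hp : p ∈ Ω) : ¬ ∀ m, Van p m fun x => w x - c := by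
  intro hv
  set W := {x | ∀ᶠ z in nhds x, w z - c = 0} with hW
  have Ec := E.sub_const hΩ c
  have step : ∀ x ∈ Ω, lineDist n p x = 0 → (∀ m, Van x m fun x => w x - c) → x ∈ W := by
    intro x hx hl hvx
    have hgrad : ∀ v, dd v u x = 0 := fun v => by
      rw [← dd_sub_cylinder hΩ h.smooth hH hx hl v, ← hw, ← ((hvx 2).2 v).1,
        dd_sub (diffAt_of_smooth hΩ E.smooth hx) (differentiableAt_const _), dd_const, sub_zero]
    obtain ⟨h11, h12, h22⟩ := iso x hx (hgrad _) (hgrad _) hl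
    exact strong_unique_continuation hΩ hx Ec.smooth Ec.s11 Ec.s12 Ec.s22 Ec.sB1 Ec.sB2 h11 h12 h22
      Ec.flux1 Ec.flux2 Ec.div_eq hvx
  have hpW : p ∈ W := step p hp lineDist_self hv
  set ℓ := {x | lineDist n p x = 0} with hℓ
  have hL : Ω ∩ ℓ ⊆ W := by
    refine (hc.inter convex_lineDist_eq_zero).isPreconnected.subset_of_closure_inter_subset
      isOpen_setOfPred_eventually_nhds ⟨p, ⟨hp, lineDist_self⟩, hpW⟩ ?_
    rintro x ⟨hxW, hx, hl⟩
    exact step x hx hl fun m => van_of_eventually_const_closure hΩ hx Ec.smooth hxW m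
  have huL : ∀ x ∈ Ω ∩ ℓ, u x = c + 1 / (2 * H) := by
    intro x hx
    have h1 : w x - c = 0 := (hL hx).self_of_nhds
    rw [hw] at h1
    have := cylinder_of_lineDist_eq_zero (n := n) (p := p) hH hx.2
    linarith
  obtain ⟨b, hbℓ, hbf⟩ : (ℓ ∩ frontier Ω).Nonempty := by
    by_contra hcon
    have hsub : ℓ ⊆ Ω := by
      refine convex_lineDist_eq_zero.isPreconnected.subset_of_closure_inter_subset hΩ
        ⟨p, lineDist_self, hp⟩ ?_
      rintro x ⟨hx, hxl⟩
      by_contra hxΩ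
      exact hcon ⟨x, hxl, hΩ.frontier_eq ▸ ⟨hx, hxΩ⟩⟩
    obtain ⟨R, hR⟩ := (hb.subset hsub).exists_norm_le
    set d : ℝ × ℝ := (-n.2, n.1) with hd
    have hd0 : 0 < ‖d‖ := norm_pos_iff.2 fun h0 => by
      have h1 : -n.2 = 0 := congrArg Prod.fst h0
      have h2 : n.1 = 0 := congrArg Prod.snd h0
      nlinarith
    have hRp := hR p lineDist_self
    have hp0 := norm_nonneg p
    have hmem : p + ((R + ‖p‖ + 1) / ‖d‖) • d ∈ ℓ := by
      simp only [hℓ, hd, mem_ofPred_eq, lineDist, Prod.fst_add, Prod.snd_add, Prod.smul_fst,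
        Prod.smul_snd, smul_eq_mul]
      ring
    have h1 := hR _ hmem
    have h2 : ‖((R + ‖p‖ + 1) / ‖d‖) • d‖ = R + ‖p‖ + 1 := by
      rw [norm_smul, norm_of_nonneg (div_nonneg (by linarith) hd0.le), div_mul_cancel₀ _ hd0.ne']
    have h3 := norm_sub_le (p + ((R + ‖p‖ + 1) / ‖d‖) • d) p
    rw [add_sub_cancel_left, h2] at h3
    linarith
  have hseg : openSegment ℝ p b ⊆ Ω := by
    have := hc.openSegment_interior_closure_subset_interior (hΩ.interior_eq.symm ▸ hp)
      (frontier_subset_closure hbf)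
    rwa [hΩ.interior_eq] at this
  have hcl : segment ℝ p b ⊆ closure Ω := by
    rw [← closure_openSegment]; exact closure_mono hseg
  have hc0 : c + 1 / (2 * H) = 0 := by
    have hEq : EqOn u (fun _ => c + 1 / (2 * H)) (segment ℝ p b) := by
      refine EqOn.of_subset_closure (s := openSegment ℝ p b) (fun x hx => huL x ⟨hseg hx, ?_⟩)
        (h.1.continuousOn.mono hcl) continuousOn_const (openSegment_subset_segment ℝ p b)
        (closure_openSegment p b).ge
      exact convex_lineDist_eq_zero.openSegment_subset lineDist_self hbℓ hx
    exact (hEq (right_mem_segment ℝ p b)).symm.trans (h.2.2.2 b hbf)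
  have hcont : Filter.Tendsto (fun s : ℝ => p + s • n) (nhdsWithin 0 (Ioi 0)) (nhds p) := by
    have : Continuous fun s : ℝ => p + s • n := by fun_prop
    simpa using (this.tendsto 0).mono_left nhdsWithin_le_nhds
  obtain ⟨s, ⟨hs1, hs2⟩, hs0 : 0 < s⟩ := ((hcont.eventually hpW).and
    (hcont.eventually (hΩ.mem_nhds hp))).and self_mem_nhdsWithin |>.exists
  have h1 := h.nonpos hΩ hb hH hs2
  have h2 : lineDist n p (p + s • n) = s := by
    simp only [lineDist, Prod.fst_add, Prod.snd_add, Prod.smul_fst, Prod.smul_snd, smul_eq_mul]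
    linear_combination s * hn
  have h3 := cylinder_sq (n := n) (p := p) (x := p + s • n) hH
  rw [hw] at hs1
  rw [h2] at h3
  have h4 : (1 / (2 * H)) ^ 2 = 1 / (4 * H ^ 2) := by field_simp; ring
  have h5 : 0 < 1 / (2 * H) := by positivity
  have h6 := cylinder_pos (n := n) (p := p) (x := p + s • n) hH
  nlinarith

end Comparison

section Arms

variable {Ω : Set (ℝ × ℝ)} {H c : ℝ} {u : ℝ × ℝ → ℝ} {n p q x : ℝ × ℝ}

lemma lineDist_neg : lineDist (-n) p x = - lineDist n p x := by simp [lineDist]; ring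

lemma cylinder_neg : cylinder H (-n) p x = cylinder H n p x := by
  simp [cylinder, lineDist_neg]

/-- Half of the cap cut off from `Ω` by the level `-c` of the cylinder. -/
def capSide (Ω : Set (ℝ × ℝ)) (H c : ℝ) (n p : ℝ × ℝ) : Set (ℝ × ℝ) :=
  {x ∈ Ω | √(c ^ 2 - 1 / (4 * H ^ 2)) < lineDist n p x}

lemma convex_capSide (hc : Convex ℝ Ω) : Convex ℝ (capSide Ω H c n p) :=
  hc.inter (convex_lineDist _)

lemma lt_cylinder_iff (hH : 0 < H) (hcH : c ≤ - (1 / (2 * H))) :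
    -c < cylinder H n p x ↔ √(c ^ 2 - 1 / (4 * H ^ 2)) < |lineDist n p x| := by
  have h5 : 0 < 1 / (2 * H) := by positivity
  have h4 : (1 / (2 * H)) ^ 2 = 1 / (4 * H ^ 2) := by field_simp; ring
  rw [← sqrt_sq_eq_abs, sqrt_lt_sqrt_iff (by nlinarith), cylinder, lt_sqrt (by linarith)]
  constructor <;> intro h <;> nlinarith

lemma JoinedIn.of_convex {S T : Set (ℝ × ℝ)} (hS : Convex ℝ S) (hST : S ⊆ T) {a b : ℝ × ℝ}
    (ha : a ∈ S) (hb : b ∈ S) : JoinedIn T a b :=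
  ((hS.isPathConnected ⟨a, ha⟩).joinedIn a ha b hb).mono hST

lemma IsCMCSol.capSide_subset (h : IsCMCSol Ω H u) (hΩ : IsOpen Ω)
    (hb : Bornology.IsBounded Ω) (hH : 0 < H) (hcH : c ≤ - (1 / (2 * H))) :
    capSide Ω H c n p ⊆ {x ∈ Ω | u x - cylinder H n p x < c} := fun x hx => by
  have h1 := (lt_cylinder_iff (n := n) (p := p) (x := x) hH hcH).2 (hx.2.trans_le (le_abs_self _))
  have h2 := h.nonpos hΩ hb hH hx.1
  exact ⟨hx.1, by linarith⟩

/-- At a critical point, the sublevel set of the difference with the osculating cylinder joins the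
two sides of the cap only through the critical point. -/
lemma IsCMCSol.exists_arms (h : IsCMCSol Ω H u) (hΩ : IsOpen Ω) (hc : Convex ℝ Ω)
    (hb : Bornology.IsBounded Ω) (hH : 0 < H) (hn : n.1 ^ 2 + n.2 ^ 2 = 1) (hp : p ∈ Ω)
    (hp1 : dd (1, 0) u p = 0) (hp2 : dd (0, 1) u p = 0) (hcp : c = u p - 1 / (2 * H)) :
    ∃ t ∈ capSide Ω H c n p, ∃ b ∈ capSide Ω H c (-n) p,
      JoinedIn (insert p {x ∈ Ω | u x - cylinder H n p x < c}) t b ∧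
      ¬ JoinedIn ({x ∈ Ω | u x - cylinder H n p x ≤ c} \ {p}) t b := by
  obtain ⟨A11, A12, A22, B1, B2, ⟨s11, s12, s22, sB1, sB2⟩, e1, e2, hdiv, hnn, hdef, iso⟩ :=
    exists_linearization (p := p) hΩ hH hn h.smooth h.2.1 h.2.2.1 rfl
  set w : ℝ × ℝ → ℝ := fun x => u x - cylinder H n p x with hw
  have E : EllipticEq Ω w A11 A12 A22 B1 B2 :=
    ⟨h.smooth.sub (contDiff_cylinder hH).contDiffOn, s11, s12, s22, sB1, sB2, e1, e2, hdiv, hnn,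
      hdef⟩
  have hwc : ContinuousOn w (closure Ω) :=
    h.1.continuousOn.sub (contDiff_cylinder hH).continuous.continuousOn
  have hcH : c ≤ - (1 / (2 * H)) := by linarith [h.nonpos hΩ hb hH hp]
  have hwp : w p = c := by
    rw [hw, hcp]; simp only [cylinder_of_lineDist_eq_zero hH lineDist_self]
  have hdw : ∀ v, dd v (fun x => w x - c) p = dd v u p := fun v => by
    rw [dd_sub (diffAt_of_smooth hΩ E.smooth hp) (differentiableAt_const _), dd_const, sub_zero,
      hw, dd_sub_cylinder hΩ h.smooth hH hp lineDist_self]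
  obtain ⟨h11, h12, h22⟩ := iso p hp hp1 hp2 lineDist_self
  obtain ⟨e, τ, θ, ε, hτ, hτ2, hε, he, hsec⟩ := (E.sub_const hΩ c).exists_sectors hΩ hp h11 h12 h22
    (by simp [hwp]) (by rw [hdw, hp1]) (by rw [hdw, hp2])
    (h.not_flat hΩ hc hb hH hn hw E iso hp)
  set S := {x ∈ Ω | w x < c} with hS
  set T := {x ∈ Ω | w x ≤ c} \ {p} with hT
  have hST : S ⊆ T := fun x hx => ⟨⟨hx.1, hx.2.le⟩, by rintro rfl; exact hx.2.ne hwp⟩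
  have hεmem : ε ∈ Ioc 0 ε := ⟨hε, le_rfl⟩
  have arm : ∀ k : ℕ, (∀ s ∈ Ioc 0 ε, p + s • e k ∈ Ω ∧ w (p + s • e k) - c < 0) →
      p + ε • e k ∈ S ∧ JoinedIn (insert p S) p (p + ε • e k) := by
    intro k hk
    have hkS : ∀ s ∈ Ioc 0 ε, p + s • e k ∈ S := fun s hs => ⟨(hk s hs).1, by linarith [(hk s hs).2]⟩
    refine ⟨hkS ε hεmem, JoinedIn.of_convex (convex_segment p (p + ε • e k)) ?_
      (left_mem_segment ..) (right_mem_segment ..)⟩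
    rintro x hx
    rw [segment_eq_image'] at hx
    obtain ⟨s, hs, rfl⟩ := hx
    rcases hs.1.eq_or_lt with rfl | hs0
    · simp
    · right
      have := hkS (s * ε) ⟨by positivity, mul_le_of_le_one_left hε.le hs.2⟩
      simpa [mul_smul] using this
  have escape : ∀ a ∈ S, ∃ y ∈ capSide Ω H c n p ∪ capSide Ω H c (-n) p, JoinedIn S a y := by
    intro a ha
    obtain ⟨b, hbf, hbc, hbcl⟩ := E.neg.exists_frontier_of_lt (c := -c) hΩ hb hwc.neg ha.1
      (neg_lt_neg ha.2)
    have hSeq : {x ∈ Ω | -c < - w x} = S := by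
      ext x; simp [hS]
    rw [hSeq] at hbcl
    have hκ : √(c ^ 2 - 1 / (4 * H ^ 2)) < |lineDist n p b| := by
      rw [← lt_cylinder_iff hH hcH]
      simpa [hw, h.2.2.2 b hbf] using hbc
    rcases lt_abs.1 hκ with hκ | hκ
    · obtain ⟨y, hy, hyS⟩ := mem_closure_iff.1 hbcl _
        (isOpen_lt continuous_const (contDiff_lineDist (n := n) (p := p)).continuous) hκ
      exact ⟨y, Or.inl ⟨(pathComponentIn_subset hyS).1, hy⟩, hyS⟩
    · rw [← lineDist_neg] at hκ
      obtain ⟨y, hy, hyS⟩ := mem_closure_iff.1 hbcl _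
        (isOpen_lt continuous_const (contDiff_lineDist (n := -n) (p := p)).continuous) hκ
      exact ⟨y, Or.inr ⟨(pathComponentIn_subset hyS).1, hy⟩, hyS⟩
  obtain ⟨hP1, hj1⟩ := arm 1 fun s hs => (hsec s hs).2.1
  obtain ⟨hP3, hj3⟩ := arm 3 fun s hs => (hsec s hs).2.2.2
  have hsep : ¬ JoinedIn T (p + ε • e 1) (p + ε • e 3) := by
    intro hJ
    refine no_connection_between_sectors (V := {x ∈ Ω | c < w x}) (J := range hJ.somePath) hΩ hc hp
      (fun hpV => hpV.2.ne' hwp) hτ hτ2 hε he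
      (fun s hs => ⟨(hsec s hs).1.1, by linarith [(hsec s hs).1.2]⟩)
      (fun s hs => ⟨(hsec s hs).2.2.1.1, by linarith [(hsec s hs).2.2.1.2]⟩)
      (fun s hs => ⟨(hsec s hs).2.1.1, fun hV => by linarith [(hsec s hs).2.1.2, hV.2]⟩)
      (fun s hs => ⟨(hsec s hs).2.2.2.1, fun hV => by linarith [(hsec s hs).2.2.2.2, hV.2]⟩)
      (fun a ha => ?_) (isCompact_range hJ.somePath.continuous)
      (isPreconnected_range hJ.somePath.continuous) ?_ ?_ ⟨0, hJ.somePath.source⟩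
      ⟨1, hJ.somePath.target⟩
    · obtain ⟨b, hbf, hbc, hbcl⟩ := E.exists_frontier_of_lt hΩ hb hwc ha.1 ha.2
      have hbΩ : b ∉ Ω := by
        rw [hΩ.frontier_eq] at hbf; exact hbf.2
      refine ⟨insert b (pathComponentIn {x ∈ Ω | c < w x} a), b,
        (isPathConnected_pathComponentIn ha).isConnected.isPreconnected.subset_closure
          (subset_insert _ _) (insert_subset hbcl subset_closure),
        Or.inr (mem_pathComponentIn_self ha), Or.inl rfl, hbΩ, ?_⟩
      rintro x ⟨rfl | hx, hxΩ⟩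
      · exact absurd hxΩ hbΩ
      · exact pathComponentIn_subset hx
    · rintro _ ⟨s, rfl⟩
      have := hJ.somePath_mem s
      exact ⟨this.1.1, fun hV => not_lt.2 this.1.2 hV.2⟩
    · rintro ⟨s, hs⟩
      exact (hJ.somePath_mem s).2 hs
  obtain ⟨y1, hy1, hj1'⟩ := escape _ hP1
  obtain ⟨y3, hy3, hj3'⟩ := escape _ hP3
  have hQ : JoinedIn (insert p S) y1 y3 :=
    ((hj1'.symm.mono (subset_insert _ _)).trans hj1.symm).trans
      (hj3.trans (hj3'.mono (subset_insert _ _)))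
  have hR : ¬ JoinedIn T y1 y3 := fun hR =>
    hsep (((hj1'.mono hST).trans hR).trans (hj3'.symm.mono hST))
  have hsub := h.capSide_subset (n := n) (p := p) hΩ hb hH hcH
  have hsub' := h.capSide_subset (n := -n) (p := p) hΩ hb hH hcH
  simp only [cylinder_neg] at hsub'
  rcases hy1 with hy1 | hy1 <;> rcases hy3 with hy3 | hy3
  · exact absurd (JoinedIn.of_convex (convex_capSide hc) (hsub.trans hST) hy1 hy3) hR
  · exact ⟨y1, hy1, y3, hy3, hQ, hR⟩
  · exact ⟨y3, hy3, y1, hy1, hQ.symm, fun hj => hR hj.symm⟩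
  · exact absurd (JoinedIn.of_convex (convex_capSide hc) (hsub'.trans hST) hy1 hy3) hR

lemma capSide_anti (hΩ : ∀ x, lineDist n q x = lineDist n p x) {c' : ℝ} (h : c' ^ 2 ≥ c ^ 2) :
    capSide Ω H c' n q ⊆ capSide Ω H c n p := fun x hx =>
  ⟨hx.1, (sqrt_le_sqrt (by linarith)).trans_lt (hΩ x ▸ hx.2)⟩

lemma IsCMCSol.not_two_critical (h : IsCMCSol Ω H u) (hΩ : IsOpen Ω) (hc : Convex ℝ Ω)
    (hb : Bornology.IsBounded Ω) (hH : 0 < H) (hn : n.1 ^ 2 + n.2 ^ 2 = 1) (hp : p ∈ Ω)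
    (hp1 : dd (1, 0) u p = 0) (hp2 : dd (0, 1) u p = 0) (hq : q ∈ Ω)
    (hq1 : dd (1, 0) u q = 0) (hq2 : dd (0, 1) u q = 0) (hpq : lineDist n p q = 0)
    (hne : q ≠ p) (hle : u q ≤ u p) : False := by
  have hl : ∀ x, lineDist n q x = lineDist n p x := fun x => by
    simp only [lineDist] at hpq ⊢; linear_combination -hpq
  have hl' : ∀ x, lineDist (-n) q x = lineDist (-n) p x := fun x => by
    rw [lineDist_neg, lineDist_neg, hl]
  have hφ : ∀ x, cylinder H n q x = cylinder H n p x := fun x => by simp only [cylinder, hl]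
  obtain ⟨t, ht, b, hb', -, hsep⟩ := h.exists_arms hΩ hc hb hH hn hp hp1 hp2 rfl
  obtain ⟨t', ht', b', hb'', hj, -⟩ := h.exists_arms hΩ hc hb hH hn hq hq1 hq2 rfl
  simp only [hφ] at hj
  have hu0 := h.nonpos hΩ hb hH hp
  have hu1 := h.nonpos hΩ hb hH hq
  have hH0 : 0 < 1 / (2 * H) := by positivity
  have hsq : (u q - 1 / (2 * H)) ^ 2 ≥ (u p - 1 / (2 * H)) ^ 2 := by nlinarith
  have hwp : cylinder H n p p = 1 / (2 * H) := cylinder_of_lineDist_eq_zero hH lineDist_self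
  have hwq : cylinder H n p q = 1 / (2 * H) := cylinder_of_lineDist_eq_zero hH hpq
  have hsub := h.capSide_subset (n := n) (p := p) (c := u p - 1 / (2 * H)) hΩ hb hH (by linarith)
  have hsub' := h.capSide_subset (n := -n) (p := p) (c := u p - 1 / (2 * H)) hΩ hb hH (by linarith)
  simp only [cylinder_neg] at hsub'
  have hST : {x ∈ Ω | u x - cylinder H n p x < u p - 1 / (2 * H)} ⊆
      {x ∈ Ω | u x - cylinder H n p x ≤ u p - 1 / (2 * H)} \ {p} := fun x hx =>
    ⟨⟨hx.1, hx.2.le⟩, by rintro rfl; exact hx.2.ne (by rw [hwp])⟩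
  refine hsep (((JoinedIn.of_convex (convex_capSide hc) (hsub.trans hST) ht
    (capSide_anti hl hsq ht')).trans (hj.mono ?_)).trans
    (JoinedIn.of_convex (convex_capSide hc) (hsub'.trans hST) (capSide_anti hl' hsq hb'') hb'))
  rintro x (rfl | hx)
  · exact ⟨⟨hq, by rw [hwq]; linarith⟩, hne⟩
  · exact hST ⟨hx.1, by linarith [hx.2]⟩

lemma IsCMCSol.critical_unique (h : IsCMCSol Ω H u) (hΩ : IsOpen Ω) (hc : Convex ℝ Ω)
    (hb : Bornology.IsBounded Ω) (hH : 0 < H) (hp : p ∈ Ω)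
    (hp1 : dd (1, 0) u p = 0) (hp2 : dd (0, 1) u p = 0) (hq : q ∈ Ω)
    (hq1 : dd (1, 0) u q = 0) (hq2 : dd (0, 1) u q = 0) : q = p := by
  by_contra hne
  set r := √((q.1 - p.1) ^ 2 + (q.2 - p.2) ^ 2) with hr
  have hpos : 0 < (q.1 - p.1) ^ 2 + (q.2 - p.2) ^ 2 := by
    by_contra! hle
    exact hne (Prod.ext (by nlinarith) (by nlinarith))
  have hr0 : 0 < r := sqrt_pos.2 hpos
  have hr2 : r ^ 2 = (q.1 - p.1) ^ 2 + (q.2 - p.2) ^ 2 := sq_sqrt hpos.le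
  set n : ℝ × ℝ := (-(q.2 - p.2) / r, (q.1 - p.1) / r) with hn
  have hn1 : n.1 ^ 2 + n.2 ^ 2 = 1 := by
    simp only [hn]; field_simp; linear_combination -hr2
  have hpq : lineDist n p q = 0 := by
    simp only [hn, lineDist]; field_simp; ring
  have hqp : lineDist n q p = 0 := by
    simp only [lineDist] at hpq ⊢; linear_combination -hpq
  rcases le_total (u q) (u p) with hle | hle
  · exact h.not_two_critical hΩ hc hb hH hn1 hp hp1 hp2 hq hq1 hq2 hpq hne hle
  · exact h.not_two_critical hΩ hc hb hH hn1 hq hq1 hq2 hp hp1 hp2 hqp (Ne.symm hne) hle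

lemma IsCMCSol.exists_critical (h : IsCMCSol Ω H u) (hΩ : IsOpen Ω) (hb : Bornology.IsBounded Ω)
    (hne : Ω.Nonempty) (hH : 0 < H) : ∃ p ∈ Ω, dd (1, 0) u p = 0 ∧ dd (0, 1) u p = 0 := by
  have hcomp : IsCompact (closure Ω) := hb.isCompact_closure
  obtain ⟨p, hp, hmin⟩ := hcomp.exists_isMinOn hne.closure h.1.continuousOn
  by_cases hpΩ : p ∈ Ω
  · have : IsLocalMin u p := (hmin.on_subset subset_closure).isLocalMin (hΩ.mem_nhds hpΩ)
    refine ⟨p, hpΩ, ?_, ?_⟩ <;> simp [dd, this.fderiv_eq_zero]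
  · obtain ⟨a, ha⟩ := hne
    have hu0 : u p = 0 := h.2.2.2 p (hΩ.frontier_eq ▸ ⟨hp, hpΩ⟩)
    have hz : EqOn u (fun _ => 0) Ω := fun x hx =>
      le_antisymm (h.nonpos hΩ hb hH hx) (hu0 ▸ hmin (subset_closure hx))
    exact ⟨a, ha, by rw [dd_congr hΩ hz ha, dd_const], by rw [dd_congr hΩ hz ha, dd_const]⟩

lemma IsCMCSol.neg (h : IsCMCSol Ω H u) : IsCMCSol Ω (-H) fun x => - u x := by
  have e1 : pd1 (fun x => - u x) = fun x => - pd1 u x := funext fun x => dd_neg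
  have e2 : pd2 (fun x => - u x) = fun x => - pd2 u x := funext fun x => dd_neg
  have eg : gradSq (fun x => - u x) = gradSq u := funext fun x => by
    simp only [gradSq, e1, e2, neg_sq]
  refine ⟨h.1.neg, fun x hx => eg ▸ h.2.1 x hx, fun x hx => ?_, fun x hx => by
    simp [h.2.2.2 x hx]⟩
  have := h.2.2.1 x hx
  simp only [cmcDiv, e1, e2, eg, neg_div] at this ⊢
  simp only [pd1_eq_dd, pd2_eq_dd, dd_neg] at this ⊢
  linarith

end Arms

/-- Any solution of the spacelike CMC Dirichlet problem with `H ≠ 0` over a bounded open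
convex domain has exactly one critical point. -/
theorem unique_critical_point_of_cmc
    (Ω : Set (ℝ × ℝ)) (hΩo : IsOpen Ω) (hΩb : Bornology.IsBounded Ω)
    (hΩc : Convex ℝ Ω) (hΩne : Ω.Nonempty) (H : ℝ) (hH : H ≠ 0)
    (u : ℝ × ℝ → ℝ) (hu : IsCMCSol Ω H u) :
    ∃! p, p ∈ Ω ∧ pd1 u p = 0 ∧ pd2 u p = 0 := by
  have main : ∀ {K : ℝ} {v : ℝ × ℝ → ℝ}, 0 < K → IsCMCSol Ω K v →
      ∃! p, p ∈ Ω ∧ dd (1, 0) v p = 0 ∧ dd (0, 1) v p = 0 := by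
    intro K v hK hv
    obtain ⟨p, hp, hp1, hp2⟩ := hv.exists_critical hΩo hΩb hΩne hK
    exact ⟨p, ⟨hp, hp1, hp2⟩, fun q hq =>
      hv.critical_unique hΩo hΩc hΩb hK hp hp1 hp2 hq.1 hq.2.1 hq.2.2⟩
  rcases hH.lt_or_gt with hneg | hpos
  · rw [pd1_eq_dd, pd2_eq_dd]
    simpa only [dd_neg, neg_eq_zero] using main (neg_pos.2 hneg) hu.neg
  · exact main hpos hu
end

section
/- Let D ⊂ ℝ² be open and let u, v be smooth functions on D with |∇u| < 1 and |∇v| < 1 on D, both satisfying div(∇w/√(1−|∇w|²)) = 2H on D for the same constant H. For τ ∈ [0,1] set p(τ) = (1−τ)v_x + τu_x, q(τ) = (1−τ)v_y + τu_y, r(τ) = (1−τ)v_xx + τu_xx, s(τ) = (1−τ)v_xy + τu_xy, t(τ) = (1−τ)v_yy + τu_yy, and define a₁₁ = ∫₀¹(1−q²)dτ, a₁₂ = ∫₀¹ pq dτ, a₂₂ = ∫₀¹(1−p²)dτ, b₁ = −2∫₀¹[(pt − qs) − 3H√(1−p²−q²)·p]dτ, b₂ = −2∫₀¹[(qr − ps)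 − 3H√(1−p²−q²)·q]dτ. Then at every point of D one has p(τ)² + q(τ)² < 1 for all τ ∈ [0,1], the difference w = u − v satisfies a₁₁w_xx + 2a₁₂w_xy + a₂₂w_yy + b₁w_x + b₂w_y = 0, and the ellipticity inequality a₁₂² < a₁₁a₂₂ holds. -/
open Real Set

/-- `p(τ) = (1-τ)v_x + τu_x`. -/
noncomputable def pfun (u v : ℝ × ℝ → ℝ) (τ : ℝ) (x : ℝ × ℝ) : ℝ :=
  (1 - τ) * pd1 v x + τ * pd1 u x

/-- `q(τ) = (1-τ)v_y + τu_y`. -/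
noncomputable def qfun (u v : ℝ × ℝ → ℝ) (τ : ℝ) (x : ℝ × ℝ) : ℝ :=
  (1 - τ) * pd2 v x + τ * pd2 u x

/-- `r(τ) = (1-τ)v_xx + τu_xx`. -/
noncomputable def rfun (u v : ℝ × ℝ → ℝ) (τ : ℝ) (x : ℝ × ℝ) : ℝ :=
  (1 - τ) * pd1 (pd1 v) x + τ * pd1 (pd1 u) x

/-- `s(τ) = (1-τ)v_xy + τu_xy`. -/
noncomputable def sfun (u v : ℝ × ℝ → ℝ) (τ : ℝ) (x : ℝ × ℝ) : ℝ :=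
  (1 - τ) * pd2 (pd1 v) x + τ * pd2 (pd1 u) x

/-- `t(τ) = (1-τ)v_yy + τu_yy`. -/
noncomputable def tfun (u v : ℝ × ℝ → ℝ) (τ : ℝ) (x : ℝ × ℝ) : ℝ :=
  (1 - τ) * pd2 (pd2 v) x + τ * pd2 (pd2 u) x

/-- `a₁₁ = ∫₀¹ (1 - q²) dτ`. -/
noncomputable def a11 (u v : ℝ × ℝ → ℝ) (x : ℝ × ℝ) : ℝ :=
  ∫ τ in (0:ℝ)..1, (1 - (qfun u v τ x)^2)

/-- `a₁₂ = ∫₀¹ pq dτ`. -/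
noncomputable def a12 (u v : ℝ × ℝ → ℝ) (x : ℝ × ℝ) : ℝ :=
  ∫ τ in (0:ℝ)..1, pfun u v τ x * qfun u v τ x

/-- `a₂₂ = ∫₀¹ (1 - p²) dτ`. -/
noncomputable def a22 (u v : ℝ × ℝ → ℝ) (x : ℝ × ℝ) : ℝ :=
  ∫ τ in (0:ℝ)..1, (1 - (pfun u v τ x)^2)

/-- `b₁ = -2∫₀¹ [(pt - qs) - 3H√(1-p²-q²) p] dτ`. -/
noncomputable def b1 (H : ℝ) (u v : ℝ × ℝ → ℝ) (x : ℝ × ℝ) : ℝ :=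
  -2 * ∫ τ in (0:ℝ)..1, ((pfun u v τ x * tfun u v τ x - qfun u v τ x * sfun u v τ x)
    - 3 * H * Real.sqrt (1 - (pfun u v τ x)^2 - (qfun u v τ x)^2) * pfun u v τ x)

/-- `b₂ = -2∫₀¹ [(qr - ps) - 3H√(1-p²-q²) q] dτ`. -/
noncomputable def b2 (H : ℝ) (u v : ℝ × ℝ → ℝ) (x : ℝ × ℝ) : ℝ :=
  -2 * ∫ τ in (0:ℝ)..1, ((qfun u v τ x * rfun u v τ x - pfun u v τ x * sfun u v τ x)
    - 3 * H * Real.sqrt (1 - (pfun u v τ x)^2 - (qfun u v τ x)^2) * qfun u v τ x)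

theorem ContDiffAt.pd1 {f : ℝ × ℝ → ℝ} {x : ℝ × ℝ} (hf : ContDiffAt ℝ (⊤ : ℕ∞) f x) :
    ContDiffAt ℝ (⊤ : ℕ∞) (pd1 f) x :=
  (hf.fderiv_right (m := (⊤ : ℕ∞)) (by simp)).clm_apply contDiffAt_const

theorem ContDiffAt.pd2 {f : ℝ × ℝ → ℝ} {x : ℝ × ℝ} (hf : ContDiffAt ℝ (⊤ : ℕ∞) f x) :
    ContDiffAt ℝ (⊤ : ℕ∞) (pd2 f) x :=
  (hf.fderiv_right (m := (⊤ : ℕ∞)) (by simp)).clm_apply contDiffAt_const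

theorem pd1_pd2_eq_pd2_pd1 {f : ℝ × ℝ → ℝ} {x : ℝ × ℝ} (hf : ContDiffAt ℝ (⊤ : ℕ∞) f x) :
    pd1 (pd2 f) x = pd2 (pd1 f) x := by
  have hd : DifferentiableAt ℝ (fderiv ℝ f) x :=
    (hf.fderiv_right (m := (⊤ : ℕ∞)) (by simp)).differentiableAt (by simp)
  have h (e e' : ℝ × ℝ) : fderiv ℝ (fun y => fderiv ℝ f y e) x e' =
      fderiv ℝ (fderiv ℝ f) x e' e := by
    rw [fderiv_clm_apply hd (differentiableAt_const e)]
    simp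
  have hs : IsSymmSndFDerivAt ℝ f x := hf.isSymmSndFDerivAt (by simpa using WithTop.coe_le_coe.2 (le_top : (2 : ℕ∞) ≤ ⊤))
  change fderiv ℝ (fun y => fderiv ℝ f y (0, 1)) x (1, 0) =
    fderiv ℝ (fun y => fderiv ℝ f y (1, 0)) x (0, 1)
  rw [h, h]
  exact hs _ _

theorem fderiv_div_sqrt_apply {g k : ℝ × ℝ → ℝ} {x : ℝ × ℝ} (hg : DifferentiableAt ℝ g x)
    (hk : DifferentiableAt ℝ k x) (hpos : 0 < k x) (e : ℝ × ℝ) :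
    fderiv ℝ (fun y => g y / √(k y)) x e * √(k x) ^ 3 =
      fderiv ℝ g x e * k x - g x * fderiv ℝ k x e / 2 := by
  have hs : 0 < √(k x) := Real.sqrt_pos.2 hpos
  have hsq : √(k x) ^ 2 = k x := Real.sq_sqrt hpos.le
  have h := hg.hasFDerivAt.mul
    ((hasDerivAt_inv hs.ne').comp_hasFDerivAt x (hk.hasFDerivAt.sqrt hpos.ne'))
  have h' : fderiv ℝ (fun y => g y / √(k y)) x = _ := h.fderiv
  rw [h']
  simp
  field_simp
  rw [hsq]
  ring

theorem fderiv_one_sub_gradSq_apply {f : ℝ × ℝ → ℝ} {x : ℝ × ℝ}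
    (hf : ContDiffAt ℝ (⊤ : ℕ∞) f x) (e : ℝ × ℝ) :
    DifferentiableAt ℝ (fun y => 1 - gradSq f y) x ∧
    fderiv ℝ (fun y => 1 - gradSq f y) x e =
      -2 * (pd1 f x * fderiv ℝ (pd1 f) x e + pd2 f x * fderiv ℝ (pd2 f) x e) := by
  have h1 : HasFDerivAt (pd1 f) _ x := (hf.pd1.differentiableAt (by simp)).hasFDerivAt
  have h2 : HasFDerivAt (pd2 f) _ x := (hf.pd2.differentiableAt (by simp)).hasFDerivAt
  have h : HasFDerivAt (fun y => 1 - gradSq f y) _ x := ((h1.pow 2).add (h2.pow 2)).const_sub 1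
  refine ⟨h.differentiableAt, ?_⟩
  rw [h.fderiv]
  simp
  ring

/-- The constant mean curvature equation in non-divergence form. -/
theorem cmcDiv_mul_sqrt_pow {f : ℝ × ℝ → ℝ} {x : ℝ × ℝ}
    (hf : ContDiffAt ℝ (⊤ : ℕ∞) f x) (hs : gradSq f x < 1) :
    cmcDiv f x * √(1 - gradSq f x) ^ 3 =
      (1 - pd2 f x ^ 2) * pd1 (pd1 f) x + 2 * (pd1 f x * pd2 f x) * pd2 (pd1 f) x
        + (1 - pd1 f x ^ 2) * pd2 (pd2 f) x := by
  have hpos : 0 < 1 - gradSq f x := sub_pos.2 hs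
  obtain ⟨hk, e1⟩ := fderiv_one_sub_gradSq_apply hf (1, 0)
  obtain ⟨-, e2⟩ := fderiv_one_sub_gradSq_apply hf (0, 1)
  have d1 := fderiv_div_sqrt_apply (hf.pd1.differentiableAt (by simp)) hk hpos (1, 0)
  have d2 := fderiv_div_sqrt_apply (hf.pd2.differentiableAt (by simp)) hk hpos (0, 1)
  rw [e1] at d1
  rw [e2] at d2
  have hsymm := pd1_pd2_eq_pd2_pd1 hf
  have hdiv : cmcDiv f x =
    fderiv ℝ (fun y => pd1 f y / √(1 - gradSq f y)) x (1, 0) +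
      fderiv ℝ (fun y => pd2 f y / √(1 - gradSq f y)) x (0, 1) := rfl
  rw [hdiv, add_mul, d1, d2]
  change pd1 (pd1 f) x * _ - _ * (-2 * (_ * pd1 (pd1 f) x + _ * pd1 (pd2 f) x)) / 2 +
    (pd2 (pd2 f) x * _ - _ * (-2 * (_ * pd2 (pd1 f) x + _ * pd2 (pd2 f) x)) / 2) = _
  rw [hsymm]
  simp only [gradSq]
  ring

theorem pd1_sub {f g : ℝ × ℝ → ℝ} {x : ℝ × ℝ} (hf : DifferentiableAt ℝ f x)
    (hg : DifferentiableAt ℝ g x) : pd1 (f - g) x = pd1 f x - pd1 g x := by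
  simp [pd1, fderiv_sub hf hg]

theorem pd2_sub {f g : ℝ × ℝ → ℝ} {x : ℝ × ℝ} (hf : DifferentiableAt ℝ f x)
    (hg : DifferentiableAt ℝ g x) : pd2 (f - g) x = pd2 f x - pd2 g x := by
  simp [pd2, fderiv_sub hf hg]

theorem sq_add_sq_segment_lt_one {a b c d τ : ℝ} (hab : a ^ 2 + b ^ 2 < 1)
    (hcd : c ^ 2 + d ^ 2 < 1) (hτ : τ ∈ Set.Icc (0 : ℝ) 1) :
    ((1 - τ) * a + τ * c) ^ 2 + ((1 - τ) * b + τ * d) ^ 2 < 1 := by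
  obtain ⟨h0, h1⟩ := hτ
  have hconv : ((1 - τ) * a + τ * c) ^ 2 + ((1 - τ) * b + τ * d) ^ 2 =
      (1 - τ) * (a ^ 2 + b ^ 2) + τ * (c ^ 2 + d ^ 2)
        - τ * (1 - τ) * ((a - c) ^ 2 + (b - d) ^ 2) := by ring
  have hnn : 0 ≤ τ * (1 - τ) * ((a - c) ^ 2 + (b - d) ^ 2) :=
    mul_nonneg (mul_nonneg h0 (sub_nonneg.2 h1)) (by positivity)
  rcases h0.eq_or_lt with rfl | h0
  · linarith
  · nlinarith [mul_lt_mul_of_pos_left hcd h0, mul_le_mul_of_nonneg_left hab.le (sub_nonneg.2 h1)]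

theorem integral_segment_mul_segment (a b c d : ℝ) :
    ∫ τ in (0 : ℝ)..1, ((1 - τ) * a + τ * c) * ((1 - τ) * b + τ * d) =
      (2 * a * b + a * d + c * b + 2 * c * d) / 6 := by
  have h (τ : ℝ) (_ : τ ∈ Set.uIcc (0 : ℝ) 1) : HasDerivAt
      (fun τ : ℝ => a * b * τ + (a * (d - b) + b * (c - a)) * τ ^ 2 / 2
        + (c - a) * (d - b) * τ ^ 3 / 3)
      (((1 - τ) * a + τ * c) * ((1 - τ) * b + τ * d)) τ := by
    have h1 := hasDerivAt_id' τ
    refine (((h1.const_mul (a * b)).add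
      (((h1.pow 2).const_mul (a * (d - b) + b * (c - a))).div_const 2)).add
      (((h1.pow 3).const_mul ((c - a) * (d - b))).div_const 3)).congr_deriv ?_
    norm_num
    ring
  rw [intervalIntegral.integral_eq_sub_of_hasDerivAt h
    (Continuous.intervalIntegrable (by fun_prop) _ _)]
  ring

theorem a12_sq_lt {u v : ℝ × ℝ → ℝ} {x : ℝ × ℝ} (hu : gradSq u x < 1) (hv : gradSq v x < 1) :
    a12 u v x ^ 2 < a11 u v x * a22 u v x := by
  have h1 (a c : ℝ) : ∫ τ in (0 : ℝ)..1, (1 - ((1 - τ) * a + τ * c) ^ 2) =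
      1 - (2 * a * a + a * c + c * a + 2 * c * c) / 6 := by
    rw [intervalIntegral.integral_sub (by simp)
      (Continuous.intervalIntegrable (by fun_prop) _ _), ← integral_segment_mul_segment]
    simp [sq]
  simp only [a11, a12, a22, pfun, qfun, gradSq] at *
  rw [h1, h1, integral_segment_mul_segment]
  generalize pd1 u x = c at *
  generalize pd2 u x = d at *
  generalize pd1 v x = a at *
  generalize pd2 v x = b at *
  nlinarith [sq_nonneg (a * d - c * b), sq_nonneg (a - c), sq_nonneg (b - d)]

/-- The derivative along the segment of the non-divergence form of the mean curvature operator. -/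
theorem hasDerivAt_segment_operator (H a b c d r₀ r₁ s₀ s₁ t₀ t₁ : ℝ) {τ : ℝ}
    (hpos : 0 < 1 - ((1 - τ) * a + τ * c) ^ 2 - ((1 - τ) * b + τ * d) ^ 2) :
    let p := fun τ : ℝ => (1 - τ) * a + τ * c
    let q := fun τ : ℝ => (1 - τ) * b + τ * d
    let r := fun τ : ℝ => (1 - τ) * r₀ + τ * r₁
    let s := fun τ : ℝ => (1 - τ) * s₀ + τ * s₁
    let t := fun τ : ℝ => (1 - τ) * t₀ + τ * t₁
    HasDerivAt
      (fun τ => (1 - q τ ^ 2) * r τ + 2 * (p τ * q τ) * s τ + (1 - p τ ^ 2) * t τ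
        - 2 * H * √(1 - p τ ^ 2 - q τ ^ 2) ^ 3)
      ((1 - q τ ^ 2) * (r₁ - r₀) + p τ * q τ * (2 * (s₁ - s₀)) + (1 - p τ ^ 2) * (t₁ - t₀)
        + ((p τ * t τ - q τ * s τ) - 3 * H * √(1 - p τ ^ 2 - q τ ^ 2) * p τ) * (-2 * (c - a))
        + ((q τ * r τ - p τ * s τ) - 3 * H * √(1 - p τ ^ 2 - q τ ^ 2) * q τ) * (-2 * (d - b)))
      τ := by
  intro p q r s t
  have hseg (m n : ℝ) : HasDerivAt (fun τ : ℝ => (1 - τ) * m + τ * n) (n - m) τ := by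
    have h1 := hasDerivAt_id' τ
    refine (((h1.const_sub 1).mul_const m).add (h1.mul_const n)).congr_deriv ?_
    ring
  have hp : HasDerivAt p (c - a) τ := hseg a c
  have hq : HasDerivAt q (d - b) τ := hseg b d
  have hr : HasDerivAt r (r₁ - r₀) τ := hseg r₀ r₁
  have hs : HasDerivAt s (s₁ - s₀) τ := hseg s₀ s₁
  have ht : HasDerivAt t (t₁ - t₀) τ := hseg t₀ t₁
  have hpos' : 0 < 1 - p τ ^ 2 - q τ ^ 2 := hpos
  have hW := (((hp.pow 2).const_sub 1).sub (hq.pow 2)).sqrt hpos'.ne'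
  refine ((((((hq.pow 2).const_sub 1).mul hr).add (((hp.mul hq).const_mul 2).mul hs)).add
    (((hp.pow 2).const_sub 1).mul ht)).sub ((hW.pow 3).const_mul (2 * H))).congr_deriv ?_
  have hw : 0 < √(1 - p τ ^ 2 - q τ ^ 2) := Real.sqrt_pos.2 hpos'
  simp
  field_simp
  ring

theorem integral_linear_combination {f₁ f₂ f₃ f₄ f₅ : ℝ → ℝ} (h₁ : Continuous f₁)
    (h₂ : Continuous f₂) (h₃ : Continuous f₃) (h₄ : Continuous f₄) (h₅ : Continuous f₅)
    (c₁ c₂ c₃ c₄ c₅ : ℝ) :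
    ∫ τ in (0 : ℝ)..1, (f₁ τ * c₁ + f₂ τ * c₂ + f₃ τ * c₃ + f₄ τ * c₄ + f₅ τ * c₅) =
      (∫ τ in (0 : ℝ)..1, f₁ τ) * c₁ + (∫ τ in (0 : ℝ)..1, f₂ τ) * c₂
        + (∫ τ in (0 : ℝ)..1, f₃ τ) * c₃ + (∫ τ in (0 : ℝ)..1, f₄ τ) * c₄
        + (∫ τ in (0 : ℝ)..1, f₅ τ) * c₅ := by
  simp only [← intervalIntegral.integral_mul_const]
  rw [intervalIntegral.integral_add, intervalIntegral.integral_add, intervalIntegral.integral_add,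
    intervalIntegral.integral_add] <;>
  exact Continuous.intervalIntegrable (by fun_prop) _ _

/-- The difference of two spacelike graphs of the same constant mean curvature satisfies a
homogeneous linear elliptic equation with the displayed coefficients. -/
theorem difference_satisfies_elliptic_equation
    (D : Set (ℝ × ℝ)) (hD : IsOpen D) (H : ℝ)
    (u v : ℝ × ℝ → ℝ)
    (hu : ContDiffOn ℝ (⊤ : ℕ∞) u D) (hv : ContDiffOn ℝ (⊤ : ℕ∞) v D)
    (hus : ∀ x ∈ D, gradSq u x < 1) (hvs : ∀ x ∈ D, gradSq v x < 1)
    (huc : ∀ x ∈ D, cmcDiv u x = 2 * H) (hvc : ∀ x ∈ D, cmcDiv v x = 2 * H) :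
    ∀ x ∈ D,
      (∀ τ ∈ Set.Icc (0:ℝ) 1, (pfun u v τ x)^2 + (qfun u v τ x)^2 < 1) ∧
      (a11 u v x * pd1 (pd1 (u - v)) x + 2 * a12 u v x * pd2 (pd1 (u - v)) x
        + a22 u v x * pd2 (pd2 (u - v)) x
        + b1 H u v x * pd1 (u - v) x + b2 H u v x * pd2 (u - v) x = 0) ∧
      (a12 u v x)^2 < a11 u v x * a22 u v x := by
  intro x hx
  have hDx : D ∈ nhds x := hD.mem_nhds hx
  have hux := hu.contDiffAt hDx
  have hvx := hv.contDiffAt hDx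
  have hseg (τ : ℝ) (hτ : τ ∈ Set.Icc (0 : ℝ) 1) : (pfun u v τ x) ^ 2 + (qfun u v τ x) ^ 2 < 1 :=
    sq_add_sq_segment_lt_one (hvs x hx) (hus x hx) hτ
  refine ⟨hseg, ?_, a12_sq_lt (hus x hx) (hvs x hx)⟩
  have hd : ∀ᶠ y in nhds x, DifferentiableAt ℝ u y ∧ DifferentiableAt ℝ v y := by
    filter_upwards [hD.mem_nhds hx] with y hy
    exact ⟨(hu.contDiffAt (hD.mem_nhds hy)).differentiableAt (by simp),
      (hv.contDiffAt (hD.mem_nhds hy)).differentiableAt (by simp)⟩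
  have e1 : pd1 (u - v) =ᶠ[nhds x] pd1 u - pd1 v := hd.mono fun y hy => pd1_sub hy.1 hy.2
  have e2 : pd2 (u - v) =ᶠ[nhds x] pd2 u - pd2 v := hd.mono fun y hy => pd2_sub hy.1 hy.2
  have du1 := hux.pd1.differentiableAt (by simp)
  have du2 := hux.pd2.differentiableAt (by simp)
  have dv1 := hvx.pd1.differentiableAt (by simp)
  have dv2 := hvx.pd2.differentiableAt (by simp)
  have e11 : pd1 (pd1 (u - v)) x = pd1 (pd1 u) x - pd1 (pd1 v) x := by
    rw [← pd1_sub du1 dv1, pd1, pd1, e1.fderiv_eq]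
  have e21 : pd2 (pd1 (u - v)) x = pd2 (pd1 u) x - pd2 (pd1 v) x := by
    rw [← pd2_sub du1 dv1, pd2, pd2, e1.fderiv_eq]
  have e22 : pd2 (pd2 (u - v)) x = pd2 (pd2 u) x - pd2 (pd2 v) x := by
    rw [← pd2_sub du2 dv2, pd2, pd2, e2.fderiv_eq]
  have hU := cmcDiv_mul_sqrt_pow hux (hus x hx)
  have hV := cmcDiv_mul_sqrt_pow hvx (hvs x hx)
  rw [huc x hx, gradSq, ← sub_sub] at hU
  rw [hvc x hx, gradSq, ← sub_sub] at hV
  have hftc := intervalIntegral.integral_eq_sub_of_hasDerivAt (a := 0) (b := 1)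
    (fun τ hτ => hasDerivAt_segment_operator H (pd1 v x) (pd2 v x) (pd1 u x) (pd2 u x)
      (pd1 (pd1 v) x) (pd1 (pd1 u) x) (pd2 (pd1 v) x) (pd2 (pd1 u) x)
      (pd2 (pd2 v) x) (pd2 (pd2 u) x) (τ := τ) (by
        rw [Set.uIcc_of_le zero_le_one] at hτ
        have := hseg τ hτ
        simp only [pfun, qfun] at this
        linarith)) (Continuous.intervalIntegrable (by fun_prop) _ _)
  rw [integral_linear_combination (by fun_prop) (by fun_prop) (by fun_prop) (by fun_prop)
    (by fun_prop)] at hftc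
  rw [e11, e21, e22, e1.self_of_nhds, e2.self_of_nhds]
  simp only [a11, a12, a22, b1, b2, pfun, qfun, rfun, sfun, tfun, Pi.sub_apply]
  norm_num at hftc
  linarith
end
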